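/- Let n ≥ 2 and N ≥ 1. Let K be a compact polynomially convex set in ℂⁿ, let L be a compact polynomially convex set in ℂᴺ, and let f : U → ℂⁿ be a holomorphic map on an open neighbourhood U ⊆ ℂᴺ of L such that f(z) ∈ ℂⁿ \ K for all z ∈ L. Then there exist an open set V with L ⊆ V ⊆ U and a holomorphic map F : V × ℂⁿ → ℂⁿ such that F(z,0) = f(z) for all z ∈ V, and for every z ∈ V the map F(z,·) : ℂⁿ → ℂⁿ is injective with image contained in ℂⁿ \ K. -/

import Mathlib

noncomputable section

/-- The polynomial hull of a set K ⊆ ℂⁿ. -/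
def polyHull {n : ℕ} (K : Set (EuclideanSpace ℂ (Fin n))) : Set (EuclideanSpace ℂ (Fin n)) :=
  {z | ∀ p : MvPolynomial (Fin n) ℂ, ∀ c : ℝ,
    (∀ w ∈ K, ‖MvPolynomial.eval (fun i => w i) p‖ ≤ c) →
      ‖MvPolynomial.eval (fun i => z i) p‖ ≤ c}

/-- A compact set is polynomially convex if it equals its polynomial hull. -/
def IsPolynomiallyConvex {n : ℕ} (K : Set (EuclideanSpace ℂ (Fin n))) : Prop :=
  polyHull K = K

section Auxiliary

set_option linter.unusedSectionVars false

open Set Metric Filter Topology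

/-- Weierstrass' theorem on normed spaces: a locally uniform limit of holomorphic maps is
holomorphic. -/
theorem differentiableOn_of_locally_tendstoUniformlyOn {E F : Type*} [NormedAddCommGroup E]
    [NormedSpace ℂ E] [NormedAddCommGroup F] [NormedSpace ℂ F] [CompleteSpace F]
    {U : Set E} {f : ℕ → E → F} {g : E → F}
    (hf : ∀ k, DifferentiableOn ℂ (f k) U)
    (h : ∀ x ∈ U, ∃ r > 0, ball x r ⊆ U ∧ TendstoUniformlyOn f g atTop (ball x r)) :
    DifferentiableOn ℂ g U := by
  intro x hx
  obtain ⟨r, hr, hrU, hlim⟩ := h x hx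
  have hd : ∀ k, DifferentiableOn ℂ (f k) (ball x r) := fun k => (hf k).mono hrU
  have hC : UniformCauchySeqOn (fun k => fderiv ℂ (f k)) atTop (ball x (r / 2)) := by
    rw [Metric.uniformCauchySeqOn_iff]
    intro ε hε
    have h1 := Metric.uniformCauchySeqOn_iff.1 hlim.uniformCauchySeqOn (ε * r / 16) (by positivity)
    obtain ⟨M, hM⟩ := h1
    refine ⟨M, fun m hm n hn y hy => ?_⟩
    have hsub : ball y (r / 2) ⊆ ball x r := by
      apply ball_subset_ball'
      have := mem_ball.1 hy
      linarith
    have hy' : y ∈ ball y (r / 2) := mem_ball_self (by positivity)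
    have key := Complex.norm_fderiv_le_div_of_mapsTo_ball (f := fun z => f m z - f n z) (c := y)
      (R₁ := r / 2) (R₂ := ε * r / 8) (((hd m).mono hsub).sub ((hd n).mono hsub)) (by
        intro z hz
        have a1 := hM m hm n hn z (hsub hz)
        have a2 := hM m hm n hn y (hsub hy')
        rw [dist_eq_norm] at a1 a2
        rw [mem_closedBall, dist_eq_norm]
        have := norm_sub_le (f m z - f n z) (f m y - f n y)
        linarith) (by positivity)
    have hm' : DifferentiableAt ℂ (f m) y :=
      (hd m).differentiableAt (isOpen_ball.mem_nhds (hsub hy'))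
    have hn' : DifferentiableAt ℂ (f n) y :=
      (hd n).differentiableAt (isOpen_ball.mem_nhds (hsub hy'))
    rw [dist_eq_norm, ← fderiv_fun_sub hm' hn']
    refine lt_of_le_of_lt key ?_
    rw [div_div_eq_mul_div, div_lt_iff₀ hr]
    nlinarith
  have hlim' : ∀ y ∈ ball x (r / 2), ∃ L, Tendsto (fun k => fderiv ℂ (f k) y) atTop (𝓝 L) :=
    fun y hy => cauchySeq_tendsto_of_complete (hC.cauchySeq hy)
  choose! g' hg' using hlim'
  have hu := hC.tendstoUniformlyOn_of_tendsto hg'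
  have := hasFDerivAt_of_tendstoUniformlyOn (isOpen_ball) hu
    (fun k y hy => ((hd k).differentiableAt (isOpen_ball.mem_nhds
      (ball_subset_ball (by linarith) hy))).hasFDerivAt)
    (fun y hy => hlim.tendsto_at (ball_subset_ball (by linarith) hy))
    (mem_ball_self (by positivity))
  exact this.differentiableAt.differentiableWithinAt

/-- Holomorphic dependence of an interval integral on a parameter. -/
theorem differentiableOn_intervalIntegral_param {E F : Type*} [NormedAddCommGroup E]
    [NormedSpace ℂ E] [ProperSpace E] [NormedAddCommGroup F] [NormedSpace ℂ F] [CompleteSpace F]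
    {U : Set E} (hU : IsOpen U) {a b : ℝ} {H : E → ℝ → F}
    (hc : ContinuousOn (Function.uncurry H) (U ×ˢ uIcc a b))
    (hd : ∀ t ∈ uIcc a b, DifferentiableOn ℂ (fun x => H x t) U) :
    DifferentiableOn ℂ (fun x => ∫ t in a..b, H x t) U := by
  intro x₀ hx₀
  obtain ⟨r, hr, hrU⟩ := Metric.nhds_basis_closedBall.mem_iff.1 (hU.mem_nhds hx₀)
  have hK : IsCompact (closedBall x₀ r ×ˢ uIcc a b) :=
    (isCompact_closedBall x₀ r).prod isCompact_uIcc
  have hcK : ContinuousOn (Function.uncurry H) (closedBall x₀ r ×ˢ uIcc a b) :=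
    hc.mono (prod_mono hrU Subset.rfl)
  obtain ⟨M, hM⟩ := hK.exists_bound_of_continuousOn hcK
  have hUC := hK.uniformContinuousOn_of_continuous hcK
  have hcx : ∀ x ∈ U, ContinuousOn (H x) (uIcc a b) := fun x hx =>
    hc.comp (f := fun t => (x, t)) (by fun_prop) (fun t ht => ⟨hx, ht⟩)
  have hF' : ContinuousOn (fun t => fderiv ℂ (fun x => H x t) x₀) (uIcc a b) := by
    rw [Metric.continuousOn_iff]
    intro s hs ε hε
    obtain ⟨δ, hδ, hδ'⟩ := Metric.uniformContinuousOn_iff.1 hUC (ε * r / 4) (by positivity)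
    refine ⟨δ, hδ, fun t ht hts => ?_⟩
    have hnear : ∀ x ∈ closedBall x₀ r, ‖H x t - H x s‖ < ε * r / 4 := by
      intro x hx
      rw [← dist_eq_norm]
      refine hδ' (x, t) ⟨hx, ht⟩ (x, s) ⟨hx, hs⟩ ?_
      rw [Prod.dist_eq, dist_self]
      simpa [hδ] using hts
    have hsub := ball_subset_closedBall.trans hrU
    have key := Complex.norm_fderiv_le_div_of_mapsTo_ball (f := fun x => H x t - H x s) (c := x₀)
      (R₁ := r) (R₂ := ε * r / 2) (((hd t ht).mono hsub).sub ((hd s hs).mono hsub)) (by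
        intro z hz
        have a1 := hnear z (ball_subset_closedBall hz)
        have a2 := hnear x₀ (mem_closedBall_self hr.le)
        rw [mem_closedBall, dist_eq_norm]
        have := norm_sub_le (H z t - H z s) (H x₀ t - H x₀ s)
        linarith) hr
    rw [dist_eq_norm, ← fderiv_fun_sub ((hd t ht).differentiableAt (hU.mem_nhds hx₀))
      ((hd s hs).differentiableAt (hU.mem_nhds hx₀))]
    refine lt_of_le_of_lt key ?_
    rw [div_lt_iff₀ hr]
    nlinarith
  have hsubI : uIoc a b ⊆ uIcc a b := uIoc_subset_uIcc
  have hres := intervalIntegral.hasFDerivAt_integral_of_dominated_loc_of_lip (𝕜 := ℂ)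
    (μ := MeasureTheory.volume) (F := H) (a := a) (b := b) (x₀ := x₀) (s := ball x₀ (r / 2))
    (F' := fun t => fderiv ℂ (fun x => H x t) x₀) (bound := fun _ => 4 * M / r)
    (ball_mem_nhds _ (by positivity))
    (by
      filter_upwards [hU.mem_nhds hx₀] with x hx
      exact ((hcx x hx).mono hsubI).aestronglyMeasurable measurableSet_uIoc)
    ((hcx x₀ hx₀).intervalIntegrable)
    ((hF'.mono hsubI).aestronglyMeasurable measurableSet_uIoc)
    (by
      refine Eventually.of_forall fun t ht => ?_
      have ht' := hsubI ht
      have hM0 : 0 ≤ M := (norm_nonneg _).trans (hM (x₀, t) ⟨mem_closedBall_self hr.le, ht'⟩)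
      refine LipschitzOnWith.of_dist_le_mul fun x hx y hy => ?_
      have hsub : ball y (r / 2) ⊆ closedBall x₀ r := by
        refine (ball_subset_ball' ?_).trans ball_subset_closedBall
        have := mem_ball.1 hy
        linarith
      have hcoe : ((Real.nnabs (4 * M / r) : NNReal) : ℝ) = 4 * M / r := by
        rw [Real.coe_nnabs, abs_of_nonneg (by positivity)]
      rw [hcoe]
      by_cases hxy : x ∈ ball y (r / 2)
      · have key := Complex.dist_le_div_mul_dist_of_mapsTo_ball (f := fun x => H x t) (c := y)
          (R₁ := r / 2) (R₂ := 2 * M) ((hd t ht').mono (hsub.trans hrU)) (by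
            intro z hz
            have a1 := hM (z, t) ⟨hsub hz, ht'⟩
            have a2 := hM (y, t) ⟨hsub (mem_ball_self (by positivity)), ht'⟩
            simp only [Function.uncurry] at a1 a2
            rw [mem_closedBall, dist_eq_norm]
            have := norm_sub_le (H z t) (H y t)
            linarith) hxy
        refine key.trans (le_of_eq ?_)
        field_simp
        ring
      · have hb : ball x₀ (r / 2) ⊆ closedBall x₀ r :=
          (ball_subset_ball (by linarith)).trans ball_subset_closedBall
        have a1 := hM (x, t) ⟨hb hx, ht'⟩
        have a2 := hM (y, t) ⟨hb hy, ht'⟩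
        simp only [Function.uncurry] at a1 a2
        have h3 : r / 2 ≤ dist x y := not_lt.1 hxy
        rw [dist_eq_norm (H x t)]
        have := norm_sub_le (H x t) (H y t)
        have h4 : 4 * M / r * (r / 2) ≤ 4 * M / r * dist x y :=
          mul_le_mul_of_nonneg_left h3 (by positivity)
        have h5 : 4 * M / r * (r / 2) = 2 * M := by field_simp; ring
        linarith)
    (by simp)
    (by
      refine Eventually.of_forall fun t ht => ?_
      exact ((hd t (hsubI ht)).differentiableAt (hU.mem_nhds hx₀)).hasFDerivAt)
  exact hres.2.differentiableAt.differentiableWithinAt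

theorem integral_line_inv_eq_log_sub_log {w v k : ℂ} {a b : ℝ}
    (h : ∀ x ∈ uIcc a b, 0 < (k * (w + x * v)).re) :
    ∫ x in a..b, v * (w + x * v)⁻¹ =
      Complex.log (k * (w + b * v)) - Complex.log (k * (w + a * v)) := by
  have hne : ∀ x ∈ uIcc a b, k * (w + x * v) ≠ 0 := fun x hx h0 => by
    have := h x hx
    rw [h0] at this
    simp at this
  refine intervalIntegral.integral_eq_sub_of_hasDerivAt
    (f := fun x : ℝ => Complex.log (k * (w + x * v))) (fun x hx => ?_) ?_
  · have h1 : HasDerivAt (fun x : ℝ => k * (w + (x : ℂ) * v)) (k * (1 * v)) x :=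
      (((Complex.ofRealCLM.hasDerivAt (x := x)).mul_const v).const_add w).const_mul k
    have h2 := h1.clog_real (Or.inl (h x hx))
    have hk : k ≠ 0 := left_ne_zero_of_mul (hne x hx)
    have he : v * (w + x * v)⁻¹ = k * (1 * v) / (k * (w + x * v)) := by
      rw [one_mul, mul_div_mul_left _ _ hk, div_eq_mul_inv]
    rw [he]
    exact h2
  · apply ContinuousOn.intervalIntegrable
    refine continuousOn_const.mul (ContinuousOn.inv₀ (by fun_prop) fun x hx => ?_)
    exact right_ne_zero_of_mul (hne x hx)

theorem log_I_mul_of_re_pos {z : ℂ} (hz : 0 < z.re) :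
    Complex.log (Complex.I * z) = Complex.log Complex.I + Complex.log z := by
  have hz0 : z ≠ 0 := fun h => by simp [h] at hz
  have := abs_lt.1 (Complex.abs_arg_lt_pi_div_two_iff.2 (Or.inl hz))
  refine Complex.log_mul Complex.I_ne_zero hz0 ?_
  rw [Complex.arg_I]
  constructor <;> linarith [Real.pi_pos]

theorem log_neg_I_mul_of_re_pos {z : ℂ} (hz : 0 < z.re) :
    Complex.log (-Complex.I * z) = Complex.log (-Complex.I) + Complex.log z := by
  have hz0 : z ≠ 0 := fun h => by simp [h] at hz
  have := abs_lt.1 (Complex.abs_arg_lt_pi_div_two_iff.2 (Or.inl hz))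
  refine Complex.log_mul (neg_ne_zero.2 Complex.I_ne_zero) hz0 ?_
  rw [Complex.arg_neg_I]
  constructor <;> linarith [Real.pi_pos]

theorem integral_boundary_rect_sub_inv {a b c d : ℝ} {t : ℂ}
    (ha : a < t.re) (hb : t.re < b) (hc : c < t.im) (hd : t.im < d) :
    (∫ x : ℝ in a..b, ((x + c * Complex.I) - t)⁻¹) - (∫ x : ℝ in a..b, ((x + d * Complex.I) - t)⁻¹)
      + Complex.I * (∫ y : ℝ in c..d, ((b + y * Complex.I) - t)⁻¹)
      - Complex.I * (∫ y : ℝ in c..d, ((a + y * Complex.I) - t)⁻¹) = 2 * Real.pi * Complex.I := by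
  have e1 := integral_line_inv_eq_log_sub_log (w := c * Complex.I - t) (v := 1) (k := Complex.I)
    (a := a) (b := b) (fun x _ => by simp; linarith)
  have e2 := integral_line_inv_eq_log_sub_log (w := d * Complex.I - t) (v := 1) (k := -Complex.I)
    (a := a) (b := b) (fun x _ => by simp; linarith)
  have e3 := integral_line_inv_eq_log_sub_log (w := b - t) (v := Complex.I) (k := 1)
    (a := c) (b := d) (fun x _ => by simp; linarith)
  have e4 := integral_line_inv_eq_log_sub_log (w := a - t) (v := Complex.I) (k := -1)
    (a := c) (b := d) (fun x _ => by simp; linarith)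
  rw [intervalIntegral.integral_const_mul] at e3 e4
  simp only [one_mul, mul_one] at e1 e2 e3 e4
  have g1 : ∀ x : ℝ, ((x : ℂ) + c * Complex.I) - t = c * Complex.I - t + x := fun x => by ring
  have g2 : ∀ x : ℝ, ((x : ℂ) + d * Complex.I) - t = d * Complex.I - t + x := fun x => by ring
  have g3 : ∀ y : ℝ, ((b : ℂ) + y * Complex.I) - t = b - t + y * Complex.I := fun x => by ring
  have g4 : ∀ y : ℝ, ((a : ℂ) + y * Complex.I) - t = a - t + y * Complex.I := fun x => by ring
  simp only [g1, g2, g3, g4]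
  rw [e1, e2, e3, e4]
  have f1 := log_I_mul_of_re_pos (z := c * Complex.I - t + b) (by simp; linarith)
  have f2 := log_neg_I_mul_of_re_pos (z := d * Complex.I - t + b) (by simp; linarith)
  have f3 := log_I_mul_of_re_pos (z := -(d * Complex.I - t + a)) (by simp; linarith)
  have f4 := log_neg_I_mul_of_re_pos (z := -(c * Complex.I - t + a)) (by simp; linarith)
  rw [mul_neg, neg_mul_eq_neg_mul] at f3
  rw [neg_mul_neg] at f4
  rw [f1, f2, f3, f4, Complex.log_I, Complex.log_neg_I]
  have k1 : (b : ℂ) - t + c * Complex.I = c * Complex.I - t + b := by ring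
  have k2 : (b : ℂ) - t + d * Complex.I = d * Complex.I - t + b := by ring
  have k3 : (-1 : ℂ) * (a - t + c * Complex.I) = -(c * Complex.I - t + a) := by ring
  have k4 : (-1 : ℂ) * (a - t + d * Complex.I) = -(d * Complex.I - t + a) := by ring
  rw [k1, k2, k3, k4]
  ring

/-- Cauchy's integral formula for a rectangle. -/
theorem integral_boundary_rect_div_sub {a b c d : ℝ} {t : ℂ} {g : ℂ → ℂ}
    (ha : a < t.re) (hb : t.re < b) (hc : c < t.im) (hd : t.im < d)
    (hg : DifferentiableOn ℂ g (Icc a b ×ℂ Icc c d)) :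
    (∫ x : ℝ in a..b, g (x + c * Complex.I) * ((x + c * Complex.I) - t)⁻¹)
      - (∫ x : ℝ in a..b, g (x + d * Complex.I) * ((x + d * Complex.I) - t)⁻¹)
      + Complex.I * (∫ y : ℝ in c..d, g (b + y * Complex.I) * ((b + y * Complex.I) - t)⁻¹)
      - Complex.I * (∫ y : ℝ in c..d, g (a + y * Complex.I) * ((a + y * Complex.I) - t)⁻¹)
      = 2 * Real.pi * Complex.I * g t := by
  have hab : a ≤ b := (ha.trans hb).le
  have hcd : c ≤ d := (hc.trans hd).le
  have hnhds : Icc a b ×ℂ Icc c d ∈ 𝓝 t := by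
    refine mem_of_superset ((isOpen_Ioo.reProdIm isOpen_Ioo).mem_nhds
      (⟨⟨ha, hb⟩, ⟨hc, hd⟩⟩ : t ∈ Ioo a b ×ℂ Ioo c d)) ?_
    exact Complex.reProdIm_subset_iff.2 (prod_mono Ioo_subset_Icc_self Ioo_subset_Icc_self)
  have hds := (Complex.differentiableOn_dslope hnhds).2 hg
  have h0 := Complex.integral_boundary_rect_eq_zero_of_differentiableOn (dslope g t)
    (⟨a, c⟩ : ℂ) (⟨b, d⟩ : ℂ) (by simpa [uIcc_of_le hab, uIcc_of_le hcd] using hds)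
  simp only [smul_eq_mul] at h0
  have hw := integral_boundary_rect_sub_inv ha hb hc hd
  have key : ∀ z : ℂ, z ≠ t → dslope g t z = g z * (z - t)⁻¹ - g t * (z - t)⁻¹ := by
    intro z hz
    rw [dslope_of_ne _ hz, slope_def_field]
    ring
  have nb : ∀ x : ℝ, (x : ℂ) + c * Complex.I ≠ t := fun x h => by
    have := congrArg Complex.im h
    simp at this
    linarith
  have nt : ∀ x : ℝ, (x : ℂ) + d * Complex.I ≠ t := fun x h => by
    have := congrArg Complex.im h
    simp at this
    linarith
  have nr : ∀ x : ℝ, (b : ℂ) + x * Complex.I ≠ t := fun x h => by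
    have := congrArg Complex.re h
    simp at this
    linarith
  have nl : ∀ x : ℝ, (a : ℂ) + x * Complex.I ≠ t := fun x h => by
    have := congrArg Complex.re h
    simp at this
    linarith
  have hgb : ContinuousOn (fun x : ℝ => g (x + c * Complex.I)) (uIcc a b) := by
    refine hg.continuousOn.comp (by fun_prop) fun x hx => ?_
    rw [uIcc_of_le hab] at hx
    simpa [Complex.mem_reProdIm, hcd] using hx
  have hgt : ContinuousOn (fun x : ℝ => g (x + d * Complex.I)) (uIcc a b) := by
    refine hg.continuousOn.comp (by fun_prop) fun x hx => ?_
    rw [uIcc_of_le hab] at hx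
    simpa [Complex.mem_reProdIm, hcd] using hx
  have hgr : ContinuousOn (fun x : ℝ => g (b + x * Complex.I)) (uIcc c d) := by
    refine hg.continuousOn.comp (by fun_prop) fun x hx => ?_
    rw [uIcc_of_le hcd] at hx
    simpa [Complex.mem_reProdIm, hab] using hx
  have hgl : ContinuousOn (fun x : ℝ => g (a + x * Complex.I)) (uIcc c d) := by
    refine hg.continuousOn.comp (by fun_prop) fun x hx => ?_
    rw [uIcc_of_le hcd] at hx
    simpa [Complex.mem_reProdIm, hab] using hx
  have split : ∀ (γ : ℝ → ℂ) (p q : ℝ), Continuous γ → (∀ x, γ x ≠ t) →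
      ContinuousOn (fun x => g (γ x)) (uIcc p q) →
      ∫ x in p..q, dslope g t (γ x) =
        (∫ x in p..q, g (γ x) * (γ x - t)⁻¹) - g t * ∫ x in p..q, (γ x - t)⁻¹ := by
    intro γ p q hγ hne hcont
    have hinv : Continuous fun x => (γ x - t)⁻¹ :=
      (hγ.sub continuous_const).inv₀ fun x => sub_ne_zero.2 (hne x)
    rw [← intervalIntegral.integral_const_mul, ← intervalIntegral.integral_sub]
    · exact intervalIntegral.integral_congr fun x _ => key _ (hne x)
    · exact (hcont.mul hinv.continuousOn).intervalIntegrable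
    · exact (continuous_const.mul hinv).intervalIntegrable _ _
  rw [split (fun x : ℝ => (x : ℂ) + c * Complex.I) a b (by fun_prop) nb hgb,
    split (fun x : ℝ => (x : ℂ) + d * Complex.I) a b (by fun_prop) nt hgt,
    split (fun x : ℝ => (b : ℂ) + x * Complex.I) c d (by fun_prop) nr hgr,
    split (fun x : ℝ => (a : ℂ) + x * Complex.I) c d (by fun_prop) nl hgl] at h0
  linear_combination h0 + g t * hw

section Several
variable {ι : Type*} [Fintype ι] [DecidableEq ι]

theorem differentiable_update_coord (i : ι) :
    Differentiable ℂ (fun q : (ι → ℂ) × ℂ => Function.update q.1 i q.2) := by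
  rw [differentiable_pi]
  intro m
  by_cases h : m = i
  · subst h
    simp only [Function.update_self]
    fun_prop
  · simp only [Function.update_of_ne h]
    fun_prop

theorem DifferentiableOn.update_const {H : (ι → ℂ) → ℂ} {W O : Set (ι → ℂ)} {i : ι} {c : ℂ}
    (hH : DifferentiableOn ℂ H W) (hO : ∀ x ∈ O, Function.update x i c ∈ W) :
    DifferentiableOn ℂ (fun x => H (Function.update x i c)) O := by
  refine hH.comp ?_ hO
  exact ((differentiable_update_coord i).comp
    (differentiable_id.prodMk (differentiable_const c))).differentiableOn

/-- Cauchy-type integrals in the coordinate `i` along a parametrized path are holomorphic. -/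
theorem differentiableOn_cauchy_path {H : (ι → ℂ) → ℂ} {W O : Set (ι → ℂ)} (hO : IsOpen O)
    (hH : DifferentiableOn ℂ H W) {i : ι} {γ φ : ℝ → ℂ} (hγ : Continuous γ) (hφ : Continuous φ)
    {k : (ι → ℂ) → ℝ → ℂ} {p q : ℝ}
    (hkc : ContinuousOn (Function.uncurry k) (O ×ˢ uIcc p q))
    (hkd : ∀ s ∈ uIcc p q, DifferentiableOn ℂ (fun x => k x s) O)
    (hm : ∀ x ∈ O, ∀ s ∈ uIcc p q, Function.update x i (γ s) ∈ W) :
    DifferentiableOn ℂ (fun x => ∫ s in p..q, φ s * (H (Function.update x i (γ s)) * k x s)) O := by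
  refine differentiableOn_intervalIntegral_param hO ?_ ?_
  · refine ContinuousOn.mul (by fun_prop) (ContinuousOn.mul ?_ hkc)
    refine hH.continuousOn.comp (f := fun y : (ι → ℂ) × ℝ => Function.update y.1 i (γ y.2)) ?_
      (fun y hy => hm y.1 hy.1 y.2 hy.2)
    exact ((differentiable_update_coord i).continuous.comp
      (continuous_fst.prodMk (hγ.comp continuous_snd))).continuousOn
  · intro s hs
    exact (differentiableOn_const _).mul
      ((hH.update_const (fun x hx => hm x hx s hs)).mul (hkd s hs))

/-- Additive splitting of a holomorphic function across a real hyperplane in one coordinate. -/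
theorem exists_split_across_line {H : (ι → ℂ) → ℂ} {W O : Set (ι → ℂ)} (hO : IsOpen O)
    (hH : DifferentiableOn ℂ H W) {i : ι} {κ : ℂ} (hκ : κ ≠ 0) {a b c d : ℝ} (hab : a ≤ b)
    (hcd : c ≤ d)
    (hm : ∀ x ∈ O, ∀ t ∈ Icc a b ×ℂ Icc c d, Function.update x i (κ * t) ∈ W) :
    ∃ H₁ H₂ : (ι → ℂ) → ℂ,
      DifferentiableOn ℂ H₁ (O ∩ {x | (κ⁻¹ * x i).re < b}) ∧
      DifferentiableOn ℂ H₂ (O ∩ {x | a < (κ⁻¹ * x i).re ∧ c < (κ⁻¹ * x i).im ∧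
        (κ⁻¹ * x i).im < d}) ∧
      ∀ x ∈ O, a < (κ⁻¹ * x i).re → (κ⁻¹ * x i).re < b → c < (κ⁻¹ * x i).im →
        (κ⁻¹ * x i).im < d → H x = H₁ x - H₂ x := by
  set I : (ℝ → ℂ) → ℝ → ℝ → (ι → ℂ) → ℂ := fun γ p q x =>
    ∫ s in p..q, H (Function.update x i (κ * γ s)) * (γ s - κ⁻¹ * x i)⁻¹ with hI
  have hcoord : Continuous fun x : ι → ℂ => κ⁻¹ * x i := by fun_prop
  have key : ∀ (γ : ℝ → ℂ) (p q : ℝ) (O' : Set (ι → ℂ)), IsOpen O' → O' ⊆ O → Continuous γ →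
      (∀ s ∈ uIcc p q, γ s ∈ Icc a b ×ℂ Icc c d) →
      (∀ x ∈ O', ∀ s ∈ uIcc p q, γ s - κ⁻¹ * x i ≠ 0) → DifferentiableOn ℂ (I γ p q) O' := by
    intro γ p q O' hO' hOO hγ hmem hne
    have := differentiableOn_cauchy_path (φ := fun _ => 1) (γ := fun s => κ * γ s) (p := p) (q := q)
      (k := fun x s => (γ s - κ⁻¹ * x i)⁻¹) (i := i) hO' hH (by fun_prop) continuous_const
      (by
        refine ContinuousOn.inv₀ (by fun_prop) ?_
        rintro ⟨x, s⟩ ⟨hx, hs⟩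
        exact hne x hx s hs)
      (fun s hs => DifferentiableOn.inv (by fun_prop) fun x hx => hne x hx s hs)
      (fun x hx s hs => hm x (hOO hx) _ (hmem s hs))
    simpa only [one_mul] using this
  refine ⟨fun x => (2 * Real.pi * Complex.I)⁻¹ *
      (Complex.I * I (fun y => b + y * Complex.I) c d x),
    fun x => -((2 * Real.pi * Complex.I)⁻¹ * (I (fun s => s + c * Complex.I) a b x
      - I (fun s => s + d * Complex.I) a b x - Complex.I * I (fun y => a + y * Complex.I) c d x)),
    ?_, ?_, ?_⟩
  · refine ((key _ _ _ _ (hO.inter ?_) inter_subset_left (by fun_prop) ?_ ?_).const_mul _).const_mul _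
    · exact isOpen_lt (Complex.continuous_re.comp hcoord) continuous_const
    · intro s hs
      rw [uIcc_of_le hcd] at hs
      simpa [Complex.mem_reProdIm, hab] using hs
    · rintro x ⟨-, hx⟩ s - h0
      have := congrArg Complex.re h0
      simp only [mem_ofPred_eq] at hx
      rw [Complex.sub_re] at this
      simp only [Complex.add_re, Complex.ofReal_re, Complex.re_ofReal_mul, Complex.I_re, mul_zero,
        add_zero, Complex.zero_re] at this
      linarith
  · have hop : IsOpen {x : ι → ℂ | a < (κ⁻¹ * x i).re ∧ c < (κ⁻¹ * x i).im ∧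
        (κ⁻¹ * x i).im < d} :=
      (isOpen_lt continuous_const (Complex.continuous_re.comp hcoord)).inter
        ((isOpen_lt continuous_const (Complex.continuous_im.comp hcoord)).inter
          (isOpen_lt (Complex.continuous_im.comp hcoord) continuous_const))
    refine (((((key _ _ _ _ (hO.inter hop) inter_subset_left (by fun_prop) ?_ ?_).sub
      (key _ _ _ _ (hO.inter hop) inter_subset_left (by fun_prop) ?_ ?_)).sub
      ((key _ _ _ _ (hO.inter hop) inter_subset_left (by fun_prop) ?_ ?_).const_mul _)).const_mul
      _)).neg
    · intro s hs
      rw [uIcc_of_le hab] at hs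
      simpa [Complex.mem_reProdIm, hcd] using hs
    · rintro x ⟨-, -, hx, -⟩ s - h0
      have := congrArg Complex.im h0
      rw [Complex.sub_im] at this
      simp only [Complex.add_im, Complex.ofReal_im, Complex.im_ofReal_mul, Complex.I_im, mul_one,
        zero_add, Complex.zero_im] at this
      linarith
    · intro s hs
      rw [uIcc_of_le hab] at hs
      simpa [Complex.mem_reProdIm, hcd] using hs
    · rintro x ⟨-, -, -, hx⟩ s - h0
      have := congrArg Complex.im h0
      rw [Complex.sub_im] at this
      simp only [Complex.add_im, Complex.ofReal_im, Complex.im_ofReal_mul, Complex.I_im, mul_one,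
        zero_add, Complex.zero_im] at this
      linarith
    · intro s hs
      rw [uIcc_of_le hcd] at hs
      simpa [Complex.mem_reProdIm, hab] using hs
    · rintro x ⟨-, hx, -, -⟩ s - h0
      have := congrArg Complex.re h0
      rw [Complex.sub_re] at this
      simp only [Complex.add_re, Complex.ofReal_re, Complex.re_ofReal_mul, Complex.I_re, mul_zero,
        add_zero, Complex.zero_re] at this
      linarith
  · intro x hx h1 h2 h3 h4
    have hg : DifferentiableOn ℂ (fun t => H (Function.update x i (κ * t)))
        (Icc a b ×ℂ Icc c d) := by
      refine hH.comp (f := fun t => Function.update x i (κ * t)) ?_ (fun t ht => hm x hx t ht)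
      exact ((differentiable_update_coord i).comp
        ((differentiable_const x).prodMk (differentiable_id.const_mul κ))).differentiableOn
    have := integral_boundary_rect_div_sub h1 h2 h3 h4 hg
    simp only [mul_inv_cancel_left₀ hκ, Function.update_eq_self] at this
    have hpi : (2 * Real.pi * Complex.I : ℂ) ≠ 0 := Complex.two_pi_I_ne_zero
    rw [sub_neg_eq_add, ← mul_add]
    refine ((inv_mul_eq_iff_eq_mul₀ hpi).2 ?_).symm
    rw [← this]
    simp only [hI]
    ring

/-- Division by `y j - p y` of a holomorphic function vanishing on `{y j = p y}`. -/
theorem exists_quotient_near {D p : (ι → ℂ) → ℂ} {j : ι} {x₀ : ι → ℂ}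
    (hp : ∀ y t, p (Function.update y j t) = p y) (hpd : Differentiable ℂ p)
    (hD : ∀ᶠ y in 𝓝 x₀, DifferentiableAt ℂ D y)
    (hv : ∀ᶠ y in 𝓝 x₀, y j = p y → D y = 0) :
    (∀ᶠ y in 𝓝 x₀, DifferentiableAt ℂ (fun y => if y j = p y then
      deriv (fun t => D (Function.update y j t)) (p y) else D y / (y j - p y)) y) ∧
    ∀ᶠ y in 𝓝 x₀, D y = (y j - p y) * (if y j = p y then
      deriv (fun t => D (Function.update y j t)) (p y) else D y / (y j - p y)) := by
  refine ⟨?_, ?_⟩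
  swap
  · filter_upwards [hv] with y hy
    split_ifs with h
    · rw [hy h, h, sub_self, zero_mul]
    · rw [mul_div_cancel₀ _ (sub_ne_zero.2 h)]
  have hpc := hpd.continuous
  by_cases hx : x₀ j = p x₀
  swap
  · have hne : ∀ᶠ y in 𝓝 x₀, y j ≠ p y :=
      (isOpen_ne_fun (continuous_apply j) hpc).mem_nhds hx
    have hne' := hne.eventually_nhds
    filter_upwards [hne', hD] with y hy hDy
    have : DifferentiableAt ℂ (fun y => D y / (y j - p y)) y := by
      simp only [div_eq_mul_inv]
      exact hDy.mul (DifferentiableAt.inv (by fun_prop) (sub_ne_zero.2 hy.self_of_nhds))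
    refine this.congr_of_eventuallyEq ?_
    filter_upwards [hy] with z hz
    rw [if_neg hz]
  · obtain ⟨ε, hε, hball⟩ := Metric.eventually_nhds_iff_ball.1 (hD.and hv)
    set δ := ε / 2 with hδ
    have hδ0 : 0 < δ := by positivity
    set O : Set (ι → ℂ) := ball x₀ δ ∩ {y | p y ∈ ball (x₀ j) δ} with hOdef
    have hO : IsOpen O := isOpen_ball.inter (isOpen_ball.preimage hpc)
    have hxO : x₀ ∈ O := ⟨mem_ball_self hδ0, by simp [← hx, hδ0]⟩
    have hup : ∀ y ∈ O, ∀ t ∈ closedBall (x₀ j) δ, Function.update y j t ∈ ball x₀ ε := by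
      intro y hy t ht
      have h1 : dist y x₀ < δ := hy.1
      refine lt_of_le_of_lt ((dist_pi_le_iff (r := δ) hδ0.le).2 fun m => ?_) (by linarith)
      by_cases hmj : m = j
      · subst hmj
        simpa using ht
      · rw [Function.update_of_ne hmj]
        exact (dist_le_pi_dist y x₀ m).trans h1.le
    have hDW : DifferentiableOn ℂ D (ball x₀ ε) := fun y hy =>
      (hball y hy).1.differentiableWithinAt
    have hgd : ∀ y ∈ O, DifferentiableOn ℂ (fun t => D (Function.update y j t))
        (closedBall (x₀ j) δ) := fun y hy => by
      refine hDW.comp (f := fun t => Function.update y j t) ?_ (hup y hy)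
      exact ((differentiable_update_coord j).comp
        ((differentiable_const y).prodMk differentiable_id)).differentiableOn
    have hz : ∀ y ∈ O, D (Function.update y j (p y)) = 0 := fun y hy => by
      refine (hball _ (hup y hy _ (ball_subset_closedBall hy.2))).2 ?_
      rw [hp, Function.update_self]
    have hyj : ∀ y ∈ O, y j ∈ ball (x₀ j) δ := fun y hy =>
      lt_of_le_of_lt (dist_le_pi_dist y x₀ j) hy.1
    have hcirc : ∀ y ∈ O, ∀ s : ℝ, circleMap (x₀ j) δ s - y j ≠ 0 ∧
        circleMap (x₀ j) δ s - p y ≠ 0 := by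
      intro y hy s
      have hs : circleMap (x₀ j) δ s ∈ sphere (x₀ j) δ := circleMap_mem_sphere _ hδ0.le s
      refine ⟨sub_ne_zero.2 fun h => ?_, sub_ne_zero.2 fun h => ?_⟩
      · have := hyj y hy
        rw [← h, mem_ball, mem_sphere.1 hs] at this
        exact lt_irrefl _ this
      · have := hy.2
        rw [mem_ofPred_eq, ← h, mem_ball, mem_sphere.1 hs] at this
        exact lt_irrefl _ this
    have hrep : ∀ y ∈ O, (if y j = p y then
        deriv (fun t => D (Function.update y j t)) (p y) else D y / (y j - p y)) =
        (2 * Real.pi * Complex.I)⁻¹ * ∫ s in (0 : ℝ)..2 * Real.pi,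
          deriv (circleMap (x₀ j) δ) s * (D (Function.update y j (circleMap (x₀ j) δ s)) *
          ((circleMap (x₀ j) δ s - p y)⁻¹ * (circleMap (x₀ j) δ s - y j)⁻¹)) := by
      intro y hy
      set g := dslope (fun t => D (Function.update y j t)) (p y) with hg
      have e1 : (if y j = p y then
        deriv (fun t => D (Function.update y j t)) (p y) else D y / (y j - p y)) = g (y j) := by
        split_ifs with h
        · rw [hg, h, dslope_same]
        · rw [hg, dslope_of_ne _ h, slope_def_field, hz y hy, Function.update_eq_self, sub_zero]
      have hgd' : DifferentiableOn ℂ g (closedBall (x₀ j) δ) :=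
        (Complex.differentiableOn_dslope (closedBall_mem_nhds_of_mem hy.2)).2 (hgd y hy)
      have e2 := hgd'.circleIntegral_sub_inv_smul (hyj y hy)
      rw [e1]
      symm
      refine (inv_mul_eq_iff_eq_mul₀ Complex.two_pi_I_ne_zero).2 ?_
      rw [smul_eq_mul] at e2
      rw [← e2]
      unfold circleIntegral
      refine intervalIntegral.integral_congr fun s _ => ?_
      have h1 := hcirc y hy s
      simp only [smul_eq_mul]
      rw [hg, dslope_of_ne _ (sub_ne_zero.1 h1.2), slope_def_field, hz y hy, sub_zero]
      ring
    have hdiff : DifferentiableOn ℂ (fun y : ι → ℂ => (2 * Real.pi * Complex.I)⁻¹ *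
        ∫ s in (0 : ℝ)..2 * Real.pi,
          deriv (circleMap (x₀ j) δ) s * (D (Function.update y j (circleMap (x₀ j) δ s)) *
          ((circleMap (x₀ j) δ s - p y)⁻¹ * (circleMap (x₀ j) δ s - y j)⁻¹))) O := by
      have hd : Continuous (deriv (circleMap (x₀ j) δ)) := by
        have : deriv (circleMap (x₀ j) δ) = fun s => circleMap 0 δ s * Complex.I := by
          ext s; rw [deriv_circleMap]
        rw [this]; fun_prop
      refine DifferentiableOn.const_mul (differentiableOn_cauchy_path hO hDW
        (continuous_circleMap _ _) hd ?_ ?_ ?_) _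
      · refine ContinuousOn.mul (ContinuousOn.inv₀ (by fun_prop) ?_)
          (ContinuousOn.inv₀ (by fun_prop) ?_)
        · rintro ⟨y, s⟩ ⟨hy, -⟩
          exact (hcirc y hy s).2
        · rintro ⟨y, s⟩ ⟨hy, -⟩
          exact (hcirc y hy s).1
      · intro s _
        exact (DifferentiableOn.inv (by fun_prop) fun y hy => (hcirc y hy s).2).mul
          (DifferentiableOn.inv (by fun_prop) fun y hy => (hcirc y hy s).1)
      · intro y hy s _
        exact hup y hy _ (circleMap_mem_closedBall _ hδ0.le s)
    filter_upwards [hO.mem_nhds hxO] with y hy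
    refine ((hdiff y hy).differentiableAt (hO.mem_nhds hy)).congr_of_eventuallyEq ?_
    filter_upwards [hO.mem_nhds hy] with z hz
    exact hrep z hz

end Several

/-- Induction over boxes: a property of boxes that holds for small boxes and is stable under gluing
along faces holds for every box. -/
theorem box_gluing_induction {κ : Type*} [Fintype κ] [DecidableEq κ]
    {P : (κ → ℝ) → (κ → ℝ) → Prop} {lo₀ hi₀ : κ → ℝ} {δ : ℝ} (hδ : 0 < δ)
    (small : ∀ lo hi, lo₀ ≤ lo → lo ≤ hi → hi ≤ hi₀ → (∀ k, hi k ≤ lo k + δ) → P lo hi)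
    (glue : ∀ lo hi k γ, lo₀ ≤ lo → lo ≤ hi → hi ≤ hi₀ → lo k ≤ γ → γ ≤ hi k →
      P lo (Function.update hi k γ) → P (Function.update lo k γ) hi → P lo hi)
    (h₀ : lo₀ ≤ hi₀) : P lo₀ hi₀ := by
  have main : ∀ S : Finset κ, ∀ lo hi, lo₀ ≤ lo → lo ≤ hi → hi ≤ hi₀ →
      (∀ k ∉ S, hi k ≤ lo k + δ) → P lo hi := by
    intro S
    induction S using Finset.induction_on with
    | empty => exact fun lo hi h1 h2 h3 h4 => small lo hi h1 h2 h3 fun k => h4 k (by simp)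
    | insert k S _ ih =>
      have inner : ∀ m : ℕ, ∀ lo hi, lo₀ ≤ lo → lo ≤ hi → hi ≤ hi₀ →
          (∀ l ∉ insert k S, hi l ≤ lo l + δ) → hi k ≤ lo k + m * δ → P lo hi := by
        intro m
        induction m with
        | zero =>
          intro lo hi h1 h2 h3 h4 h5
          refine ih lo hi h1 h2 h3 fun l hl => ?_
          by_cases hlk : l = k
          · subst hlk
            simp at h5
            linarith
          · exact h4 l (by simp [hlk, hl])
        | succ m ihm =>
          intro lo hi h1 h2 h3 h4 h5
          by_cases hs : hi k ≤ lo k + δ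
          · refine ih lo hi h1 h2 h3 fun l hl => ?_
            by_cases hlk : l = k
            · subst hlk
              exact hs
            · exact h4 l (by simp [hlk, hl])
          · push Not at hs
            have hk := h2 k
            refine glue lo hi k (lo k + δ) h1 h2 h3 (by linarith) hs.le ?_ ?_
            · refine ih _ _ h1 ?_ ?_ fun l hl => ?_
              · exact le_update_iff.2 ⟨by linarith, fun l _ => h2 l⟩
              · exact update_le_iff.2 ⟨by linarith [h3 k], fun l _ => h3 l⟩
              · by_cases hlk : l = k
                · subst hlk
                  simp
                · rw [Function.update_of_ne hlk]
                  exact h4 l (by simp [hlk, hl])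
            · refine ihm _ _ ?_ ?_ h3 (fun l hl => ?_) ?_
              · exact le_update_iff.2 ⟨by linarith [h1 k], fun l _ => h1 l⟩
              · exact update_le_iff.2 ⟨hs.le, fun l _ => h2 l⟩
              · have hlk : l ≠ k := fun h => hl (by simp [h])
                rw [Function.update_of_ne hlk]
                exact h4 l hl
              · rw [Function.update_self]
                push_cast at h5
                linarith
      intro lo hi h1 h2 h3 h4
      obtain ⟨m, hm⟩ := exists_nat_ge ((hi k - lo k) / δ)
      refine inner m lo hi h1 h2 h3 h4 ?_
      rw [div_le_iff₀ hδ] at hm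
      linarith
  exact main Finset.univ lo₀ hi₀ le_rfl h₀ le_rfl (by simp)

section Several
variable {ι : Type*}

/-- The real coordinates on `ι → ℂ`. -/
def realCoord (k : ι × Bool) (x : ι → ℂ) : ℝ := if k.2 then (x k.1).im else (x k.1).re

/-- Closed boxes in `ι → ℂ`. -/
def cbox (lo hi : ι × Bool → ℝ) : Set (ι → ℂ) :=
  {x | ∀ k, lo k ≤ realCoord k x ∧ realCoord k x ≤ hi k}

/-- `F` is holomorphic near every point of `Q`. -/
def HolNear {E G : Type*} [NormedAddCommGroup E] [NormedSpace ℂ E] [NormedAddCommGroup G]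
    [NormedSpace ℂ G] (F : E → G) (Q : Set E) : Prop :=
  ∀ x ∈ Q, ∀ᶠ y in 𝓝 x, DifferentiableAt ℂ F y

theorem HolNear.mono {E G : Type*} [NormedAddCommGroup E] [NormedSpace ℂ E] [NormedAddCommGroup G]
    [NormedSpace ℂ G] {F : E → G} {Q Q' : Set E} (h : HolNear F Q) (hQ : Q' ⊆ Q) : HolNear F Q' :=
  fun x hx => h x (hQ hx)

theorem continuous_realCoord (k : ι × Bool) : Continuous (realCoord k) := by
  unfold realCoord
  split_ifs <;> fun_prop

theorem isClosed_cbox (lo hi : ι × Bool → ℝ) : IsClosed (cbox lo hi) := by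
  simp only [cbox, ofPred_forall]
  exact isClosed_iInter fun k => (isClosed_le continuous_const (continuous_realCoord k)).inter
    (isClosed_le (continuous_realCoord k) continuous_const)

theorem cbox_mono {lo hi lo' hi' : ι × Bool → ℝ} (h1 : lo' ≤ lo) (h2 : hi ≤ hi') :
    cbox lo hi ⊆ cbox lo' hi' :=
  fun _ hx k => ⟨(h1 k).trans (hx k).1, (hx k).2.trans (h2 k)⟩

variable [Fintype ι]

theorem dist_le_of_realCoord {x y : ι → ℂ} {ε : ℝ} (hε : 0 ≤ ε)
    (h : ∀ k, |realCoord k x - realCoord k y| ≤ ε) : dist x y ≤ 2 * ε := by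
  refine (dist_pi_le_iff (by positivity)).2 fun m => ?_
  have h1 := h (m, false)
  have h2 := h (m, true)
  simp only [realCoord, Bool.false_eq_true, if_false, if_true] at h1 h2
  rw [dist_eq_norm]
  refine (Complex.norm_le_abs_re_add_abs_im _).trans ?_
  simp only [Complex.sub_re, Complex.sub_im]
  linarith

theorem isCompact_cbox (lo hi : ι × Bool → ℝ) : IsCompact (cbox lo hi) := by
  refine Metric.isCompact_of_isClosed_isBounded (isClosed_cbox lo hi) ?_
  refine (Metric.isBounded_iff_subset_closedBall (0 : ι → ℂ)).2
    ⟨2 * ∑ k, (|lo k| + |hi k|), fun x hx => ?_⟩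
  refine dist_le_of_realCoord (by positivity) fun k => ?_
  have h0 : realCoord k (0 : ι → ℂ) = 0 := by simp [realCoord]
  rw [h0, sub_zero]
  have h1 : |lo k| + |hi k| ≤ ∑ k, (|lo k| + |hi k|) :=
    Finset.single_le_sum (f := fun k => |lo k| + |hi k|) (fun _ _ => by positivity)
      (Finset.mem_univ k)
  refine le_trans (abs_le.2 ⟨?_, ?_⟩) h1
  · linarith [(hx k).1, neg_abs_le (lo k), abs_nonneg (hi k)]
  · linarith [(hx k).2, le_abs_self (hi k), abs_nonneg (lo k)]

theorem exists_widened_cbox_subset {lo hi : ι × Bool → ℝ} (h : lo ≤ hi) {W : Set (ι → ℂ)}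
    (hW : IsOpen W) (hsub : cbox lo hi ⊆ W) :
    ∃ ε > 0, cbox (fun k => lo k - ε) (fun k => hi k + ε) ⊆ W := by
  obtain ⟨δ, hδ, hδW⟩ := (isCompact_cbox lo hi).exists_cthickening_subset_open hW hsub
  refine ⟨δ / 2, by positivity, fun x hx => hδW ?_⟩
  let y : ι → ℂ := fun i => ⟨max (lo (i, false)) (min (hi (i, false)) (x i).re),
    max (lo (i, true)) (min (hi (i, true)) (x i).im)⟩
  have hy : ∀ k, realCoord k y = max (lo k) (min (hi k) (realCoord k x)) := by
    rintro ⟨i, b⟩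
    cases b <;> simp [realCoord, y]
  refine mem_cthickening_of_dist_le x y δ _ (fun k => ?_) ?_
  · rw [hy]
    exact ⟨le_max_left _ _, max_le (h k) (min_le_left _ _)⟩
  · have := dist_le_of_realCoord (x := x) (y := y) (ε := δ / 2) (by positivity) fun k => by
      rw [hy, abs_le]
      have h1 := hx k
      have h2 := h k
      simp only at h1
      rcases le_total (realCoord k x) (hi k) with h3 | h3
      · rw [min_eq_right h3]
        rcases le_total (realCoord k x) (lo k) with h4 | h4
        · rw [max_eq_left h4]
          constructor <;> linarith
        · rw [max_eq_right h4]
          constructor <;> linarith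
      · rw [min_eq_left h3, max_eq_right h2]
        constructor <;> linarith
    linarith

variable [DecidableEq ι]

/-- Cousin's splitting lemma for adjacent boxes. -/
theorem exists_split_cbox {lo hi : ι × Bool → ℝ} (hlh : lo ≤ hi) {k : ι × Bool} {γ : ℝ}
    {H : (ι → ℂ) → ℂ} (hH : HolNear H (cbox (Function.update lo k γ) (Function.update hi k γ))) :
    ∃ Ha Hb : (ι → ℂ) → ℂ, HolNear Ha (cbox lo (Function.update hi k γ)) ∧
      HolNear Hb (cbox (Function.update lo k γ) hi) ∧
      ∀ x ∈ cbox (Function.update lo k γ) (Function.update hi k γ),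
        ∀ᶠ y in 𝓝 x, H y = Ha y - Hb y := by
  obtain ⟨i, b⟩ := k
  obtain ⟨κ, hκ, c₀, d₀, hcd, hre, him⟩ : ∃ κ : ℂ, κ ≠ 0 ∧ ∃ c₀ d₀ : ℝ, c₀ ≤ d₀ ∧
      (∀ x : ι → ℂ, realCoord (i, b) x = (κ⁻¹ * x i).re) ∧
      ∀ (x : ι → ℂ) (ε : ℝ), (c₀ - ε ≤ (κ⁻¹ * x i).im ∧ (κ⁻¹ * x i).im ≤ d₀ + ε) ↔
        (lo (i, !b) - ε ≤ realCoord (i, !b) x ∧ realCoord (i, !b) x ≤ hi (i, !b) + ε) := by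
    cases b
    · exact ⟨1, one_ne_zero, lo (i, true), hi (i, true), hlh _, by simp [realCoord],
        by simp [realCoord]⟩
    · refine ⟨Complex.I, Complex.I_ne_zero, -hi (i, false), -lo (i, false), neg_le_neg (hlh _),
        by simp [realCoord], fun x ε => ?_⟩
      simp only [Complex.inv_I, realCoord, neg_mul, Complex.neg_im, Complex.I_mul_im, Bool.not_true,
        Bool.false_eq_true, if_false]
      constructor <;> rintro ⟨h1, h2⟩ <;> constructor <;> linarith
  set lo' := Function.update lo (i, b) γ with hlo'
  set hi' := Function.update hi (i, b) γ with hhi'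
  have hle : lo' ≤ hi' := by
    intro l
    by_cases hl : l = (i, b)
    · subst hl
      simp [hlo', hhi']
    · simp only [hlo', hhi', Function.update_of_ne hl]
      exact hlh l
  set W : Set (ι → ℂ) := {y | ∀ᶠ z in 𝓝 y, DifferentiableAt ℂ H z} with hW
  have hWo : IsOpen W := isOpen_setOfPred_eventually_nhds
  have hHW : DifferentiableOn ℂ H W := fun y hy => hy.self_of_nhds.differentiableWithinAt
  obtain ⟨ε, hε, hεW⟩ := exists_widened_cbox_subset hle hWo hH
  set O : Set (ι → ℂ) := {x | ∀ l : ι × Bool, l.1 ≠ i →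
    lo l - ε < realCoord l x ∧ realCoord l x < hi l + ε} with hO
  have hOo : IsOpen O := by
    simp only [hO, ofPred_forall]
    refine isOpen_iInter_of_finite fun l => isOpen_iInter_of_finite fun _ => ?_
    exact (isOpen_lt continuous_const (continuous_realCoord l)).inter
      (isOpen_lt (continuous_realCoord l) continuous_const)
  have hnb : (i, !b) ≠ (i, b) := by simp
  obtain ⟨H₁, H₂, h₁, h₂, h₁₂⟩ := exists_split_across_line hOo hHW (i := i) hκ (a := γ - ε)
    (b := γ + ε) (c := c₀ - ε) (d := d₀ + ε) (by linarith) (by linarith) (by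
      intro x hx t ht
      rw [Complex.mem_reProdIm] at ht
      refine hεW fun l => ?_
      by_cases hl : l.1 = i
      · obtain ⟨l, b'⟩ := l
        simp only at hl
        subst hl
        have e1 := hre (Function.update x l (κ * t))
        have e2 := (him (Function.update x l (κ * t)) ε)
        rw [Function.update_self, inv_mul_cancel_left₀ hκ] at e1 e2
        by_cases hb : b' = b
        · subst hb
          rw [e1]
          simpa [hlo', hhi'] using ht.1
        · have hb' : b' = !b := by cases b <;> cases b' <;> simp_all
          subst hb'
          simp only [hlo', hhi', Function.update_of_ne hnb]
          exact e2.1 ht.2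
      · have hl' : l ≠ (i, b) := fun h => hl (by rw [h])
        have : realCoord l (Function.update x i (κ * t)) = realCoord l x := by
          simp [realCoord, Function.update_of_ne hl]
        rw [this]
        simp only [hlo', hhi', Function.update_of_ne hl']
        exact ⟨(hx l hl).1.le, (hx l hl).2.le⟩)
  have hcoord : Continuous fun x : ι → ℂ => κ⁻¹ * x i := by fun_prop
  have ho1 : IsOpen {x : ι → ℂ | (κ⁻¹ * x i).re < γ + ε} :=
    isOpen_lt (Complex.continuous_re.comp hcoord) continuous_const
  have ho2 : IsOpen {x : ι → ℂ | γ - ε < (κ⁻¹ * x i).re ∧ c₀ - ε < (κ⁻¹ * x i).im ∧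
        (κ⁻¹ * x i).im < d₀ + ε} :=
      (isOpen_lt continuous_const (Complex.continuous_re.comp hcoord)).inter
        ((isOpen_lt continuous_const (Complex.continuous_im.comp hcoord)).inter
          (isOpen_lt (Complex.continuous_im.comp hcoord) continuous_const))
  have m1 : ∀ x ∈ cbox lo hi', x ∈ O ∩ {x : ι → ℂ | (κ⁻¹ * x i).re < γ + ε} := by
    intro x hx
    refine ⟨fun l hl => ?_, ?_⟩
    · have hl' : l ≠ (i, b) := fun h => hl (by rw [h])
      have := hx l
      simp only [hhi', Function.update_of_ne hl'] at this
      constructor <;> linarith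
    · have := (hx (i, b)).2
      rw [hre] at this
      simp only [hhi', Function.update_self] at this
      rw [mem_ofPred_eq]
      linarith
  have m2 : ∀ x ∈ cbox lo' hi, x ∈ O ∩ {x : ι → ℂ | γ - ε < (κ⁻¹ * x i).re ∧
      c₀ - ε < (κ⁻¹ * x i).im ∧ (κ⁻¹ * x i).im < d₀ + ε} := by
    intro x hx
    refine ⟨fun l hl => ?_, ?_, ?_⟩
    · have hl' : l ≠ (i, b) := fun h => hl (by rw [h])
      have := hx l
      simp only [hlo', Function.update_of_ne hl'] at this
      constructor <;> linarith
    · have := (hx (i, b)).1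
      rw [hre] at this
      simp only [hlo', Function.update_self] at this
      linarith
    · have h1 := hx (i, !b)
      simp only [hlo', Function.update_of_ne hnb] at h1
      have h2 := (him x 0).2 (by simpa using h1)
      constructor <;> linarith [h2.1, h2.2]
  refine ⟨H₁, H₂, fun x hx => ?_, fun x hx => ?_, fun x hx => ?_⟩
  · filter_upwards [(hOo.inter ho1).mem_nhds (m1 x hx)] with y hy
    exact (h₁ y hy).differentiableAt ((hOo.inter ho1).mem_nhds hy)
  · filter_upwards [(hOo.inter ho2).mem_nhds (m2 x hx)] with y hy
    exact (h₂ y hy).differentiableAt ((hOo.inter ho2).mem_nhds hy)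
  · have x1 : x ∈ O ∩ {x : ι → ℂ | (κ⁻¹ * x i).re < γ + ε} := by
      refine ⟨fun l hl => ?_, ?_⟩
      · have hl' : l ≠ (i, b) := fun h => hl (by rw [h])
        have := hx l
        simp only [hlo', hhi', Function.update_of_ne hl'] at this
        constructor <;> linarith
      · have := (hx (i, b)).2
        rw [hre] at this
        simp only [hhi', Function.update_self] at this
        rw [mem_ofPred_eq]
        linarith
    have x2 : γ - ε < (κ⁻¹ * x i).re ∧ c₀ - ε < (κ⁻¹ * x i).im ∧ (κ⁻¹ * x i).im < d₀ + ε := by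
      refine ⟨?_, ?_⟩
      · have := (hx (i, b)).1
        rw [hre] at this
        simp only [hlo', Function.update_self] at this
        linarith
      · have h1 := hx (i, !b)
        simp only [hlo', hhi', Function.update_of_ne hnb] at h1
        have h2 := (him x 0).2 (by simpa using h1)
        constructor <;> linarith [h2.1, h2.2]
    filter_upwards [(hOo.inter ho1).mem_nhds x1, ho2.mem_nhds x2] with y hy1 hy2
    exact h₁₂ y hy1.1 hy2.1 hy1.2 hy2.2.1 hy2.2.2

end Several

section Several
variable {ι : Type*} [Fintype ι] [DecidableEq ι]

/-- The graph over the coordinates outside `S` of the functions `p i`, `i ∈ S`. -/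
def partialGraph (p : ι → (ι → ℂ) → ℂ) (S : Finset ι) : Set (ι → ℂ) := {x | ∀ i ∈ S, x i = p i x}

/-- The retraction onto a partial graph. -/
def graphRetract (p : ι → (ι → ℂ) → ℂ) (S : Finset ι) (x : ι → ℂ) : ι → ℂ :=
  fun i => if i ∈ S then p i x else x i

theorem isClosed_partialGraph {p : ι → (ι → ℂ) → ℂ} (hpd : ∀ i, Differentiable ℂ (p i))
    (S : Finset ι) : IsClosed (partialGraph p S) := by
  simp only [partialGraph, ofPred_forall]
  exact isClosed_iInter fun i => isClosed_iInter fun _ =>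
    isClosed_eq (continuous_apply i) (hpd i).continuous

theorem differentiable_graphRetract {p : ι → (ι → ℂ) → ℂ} (hpd : ∀ i, Differentiable ℂ (p i))
    (S : Finset ι) : Differentiable ℂ (graphRetract p S) := by
  rw [differentiable_pi]
  intro i
  unfold graphRetract
  split_ifs
  · exact hpd i
  · fun_prop

theorem graphRetract_of_mem {p : ι → (ι → ℂ) → ℂ} {S : Finset ι} {x : ι → ℂ}
    (hx : x ∈ partialGraph p S) : graphRetract p S x = x := by
  ext i
  unfold graphRetract
  split_ifs with h
  · exact (hx i h).symm
  · rfl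

theorem apply_graphRetract {p : ι → (ι → ℂ) → ℂ} {J S : Finset ι} (hSJ : S ⊆ J)
    (hp : ∀ i x y, (∀ m ∉ J, x m = y m) → p i x = p i y) (i : ι) (x : ι → ℂ) :
    p i (graphRetract p S x) = p i x :=
  hp i _ _ fun m hm => by
    unfold graphRetract
    rw [if_neg fun h => hm (hSJ h)]

theorem graphRetract_mem {p : ι → (ι → ℂ) → ℂ} {J S : Finset ι} (hSJ : S ⊆ J)
    (hp : ∀ i x y, (∀ m ∉ J, x m = y m) → p i x = p i y) (x : ι → ℂ) :
    graphRetract p S x ∈ partialGraph p S := by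
  intro i hi
  rw [apply_graphRetract hSJ hp]
  simp [graphRetract, hi]

/-- The Oka extension property over boxes for the partial graph `S`. -/
def OkaExtends (p : ι → (ι → ℂ) → ℂ) (S : Finset ι) : Prop :=
  ∀ lo hi : ι × Bool → ℝ, lo ≤ hi → ∀ f : (ι → ℂ) → ℂ,
    HolNear f (cbox lo hi ∩ partialGraph p S) →
    ∃ F : (ι → ℂ) → ℂ, HolNear F (cbox lo hi) ∧
      ∀ x ∈ cbox lo hi ∩ partialGraph p S, ∀ᶠ y in 𝓝 x, y ∈ partialGraph p S → F y = f y

/-- `F` is holomorphic near the `S`-graph points of `Q` and agrees with `f` on the `S'`-graph. -/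
def IsPartialExtension (p : ι → (ι → ℂ) → ℂ) (S S' : Finset ι) (f F : (ι → ℂ) → ℂ)
    (Q : Set (ι → ℂ)) : Prop :=
  ∀ x ∈ Q, (x ∈ partialGraph p S → ∀ᶠ y in 𝓝 x, DifferentiableAt ℂ F y) ∧
    (x ∈ partialGraph p S' → ∀ᶠ y in 𝓝 x, y ∈ partialGraph p S' → F y = f y)

theorem eventually_differentiableAt_comp_graphRetract {p : ι → (ι → ℂ) → ℂ}
    (hpd : ∀ i, Differentiable ℂ (p i)) {S : Finset ι} {F : (ι → ℂ) → ℂ} {x : ι → ℂ}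
    (hx : x ∈ partialGraph p S) (hF : ∀ᶠ y in 𝓝 x, DifferentiableAt ℂ F y) :
    ∀ᶠ y in 𝓝 x, DifferentiableAt ℂ (fun y => F (graphRetract p S y)) y := by
  have hc := (differentiable_graphRetract hpd S).continuous.continuousAt (x := x)
  rw [ContinuousAt, graphRetract_of_mem hx] at hc
  filter_upwards [hc.eventually hF] with y hy
  exact hy.comp y (differentiable_graphRetract hpd S y)

theorem OkaExtends.glue {p : ι → (ι → ℂ) → ℂ} (hpd : ∀ i, Differentiable ℂ (p i))
    {J S : Finset ι} (hSJ : S ⊆ J) (hp : ∀ i x y, (∀ m ∉ J, x m = y m) → p i x = p i y)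
    (hS : OkaExtends p S) {j : ι} (hj : j ∈ J) (hjS : j ∉ S) {f Fa Fb : (ι → ℂ) → ℂ}
    {lo hi : ι × Bool → ℝ} (hlh : lo ≤ hi) {k : ι × Bool} {γ : ℝ}
    (hFa : IsPartialExtension p S (insert j S) f Fa (cbox lo (Function.update hi k γ)))
    (hFb : IsPartialExtension p S (insert j S) f Fb (cbox (Function.update lo k γ) hi))
    (hγ₁ : lo k ≤ γ) (hγ₂ : γ ≤ hi k) :
    ∃ F, IsPartialExtension p S (insert j S) f F (cbox lo hi) := by
  set ρ := graphRetract p S with hρ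
  have hρd : Differentiable ℂ ρ := differentiable_graphRetract hpd S
  have hρx : ∀ {x}, x ∈ partialGraph p S → Tendsto ρ (𝓝 x) (𝓝 x) := fun {x} hx => by
    have := hρd.continuous.continuousAt (x := x)
    rwa [ContinuousAt, hρ, graphRetract_of_mem hx] at this
  have hρj : ∀ y, ρ y j = y j := fun y => by simp [hρ, graphRetract, hjS]
  have hρp : ∀ y, p j (ρ y) = p j y := fun y => apply_graphRetract hSJ hp j y
  have hρm : ∀ y, ρ y ∈ partialGraph p S := graphRetract_mem hSJ hp
  have hρρ : ∀ y, ρ (ρ y) = ρ y := fun y => graphRetract_of_mem (hρm y)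
  have hins : ∀ {y}, y ∈ partialGraph p (insert j S) ↔ y j = p j y ∧ y ∈ partialGraph p S := by
    intro y
    simp [partialGraph]
  have hρins : ∀ y, y j = p j y → ρ y ∈ partialGraph p (insert j S) := fun y hy =>
    hins.2 ⟨by rw [hρj, hρp, hy], hρm y⟩
  set lo' := Function.update lo k γ with hlo'
  set hi' := Function.update hi k γ with hhi'
  have hlo : lo ≤ lo' := le_update_iff.2 ⟨hγ₁, fun _ _ => le_rfl⟩
  have hhi : hi' ≤ hi := update_le_iff.2 ⟨hγ₂, fun _ _ => le_rfl⟩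
  have hlh' : lo' ≤ hi' := by
    intro l
    by_cases hl : l = k
    · subst hl
      simp [hlo', hhi']
    · simp only [hlo', hhi', Function.update_of_ne hl]
      exact hlh l
  have hsa : cbox lo' hi' ⊆ cbox lo hi' := cbox_mono hlo le_rfl
  have hsb : cbox lo' hi' ⊆ cbox lo' hi := cbox_mono le_rfl hhi
  set D : (ι → ℂ) → ℂ := fun y => Fa (ρ y) - Fb (ρ y) with hD
  set h : (ι → ℂ) → ℂ := fun y => if y j = p j y then
      deriv (fun t => D (Function.update y j t)) (p j y) else D y / (y j - p j y) with hh
  have hq : ∀ x ∈ cbox lo' hi' ∩ partialGraph p S, (∀ᶠ y in 𝓝 x, DifferentiableAt ℂ h y) ∧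
      ∀ᶠ y in 𝓝 x, D y = (y j - p j y) * h y := by
    rintro x ⟨hx, hxS⟩
    refine exists_quotient_near (fun y t => hp j _ _ fun m hm => ?_) (hpd j) ?_ ?_
    · rw [Function.update_of_ne]
      rintro rfl
      exact hm hj
    · filter_upwards [eventually_differentiableAt_comp_graphRetract hpd hxS
        ((hFa x (hsa hx)).1 hxS), eventually_differentiableAt_comp_graphRetract hpd hxS
        ((hFb x (hsb hx)).1 hxS)] with y h1 h2
      exact h1.sub h2
    · by_cases hxj : x j = p j x
      · have hxi := hins.2 ⟨hxj, hxS⟩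
        filter_upwards [(hρx hxS).eventually ((hFa x (hsa hx)).2 hxi),
          (hρx hxS).eventually ((hFb x (hsb hx)).2 hxi)] with y h1 h2 hy
        rw [hD]
        simp only
        rw [h1 (hρins y hy), h2 (hρins y hy), sub_self]
      · filter_upwards [(isOpen_ne_fun (continuous_apply j) (hpd j).continuous).mem_nhds hxj]
          with y hy hy'
        exact absurd hy' hy
  obtain ⟨H, hHn, hHh⟩ := hS lo' hi' hlh' h fun x hx => (hq x hx).1
  obtain ⟨Ha, Hb, hHa, hHb, hHab⟩ := exists_split_cbox hlh hHn
  set Ea : (ι → ℂ) → ℂ := fun y => Fa (ρ y) - (y j - p j y) * Ha (ρ y) with hEa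
  set Eb : (ι → ℂ) → ℂ := fun y => Fb (ρ y) - (y j - p j y) * Hb (ρ y) with hEb
  have gen : ∀ {G K : (ι → ℂ) → ℂ} {Q : Set (ι → ℂ)},
      IsPartialExtension p S (insert j S) f G Q → HolNear K Q →
      IsPartialExtension p S (insert j S) f (fun y => G (ρ y) - (y j - p j y) * K (ρ y)) Q := by
    intro G K Q hG hK x hx
    refine ⟨fun hxS => ?_, fun hxi => ?_⟩
    · filter_upwards [eventually_differentiableAt_comp_graphRetract hpd hxS ((hG x hx).1 hxS),
        eventually_differentiableAt_comp_graphRetract hpd hxS (hK x hx)] with y h1 h2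
      exact h1.sub (DifferentiableAt.mul (DifferentiableAt.sub (by fun_prop) (hpd j y)) h2)
    · filter_upwards [(hG x hx).2 hxi] with y h1 hy
      have hy' := hins.1 hy
      have e : ρ y = y := graphRetract_of_mem hy'.2
      rw [e, h1 hy, hy'.1, sub_self, zero_mul, sub_zero]
  have ga := gen hFa hHa
  have gb := gen hFb hHb
  refine ⟨fun y => if realCoord k y ≤ γ then Ea y else Eb y, fun x hx => ?_⟩
  have hck := continuous_realCoord (ι := ι) k
  have memA : realCoord k x ≤ γ → x ∈ cbox lo hi' := fun hle l => by
    by_cases hl : l = k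
    · subst hl
      simpa [hhi', hle] using (hx l).1
    · simpa only [hhi', Function.update_of_ne hl] using hx l
  have memB : γ ≤ realCoord k x → x ∈ cbox lo' hi := fun hle l => by
    by_cases hl : l = k
    · subst hl
      simpa [hlo', hle] using (hx l).2
    · simpa only [hlo', Function.update_of_ne hl] using hx l
  have memAB : realCoord k x = γ → x ∈ cbox lo' hi' := fun he l => by
    by_cases hl : l = k
    · subst hl
      simp [hlo', hhi', he]
    · simpa only [hlo', hhi', Function.update_of_ne hl] using hx l
  rcases lt_trichotomy (realCoord k x) γ with hlt | heq | hgt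
  · have hev : ∀ᶠ y in 𝓝 x, (if realCoord k y ≤ γ then Ea y else Eb y) = Ea y := by
      filter_upwards [hck.continuousAt.eventually_lt continuousAt_const hlt] with y hy
      rw [if_pos hy.le]
    refine ⟨fun hxS => ?_, fun hxi => ?_⟩
    · filter_upwards [hev.eventually_nhds, (ga x (memA hlt.le)).1 hxS] with y h1 h2
      exact h2.congr_of_eventuallyEq h1
    · filter_upwards [hev, (ga x (memA hlt.le)).2 hxi] with y h1 h2 hy
      rw [h1]
      exact h2 hy
  · have hxAB := memAB heq
    refine ⟨fun hxS => ?_, fun hxi => ?_⟩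
    · have hev : ∀ᶠ y in 𝓝 x, (if realCoord k y ≤ γ then Ea y else Eb y) = Ea y := by
        filter_upwards [(hρx hxS).eventually (hq x ⟨hxAB, hxS⟩).2,
          (hρx hxS).eventually (hHh x ⟨hxAB, hxS⟩), (hρx hxS).eventually (hHab x hxAB)]
          with y h1 h2 h3
        split_ifs
        · rfl
        · have h4 := h2 (hρm y)
          rw [h3] at h4
          rw [hρj, hρp, ← h4] at h1
          simp only [hD, hρρ] at h1
          simp only [hEa, hEb]
          linear_combination -h1
      filter_upwards [hev.eventually_nhds, (ga x (hsa hxAB)).1 hxS] with y h1 h2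
      exact h2.congr_of_eventuallyEq h1
    · filter_upwards [(ga x (hsa hxAB)).2 hxi, (gb x (hsb hxAB)).2 hxi] with y h1 h2 hy
      split_ifs
      · exact h1 hy
      · exact h2 hy
  · have hev : ∀ᶠ y in 𝓝 x, (if realCoord k y ≤ γ then Ea y else Eb y) = Eb y := by
      filter_upwards [continuousAt_const.eventually_lt hck.continuousAt hgt] with y hy
      rw [if_neg (not_le.2 hy)]
    refine ⟨fun hxS => ?_, fun hxi => ?_⟩
    · filter_upwards [hev.eventually_nhds, (gb x (memB hgt.le)).1 hxS] with y h1 h2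
      exact h2.congr_of_eventuallyEq h1
    · filter_upwards [hev, (gb x (memB hgt.le)).2 hxi] with y h1 h2 hy
      rw [h1]
      exact h2 hy

theorem OkaExtends.insert_of_notMem {p : ι → (ι → ℂ) → ℂ} (hpd : ∀ i, Differentiable ℂ (p i))
    {J S : Finset ι} (hSJ : S ⊆ J) (hp : ∀ i x y, (∀ m ∉ J, x m = y m) → p i x = p i y)
    (hS : OkaExtends p S) {j : ι} (hj : j ∈ J) (hjS : j ∉ S) : OkaExtends p (insert j S) := by
  intro lo₀ hi₀ h₀ f hf
  have hloc : ∀ x ∈ cbox lo₀ hi₀, ∃ r > 0, ∃ F, ∀ Q ⊆ ball x r, Q ⊆ cbox lo₀ hi₀ →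
      IsPartialExtension p S (insert j S) f F Q := by
    intro x hx
    by_cases hxi : x ∈ partialGraph p (insert j S)
    · obtain ⟨r, hr, hr'⟩ := Metric.eventually_nhds_iff_ball.1 (hf x ⟨hx, hxi⟩)
      refine ⟨r, hr, f, fun Q hQ _ y hy => ⟨fun _ => ?_, fun _ => Eventually.of_forall fun _ _ => rfl⟩⟩
      filter_upwards [isOpen_ball.mem_nhds (hQ hy)] with z hz
      exact hr' z hz
    · obtain ⟨r, hr, hr'⟩ := Metric.isOpen_iff.1 (isClosed_partialGraph hpd (insert j S)).isOpen_compl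
        x hxi
      refine ⟨r, hr, 0, fun Q hQ _ y hy => ⟨fun _ => Eventually.of_forall fun z =>
        differentiableAt_const 0, fun hyi => absurd hyi (hr' (hQ hy))⟩⟩
  choose! r hr F hF using hloc
  obtain ⟨δ, hδ, hδ'⟩ := lebesgue_number_lemma_of_metric (isCompact_cbox lo₀ hi₀)
    (c := fun x : cbox lo₀ hi₀ => ball (x : ι → ℂ) (r x)) (fun _ => isOpen_ball)
    (fun x hx => mem_iUnion.2 ⟨⟨x, hx⟩, mem_ball_self (hr x hx)⟩)
  obtain ⟨F₁, hF₁⟩ : ∃ F, IsPartialExtension p S (insert j S) f F (cbox lo₀ hi₀) := by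
    refine box_gluing_induction (P := fun lo hi => ∃ F,
      IsPartialExtension p S (insert j S) f F (cbox lo hi)) (δ := δ / 4) (by positivity)
      (fun lo hi h1 h2 h3 h4 => ?_) (fun lo hi k γ h1 h2 h3 h4 h5 ha hb => ?_) h₀
    · rcases (cbox lo hi).eq_empty_or_nonempty with he | ⟨x, hx⟩
      · exact ⟨0, by rw [he]; exact fun x hx => absurd hx (notMem_empty x)⟩
      · obtain ⟨y, hy⟩ := hδ' x (cbox_mono h1 h3 hx)
        refine ⟨F y, hF y y.2 _ (fun z hz => hy ?_) (cbox_mono h1 h3)⟩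
        have := dist_le_of_realCoord (x := z) (y := x) (ε := δ / 4) (by positivity) fun k => by
          have := h4 k
          rw [abs_le]
          constructor <;> linarith [(hx k).1, (hx k).2, (hz k).1, (hz k).2]
        rw [mem_ball]
        linarith
    · obtain ⟨Fa, hFa⟩ := ha
      obtain ⟨Fb, hFb⟩ := hb
      exact OkaExtends.glue hpd hSJ hp hS hj hjS h2 hFa hFb h4 h5
  obtain ⟨F₂, h2, h3⟩ := hS lo₀ hi₀ h₀ F₁ fun x hx => (hF₁ x hx.1).1 hx.2
  have hsub : partialGraph p (insert j S) ⊆ partialGraph p S := fun x hx i hi =>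
    hx i (Finset.mem_insert_of_mem hi)
  refine ⟨F₂, h2, fun x hx => ?_⟩
  filter_upwards [h3 x ⟨hx.1, hsub hx.2⟩, (hF₁ x hx.1).2 hx.2] with y h4 h5 hy
  rw [h4 (hsub hy), h5 hy]

/-- Oka's extension theorem from graphs over polynomial polyhedra to boxes. -/
theorem okaExtends {p : ι → (ι → ℂ) → ℂ} (hpd : ∀ i, Differentiable ℂ (p i))
    {J : Finset ι} (hp : ∀ i x y, (∀ m ∉ J, x m = y m) → p i x = p i y) : OkaExtends p J := by
  have : ∀ S : Finset ι, S ⊆ J → OkaExtends p S := by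
    intro S
    induction S using Finset.induction_on with
    | empty =>
      intro _ lo hi _ f hf
      exact ⟨f, fun x hx => hf x ⟨hx, fun i hi => absurd hi (Finset.notMem_empty i)⟩,
        fun x _ => Eventually.of_forall fun _ _ => rfl⟩
    | insert j S hjS ih =>
      intro hsub
      have hSJ := (Finset.subset_insert j S).trans hsub
      exact (ih hSJ).insert_of_notMem hpd hSJ hp (hsub (Finset.mem_insert_self j S)) hjS
  exact this J Finset.Subset.rfl

end Several

section Several
variable {ι : Type*} [Fintype ι] [DecidableEq ι]

theorem differentiable_mvPolynomial_eval (P : MvPolynomial ι ℂ) :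
    Differentiable ℂ fun x : ι → ℂ => MvPolynomial.eval x P := by
  induction P using MvPolynomial.induction_on with
  | C a => simp
  | add p q hp hq =>
    simp only [map_add]
    exact hp.add hq
  | mul_X p i hp =>
    simp only [map_mul, MvPolynomial.eval_X]
    exact hp.mul (by fun_prop)

theorem eval_bind₁ {κ : Type*} (x : κ → ℂ) (g : ι → MvPolynomial κ ℂ) (P : MvPolynomial ι ℂ) :
    MvPolynomial.eval x (MvPolynomial.bind₁ g P) =
      MvPolynomial.eval (fun m => MvPolynomial.eval x (g m)) P := by
  induction P using MvPolynomial.induction_on with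
  | C a => simp
  | add p q hp hq => simp [hp, hq]
  | mul_X p i hp => simp [hp]

theorem HolNear.exists_ball {F : (ι → ℂ) → ℂ} {A : ℝ} (hA : 0 < A)
    (hF : HolNear F (closedBall 0 A)) :
    ∃ B > A, DifferentiableOn ℂ F (closedBall 0 B) := by
  obtain ⟨δ, hδ, hδW⟩ := (isCompact_closedBall (0 : ι → ℂ) A).exists_cthickening_subset_open
    (isOpen_setOfPred_eventually_nhds (p := fun y => DifferentiableAt ℂ F y)) hF
  rw [cthickening_closedBall hδ.le hA.le] at hδW
  exact ⟨δ + A, by linarith, fun y hy => (hδW hy).self_of_nhds.differentiableWithinAt⟩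

/-- Taylor expansion in one coordinate on a polydisc. -/
theorem exists_taylor_coord {F : (ι → ℂ) → ℂ} {A : ℝ} (hA : 0 < A)
    (hF : HolNear F (closedBall 0 A)) (i : ι) {ε : ℝ} (hε : 0 < ε) :
    ∃ (M : ℕ) (a : ℕ → (ι → ℂ) → ℂ), (∀ k, HolNear (a k) (closedBall 0 A)) ∧
      (∀ k x t, a k (Function.update x i t) = a k x) ∧
      ∀ x ∈ closedBall (0 : ι → ℂ) A, ‖F x - ∑ k ∈ Finset.range M, a k x * x i ^ k‖ ≤ ε := by
  obtain ⟨B, hAB, hFB⟩ := hF.exists_ball hA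
  have hB : 0 < B := hA.trans hAB
  obtain ⟨C, hC⟩ := (isCompact_closedBall (0 : ι → ℂ) B).exists_bound_of_continuousOn
    hFB.continuousOn
  have hC0 : 0 ≤ C := (norm_nonneg _).trans (hC 0 (mem_closedBall_self hB.le))
  have hup : ∀ x ∈ ball (0 : ι → ℂ) B, ∀ t ∈ closedBall (0 : ℂ) B,
      Function.update x i t ∈ closedBall (0 : ι → ℂ) B := by
    intro x hx t ht
    rw [mem_closedBall_zero_iff] at ht ⊢
    rw [mem_ball_zero_iff] at hx
    refine (pi_norm_le_iff_of_nonneg hB.le).2 fun m => ?_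
    by_cases hm : m = i
    · subst hm
      simpa using ht
    · rw [Function.update_of_ne hm]
      exact (norm_le_pi_norm x m).trans hx.le
  have hsub : closedBall (0 : ι → ℂ) A ⊆ ball 0 B := closedBall_subset_ball hAB
  have hgd : ∀ x ∈ ball (0 : ι → ℂ) B, DifferentiableOn ℂ (fun t => F (Function.update x i t))
      (closedBall 0 B) := fun x hx => by
    refine hFB.comp (f := fun t => Function.update x i t) ?_ (hup x hx)
    exact ((differentiable_update_coord i).comp
      ((differentiable_const x).prodMk differentiable_id)).differentiableOn
  obtain ⟨M, hM⟩ : ∃ M : ℕ, B * (C * (A / B) ^ M / (B - A)) ≤ ε := by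
    have h1 : Tendsto (fun M : ℕ => B * (C * (A / B) ^ M / (B - A))) atTop
        (𝓝 (B * (C * 0 / (B - A)))) :=
      (((tendsto_pow_atTop_nhds_zero_of_lt_one (by positivity)
        ((div_lt_one hB).2 hAB)).const_mul C).div_const _).const_mul B
    simp only [mul_zero, zero_div] at h1
    exact (h1.eventually (ge_mem_nhds hε)).exists
  refine ⟨M, fun k x => (2 * Real.pi * Complex.I)⁻¹ *
    ∮ t in C(0, B), F (Function.update x i t) * (t ^ (k + 1))⁻¹, fun k => ?_, fun k x t => ?_, ?_⟩
  · have hd : Continuous (deriv (circleMap 0 B)) := by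
      have : deriv (circleMap 0 B) = fun s => circleMap 0 B s * Complex.I := by
        ext s; rw [deriv_circleMap]
      rw [this]; fun_prop
    have hD : DifferentiableOn ℂ (fun x : ι → ℂ => (2 * Real.pi * Complex.I)⁻¹ *
        ∮ t in C(0, B), F (Function.update x i t) * (t ^ (k + 1))⁻¹) (ball 0 B) := by
      unfold circleIntegral
      simp only [smul_eq_mul]
      refine DifferentiableOn.const_mul (differentiableOn_cauchy_path
        (k := fun _ s => (circleMap 0 B s ^ (k + 1))⁻¹) isOpen_ball hFB
        (continuous_circleMap _ _) hd ?_ ?_ ?_) _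
      · refine ContinuousOn.inv₀ (by fun_prop) ?_
        rintro ⟨y, s⟩ -
        exact pow_ne_zero _ (circleMap_ne_center hB.ne')
      · intro s _
        exact differentiableOn_const _
      · intro y hy s _
        exact hup y hy _ (circleMap_mem_closedBall _ hB.le s)
    intro x hx
    filter_upwards [isOpen_ball.mem_nhds (hsub hx)] with y hy
    exact (hD y hy).differentiableAt (isOpen_ball.mem_nhds hy)
  · simp
  · intro x hx
    have hxB := hsub hx
    have hxi : ‖x i‖ ≤ A := (norm_le_pi_norm x i).trans (mem_closedBall_zero_iff.1 hx)
    have hxiB : x i ∈ ball (0 : ℂ) B := by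
      rw [mem_ball_zero_iff]
      linarith
    have e1 := (hgd x hxB).circleIntegral_sub_inv_smul hxiB
    simp only [Function.update_eq_self, smul_eq_mul] at e1
    have hcont : ContinuousOn (fun t => F (Function.update x i t)) (sphere 0 B) :=
      (hgd x hxB).continuousOn.mono sphere_subset_closedBall
    have hne : ∀ t ∈ sphere (0 : ℂ) B, t ≠ 0 := fun t ht => ne_zero_of_mem_sphere hB.ne' ⟨t, ht⟩
    have hne' : ∀ t ∈ sphere (0 : ℂ) B, t - x i ≠ 0 := by
      intro t ht h
      rw [sub_eq_zero.1 h] at ht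
      rw [mem_sphere_zero_iff_norm] at ht
      linarith
    have hint : ∀ k : ℕ, CircleIntegrable (fun t => F (Function.update x i t) * (t ^ (k + 1))⁻¹ *
        x i ^ k) 0 B := fun k => by
      refine ContinuousOn.circleIntegrable hB.le
        ((hcont.mul (ContinuousOn.inv₀ (by fun_prop) fun t ht => pow_ne_zero _ (hne t ht))).mul
          continuousOn_const)
    have e2 : ∑ k ∈ Finset.range M, ((2 * Real.pi * Complex.I)⁻¹ *
        ∮ t in C(0, B), F (Function.update x i t) * (t ^ (k + 1))⁻¹) * x i ^ k =
        (2 * Real.pi * Complex.I)⁻¹ * ∮ t in C(0, B), ∑ k ∈ Finset.range M,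
          F (Function.update x i t) * (t ^ (k + 1))⁻¹ * x i ^ k := by
      rw [circleIntegral.integral_fun_sum fun k _ => hint k, Finset.mul_sum]
      refine Finset.sum_congr rfl fun k _ => ?_
      have : ∀ g : ℂ → ℂ, (∮ t in C(0, B), g t * x i ^ k) = (∮ t in C(0, B), g t) * x i ^ k := by
        intro g
        rw [mul_comm, ← circleIntegral.integral_const_mul]
        exact circleIntegral.integral_congr hB.le fun t _ => mul_comm _ _
      rw [this]
      ring
    have e3 : F x = (2 * Real.pi * Complex.I)⁻¹ *
        ∮ t in C(0, B), (t - x i)⁻¹ * F (Function.update x i t) := by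
      rw [e1, inv_mul_cancel_left₀ Complex.two_pi_I_ne_zero]
    rw [e2]
    have hI1 : CircleIntegrable (fun t => (t - x i)⁻¹ * F (Function.update x i t)) 0 B :=
      ContinuousOn.circleIntegrable hB.le ((ContinuousOn.inv₀ (by fun_prop) hne').mul hcont)
    have hI2 : CircleIntegrable (fun t => ∑ k ∈ Finset.range M,
        F (Function.update x i t) * (t ^ (k + 1))⁻¹ * x i ^ k) 0 B :=
      CircleIntegrable.fun_sum _ fun k _ => hint k
    rw [e3, ← mul_sub, ← circleIntegral.integral_sub hI1 hI2, ← smul_eq_mul]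
    refine (circleIntegral.norm_two_pi_i_inv_smul_integral_le_of_norm_le_const hB.le
      (C := C * (A / B) ^ M / (B - A)) fun t ht => ?_).trans hM
    have hsum : (t - x i)⁻¹ * F (Function.update x i t) - ∑ k ∈ Finset.range M,
        F (Function.update x i t) * (t ^ (k + 1))⁻¹ * x i ^ k =
        F (Function.update x i t) * (x i / t) ^ M * (t - x i)⁻¹ := by
      have ht0 := hne t ht
      have g := mul_neg_geom_sum (x i / t) M
      have : ∑ k ∈ Finset.range M, F (Function.update x i t) * (t ^ (k + 1))⁻¹ * x i ^ k =
          F (Function.update x i t) * t⁻¹ * ∑ k ∈ Finset.range M, (x i / t) ^ k := by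
        rw [Finset.mul_sum]
        refine Finset.sum_congr rfl fun k _ => ?_
        rw [div_pow, pow_succ, mul_inv]
        field_simp
      rw [this]
      have h1 : (1 - x i / t) = (t - x i) * t⁻¹ := by
        field_simp
      have h2 : t⁻¹ * ∑ k ∈ Finset.range M, (x i / t) ^ k =
          (t - x i)⁻¹ * (1 - (x i / t) ^ M) := by
        rw [eq_inv_mul_iff_mul_eq₀ (hne' t ht), ← g, h1]
        ring
      rw [mul_assoc (F _), h2]
      ring
    rw [hsum, norm_mul, norm_mul, norm_pow, norm_div, norm_inv, mem_sphere_zero_iff_norm.1 ht]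
    have hn : B - A ≤ ‖t - x i‖ := by
      have := norm_sub_norm_le t (x i)
      rw [mem_sphere_zero_iff_norm.1 ht] at this
      linarith
    rw [div_eq_mul_inv _ (B - A)]
    have hBA : 0 < B - A := by linarith
    gcongr
    exact hC _ (hup x hxB t (sphere_subset_closedBall ht))

/-- Holomorphic functions near a closed polydisc are uniform limits of polynomials. -/
theorem HolNear.exists_mvPolynomial {F : (ι → ℂ) → ℂ} {A : ℝ} (hA : 0 < A)
    (hF : HolNear F (closedBall 0 A)) {ε : ℝ} (hε : 0 < ε) :
    ∃ P : MvPolynomial ι ℂ, ∀ x ∈ closedBall (0 : ι → ℂ) A, ‖F x - MvPolynomial.eval x P‖ ≤ ε := by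
  have main : ∀ (S : Finset ι) (F : (ι → ℂ) → ℂ), HolNear F (closedBall 0 A) → ∀ ε > 0,
      ∃ P : MvPolynomial ι ℂ, ∀ x ∈ closedBall (0 : ι → ℂ) A, (∀ i ∉ S, x i = 0) →
        ‖F x - MvPolynomial.eval x P‖ ≤ ε := by
    intro S
    induction S using Finset.induction_on with
    | empty =>
      intro F _ ε hε
      refine ⟨MvPolynomial.C (F 0), fun x _ h => ?_⟩
      have : x = 0 := funext fun i => h i (by simp)
      simp [this, hε.le]
    | insert i S hiS ih =>
      intro F hF ε hε
      obtain ⟨M, a, ha, hau, haF⟩ := exists_taylor_coord hA hF i (half_pos hε)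
      choose P hP using fun k => ih (a k) (ha k) (ε / 2 / ((M + 1) * A ^ k)) (by positivity)
      refine ⟨∑ k ∈ Finset.range M, MvPolynomial.aeval (fun m => if m = i then 0 else
          MvPolynomial.X (R := ℂ) m) (P k) * MvPolynomial.X i ^ k, fun x hx h => ?_⟩
      have hx0 : ∀ k, MvPolynomial.eval x (MvPolynomial.aeval (fun m => if m = i then 0 else
          MvPolynomial.X (R := ℂ) m) (P k)) = MvPolynomial.eval (Function.update x i 0) (P k) := by
        intro k
        rw [MvPolynomial.aeval_eq_bind₁, eval_bind₁]
        congr 2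
        ext m
        by_cases hm : m = i
        · subst hm
          simp
        · simp [hm]
      simp only [map_sum, map_mul, map_pow,
        MvPolynomial.eval_X, hx0]
      have hxn := mem_closedBall_zero_iff.1 hx
      have hxu : Function.update x i 0 ∈ closedBall (0 : ι → ℂ) A := by
        rw [mem_closedBall_zero_iff]
        refine (pi_norm_le_iff_of_nonneg hA.le).2 fun m => ?_
        by_cases hm : m = i
        · subst hm
          simpa using hA.le
        · rw [Function.update_of_ne hm]
          exact (norm_le_pi_norm x m).trans hxn
      have hterm : ∀ k, ‖a k x * x i ^ k - MvPolynomial.eval (Function.update x i 0) (P k) *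
          x i ^ k‖ ≤ ε / 2 / (M + 1) := by
        intro k
        have h1 := hP k _ hxu fun m hm => by
          by_cases hmi : m = i
          · subst hmi
            simp
          · rw [Function.update_of_ne hmi]
            exact h m (by simp [hmi, hm])
        rw [hau] at h1
        rw [← sub_mul, norm_mul, norm_pow]
        have h2 : ‖x i‖ ≤ A := (norm_le_pi_norm x i).trans hxn
        calc _ ≤ ε / 2 / ((M + 1) * A ^ k) * A ^ k := by gcongr
          _ = ε / 2 / (M + 1) := by field_simp
      have h1 := haF x hx
      have h2 : ‖∑ k ∈ Finset.range M, (a k x * x i ^ k -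
          MvPolynomial.eval (Function.update x i 0) (P k) * x i ^ k)‖ ≤ ε / 2 := by
        refine (norm_sum_le_of_le _ fun k _ => hterm k).trans ?_
        rw [Finset.sum_const, Finset.card_range, nsmul_eq_mul]
        have : (M : ℝ) * (ε / 2 / (M + 1)) = ε / 2 * (M / (M + 1)) := by ring
        rw [this]
        have h3 : (M : ℝ) / (M + 1) ≤ 1 := (div_le_one (by positivity)).2 (by linarith)
        nlinarith
      rw [Finset.sum_sub_distrib] at h2
      calc _ = ‖(F x - ∑ k ∈ Finset.range M, a k x * x i ^ k) + (∑ k ∈ Finset.range M,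
            a k x * x i ^ k - ∑ k ∈ Finset.range M,
            MvPolynomial.eval (Function.update x i 0) (P k) * x i ^ k)‖ := by
            rw [sub_add_sub_cancel]
        _ ≤ ε := (norm_add_le _ _).trans (by linarith)
  obtain ⟨P, hP⟩ := main Finset.univ F hF ε hε
  exact ⟨P, fun x hx => hP x hx (by simp)⟩

/-- `L` is separated from each point of its complement by a polynomial. -/
def IsPolySeparated (L : Set (ι → ℂ)) : Prop :=
  ∀ z ∉ L, ∃ P : MvPolynomial ι ℂ, (∀ w ∈ L, ‖MvPolynomial.eval w P‖ < 1) ∧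
    2 < ‖MvPolynomial.eval z P‖

theorem IsPolySeparated.exists_finset {L C : Set (ι → ℂ)} (hL : IsPolySeparated L)
    (hC : IsCompact C) (hd : ∀ z ∈ C, z ∉ L) :
    ∃ T : Finset (MvPolynomial ι ℂ), (∀ P ∈ T, ∀ w ∈ L, ‖MvPolynomial.eval w P‖ < 1) ∧
      ∀ z ∈ C, ∃ P ∈ T, 2 < ‖MvPolynomial.eval z P‖ := by
  choose! P hP1 hP2 using hL
  obtain ⟨t, htC, ht⟩ := hC.elim_nhds_subcover (fun z => {y | 2 < ‖MvPolynomial.eval y (P z)‖})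
    fun z hz => (isOpen_lt continuous_const
      (differentiable_mvPolynomial_eval (P z)).continuous.norm).mem_nhds (hP2 z (hd z hz))
  classical
  refine ⟨t.image P, fun Q hQ w hw => ?_, fun z hz => ?_⟩
  · obtain ⟨z, hz, rfl⟩ := Finset.mem_image.1 hQ
    exact hP1 z (hd z (htC z hz)) w hw
  · obtain ⟨y, hy, hzy⟩ := mem_iUnion₂.1 (ht hz)
    exact ⟨P y, Finset.mem_image_of_mem P hy, hzy⟩

end Several

section OkaWeil
variable {σ : Type*} [Fintype σ] [DecidableEq σ]

/-- The Oka–Weil approximation theorem. -/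
theorem oka_weil {L U : Set (σ → ℂ)} (hL : IsCompact L) (hLp : IsPolySeparated L) (hU : IsOpen U)
    (hLU : L ⊆ U) {f : (σ → ℂ) → ℂ} (hf : DifferentiableOn ℂ f U) :
    ∃ V, IsOpen V ∧ L ⊆ V ∧ V ⊆ U ∧ ∀ ε > 0, ∃ P : MvPolynomial σ ℂ, ∀ z ∈ V,
      ‖f z - MvPolynomial.eval z P‖ ≤ ε := by
  classical
  obtain ⟨A, hA, hLA⟩ := hL.isBounded.subset_ball_lt 0 0
  obtain ⟨T, hT1, hT2⟩ := hLp.exists_finset (C := cbox (fun _ => -A) (fun _ => A) \ U)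
    ((isCompact_cbox _ _).diff hU) fun z hz hzL => hz.2 (hLU hzL)
  set p : (σ ⊕ T) → ((σ ⊕ T) → ℂ) → ℂ := fun i x =>
    Sum.elim (fun _ => 0) (fun P : T => A * MvPolynomial.eval (fun i => x (Sum.inl i)) P.1) i with hp
  have hpd : ∀ i, Differentiable ℂ (p i) := by
    rintro (i | P)
    · exact differentiable_const _
    · exact ((differentiable_mvPolynomial_eval P.1).comp
        (differentiable_pi.2 fun i => by fun_prop)).const_mul (A : ℂ)
  set J : Finset (σ ⊕ T) := Finset.univ.filter fun i => i.isRight with hJ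
  have hpJ : ∀ i x y, (∀ m ∉ J, x m = y m) → p i x = p i y := by
    intro i x y h
    have : (fun i => x (Sum.inl i)) = fun i => y (Sum.inl i) := funext fun i => h _ (by simp [hJ])
    simp only [hp, this]
  have hproj : Differentiable ℂ fun (x : (σ ⊕ T) → ℂ) i => x (Sum.inl i) :=
    differentiable_pi.2 fun i => by fun_prop
  have hmemU : ∀ x ∈ cbox (fun _ => -A) (fun _ => A) ∩ partialGraph p J,
      (fun i => x (Sum.inl i)) ∈ U := by
    rintro x ⟨hx, hxJ⟩
    by_contra hxU
    obtain ⟨P, hPT, hP⟩ := hT2 (fun i => x (Sum.inl i)) ⟨fun k => hx (Sum.inl k.1, k.2), hxU⟩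
    have h1 := hxJ (Sum.inr ⟨P, hPT⟩) (by simp [hJ])
    have h2 := abs_le.2 (hx (Sum.inr ⟨P, hPT⟩, false))
    have h3 := abs_le.2 (hx (Sum.inr ⟨P, hPT⟩, true))
    simp only [realCoord, Bool.false_eq_true, if_false, if_true] at h2 h3
    have h4 := Complex.norm_le_abs_re_add_abs_im (x (Sum.inr ⟨P, hPT⟩))
    have h5 : ‖x (Sum.inr ⟨P, hPT⟩)‖ = A * ‖MvPolynomial.eval (fun i => x (Sum.inl i)) P‖ := by
      rw [h1]
      simp [hp, abs_of_pos hA]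
    nlinarith
  obtain ⟨F, hF, hFf⟩ := okaExtends hpd hpJ (fun _ => -A) (fun _ => A) (fun _ => by simp; linarith)
    (fun x => f fun i => x (Sum.inl i)) (fun x hx => by
      have hc := hproj.continuous.continuousAt (x := x)
      filter_upwards [hc.preimage_mem_nhds (hU.mem_nhds (hmemU x hx))] with y hy
      exact ((hf _ hy).differentiableAt (hU.mem_nhds hy)).comp y (hproj y))
  have hball : closedBall (0 : (σ ⊕ T) → ℂ) A ⊆ cbox (fun _ => -A) (fun _ => A) := by
    intro x hx k
    rw [mem_closedBall_zero_iff] at hx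
    have h1 := (norm_le_pi_norm x k.1).trans hx
    refine abs_le.1 ?_
    unfold realCoord
    split_ifs
    · exact (Complex.abs_im_le_norm _).trans h1
    · exact (Complex.abs_re_le_norm _).trans h1
  have hFb := hF.mono hball
  set g : (σ → ℂ) → (σ ⊕ T) → ℂ := fun z =>
    Sum.elim z fun P : T => A * MvPolynomial.eval z P.1 with hg
  have hgm : ∀ z ∈ ball (0 : σ → ℂ) A, (∀ P ∈ T, ‖MvPolynomial.eval z P‖ < 1) →
      g z ∈ closedBall 0 A ∧ g z ∈ partialGraph p J := by
    intro z hz hzT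
    rw [mem_ball_zero_iff] at hz
    refine ⟨?_, ?_⟩
    · rw [mem_closedBall_zero_iff]
      refine (pi_norm_le_iff_of_nonneg hA.le).2 ?_
      rintro (i | P)
      · exact (norm_le_pi_norm z i).trans hz.le
      · have := hzT P.1 P.2
        simp only [hg, Sum.elim_inr, norm_mul, Complex.norm_real, Real.norm_eq_abs, abs_of_pos hA]
        nlinarith
    · rintro (i | P) hi
      · simp [hJ] at hi
      · simp [hp, hg]
  refine ⟨ball 0 A ∩ {z | ∀ P ∈ T, ‖MvPolynomial.eval z P‖ < 1}, ?_, ?_, ?_, ?_⟩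
  · refine isOpen_ball.inter ?_
    simp only [ofPred_forall]
    exact isOpen_biInter_finset fun P _ => isOpen_lt
      (differentiable_mvPolynomial_eval P).continuous.norm continuous_const
  · exact fun z hz => ⟨hLA hz, fun P hP => hT1 P hP z hz⟩
  · rintro z ⟨hz, hzT⟩
    obtain ⟨h1, h2⟩ := hgm z hz hzT
    exact hmemU _ ⟨hball h1, h2⟩
  · intro ε hε
    obtain ⟨Q, hQ⟩ := hFb.exists_mvPolynomial hA hε
    refine ⟨MvPolynomial.bind₁ (Sum.elim MvPolynomial.X fun P : T =>
      MvPolynomial.C (A : ℂ) * P.1) Q, ?_⟩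
    rintro z ⟨hz, hzT⟩
    obtain ⟨h1, h2⟩ := hgm z hz hzT
    have h3 := (hFf _ ⟨hball h1, h2⟩).self_of_nhds h2
    have h4 := hQ _ h1
    rw [h3] at h4
    have h5 : (fun m => MvPolynomial.eval z (Sum.elim MvPolynomial.X (fun P : T =>
        MvPolynomial.C (A : ℂ) * P.1) m)) = g z :=
      funext fun m => by rcases m with i | P <;> simp [hg]
    rw [eval_bind₁, h5]
    exact h4

end OkaWeil

section TailComp

/-- The composition `T j ∘ T (j + 1) ∘ ⋯ ∘ T (j + k - 1)`. -/
def tailComp {E : Type*} (T : ℕ → E → E) : ℕ → ℕ → E → E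
  | _, 0 => id
  | j, k + 1 => T j ∘ tailComp T (j + 1) k

theorem tailComp_succ_right {E : Type*} (T : ℕ → E → E) (j k : ℕ) :
    tailComp T j (k + 1) = tailComp T j k ∘ T (j + k) := by
  induction k generalizing j with
  | zero => simp [tailComp]
  | succ k ih =>
    rw [tailComp, ih, tailComp, Function.comp_assoc]
    congr 3
    omega

theorem tailComp_add {E : Type*} (T : ℕ → E → E) (i j k : ℕ) :
    tailComp T i (j + k) = tailComp T i j ∘ tailComp T (i + j) k := by
  induction j generalizing i with
  | zero => simp [tailComp]
  | succ j ih =>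
    rw [Nat.succ_add, tailComp, ih, tailComp, Function.comp_assoc, Nat.add_right_comm i 1 j,
      Nat.add_assoc i j 1]

theorem tailComp_injective {E : Type*} {T : ℕ → E → E} (hT : ∀ i, Function.Injective (T i))
    (j k : ℕ) : Function.Injective (tailComp T j k) := by
  induction k generalizing j with
  | zero => exact Function.injective_id
  | succ k ih => exact (hT j).comp (ih _)

theorem tailComp_zero {E : Type*} [Zero E] {T : ℕ → E → E} (hT : ∀ i, T i 0 = 0) (j k : ℕ) :
    tailComp T j k 0 = 0 := by
  induction k generalizing j with
  | zero => rfl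
  | succ k ih => simp [tailComp, ih, hT]

variable {E : Type*} [NormedAddCommGroup E] [NormedSpace ℂ E]

theorem norm_tailComp_sub_le {T : ℕ → E → E} {ρ : ℝ}
    (hρ : 0 ≤ ρ) (h : ∀ i w, ‖w‖ ≤ ρ * 2 ^ i → ‖T i w - w‖ ≤ (1 / 2) ^ i / 2)
    (j k : ℕ) {w : E} (hw : ‖w‖ + 1 ≤ ρ * 2 ^ j) : ‖tailComp T j k w - w‖ ≤ (1 / 2) ^ j := by
  induction k generalizing j with
  | zero => simp [tailComp]
  | succ k ih =>
    have h1 : ‖tailComp T (j + 1) k w - w‖ ≤ (1 / 2) ^ (j + 1) := by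
      refine ih (j + 1) (hw.trans ?_)
      gcongr
      · norm_num
      · omega
    have h2 : ((1 : ℝ) / 2) ^ (j + 1) ≤ 1 := pow_le_one₀ (by norm_num) (by norm_num)
    have h3 : ‖tailComp T (j + 1) k w‖ ≤ ‖w‖ + 1 := by
      have := norm_sub_norm_le (tailComp T (j + 1) k w) w
      linarith
    have h4 := h j _ (h3.trans hw)
    have h5 : tailComp T j (k + 1) w - w = (T j (tailComp T (j + 1) k w) -
        tailComp T (j + 1) k w) + (tailComp T (j + 1) k w - w) := by
      simp [tailComp]
    rw [h5]
    refine (norm_add_le _ _).trans ?_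
    rw [pow_succ] at h1
    linarith

theorem dist_tailComp_succ_le {T : ℕ → E → E} {ρ : ℝ} (hTd : ∀ i, Differentiable ℂ (T i))
    (hρ : 0 ≤ ρ) (h : ∀ i w, ‖w‖ ≤ ρ * 2 ^ i → ‖T i w - w‖ ≤ (1 / 2) ^ i / 2)
    (j k : ℕ) {w : E} (hw : ‖w‖ + 2 ≤ ρ * 2 ^ j) :
    dist (tailComp T j k w) (tailComp T j (k + 1) w) ≤ 3 * (1 / 2) ^ j / 2 / 2 ^ k := by
  have hd : Differentiable ℂ (tailComp T j k) := by
    clear hw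
    induction k generalizing j with
    | zero => exact differentiable_id
    | succ k ih => exact (hTd j).comp (ih _)
  have hT : dist (T (j + k) w) w ≤ (1 / 2) ^ (j + k) / 2 := by
    rw [dist_eq_norm]
    refine h _ _ ((by linarith : ‖w‖ ≤ ρ * 2 ^ j).trans ?_)
    gcongr
    · norm_num
    · omega
  have hp : ∀ i : ℕ, ((1 : ℝ) / 2) ^ i ≤ 1 := fun i => pow_le_one₀ (by norm_num) (by norm_num)
  have hmem : T (j + k) w ∈ ball w 1 := by
    rw [mem_ball]
    linarith [hp (j + k)]
  have hmaps : MapsTo (tailComp T j k) (ball w 1) (closedBall (tailComp T j k w) 3) := by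
    intro u hu
    rw [mem_ball, dist_eq_norm] at hu
    have hu' : ‖u‖ ≤ ‖w‖ + 1 := by
      have := norm_sub_norm_le u w
      linarith
    have h1 := norm_tailComp_sub_le hρ h j k (w := u) (by linarith)
    have h2 := norm_tailComp_sub_le hρ h j k (w := w) (by linarith)
    rw [mem_closedBall, dist_eq_norm]
    have h3 : tailComp T j k u - tailComp T j k w = (tailComp T j k u - u) + (u - w) -
        (tailComp T j k w - w) := by abel
    rw [h3]
    have h4 := norm_sub_le ((tailComp T j k u - u) + (u - w)) (tailComp T j k w - w)
    have h5 := norm_add_le (tailComp T j k u - u) (u - w)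
    linarith [hp j]
  have := Complex.dist_le_div_mul_dist_of_mapsTo_ball hd.differentiableOn hmaps hmem
  rw [dist_comm, tailComp_succ_right]
  refine this.trans ?_
  rw [pow_add] at hT
  calc 3 / 1 * dist (T (j + k) w) w ≤ 3 / 1 * ((1 / 2) ^ j * (1 / 2) ^ k / 2) := by gcongr
    _ = 3 * (1 / 2) ^ j / 2 / 2 ^ k := by
      rw [one_div, inv_pow, inv_pow]
      field_simp

theorem exists_tailComp_limit [CompleteSpace E] {Z : Type*} [NormedAddCommGroup Z]
    [NormedSpace ℂ Z] {V : Set Z} (hV : IsOpen V) {T : ℕ → Z → E → E} {ρ : ℝ} (hρ : 0 < ρ)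
    (hT : ∀ i, DifferentiableOn ℂ (fun p : Z × E => T i p.1 p.2) (V ×ˢ univ))
    (h : ∀ i, ∀ z ∈ V, ∀ w, ‖w‖ ≤ ρ * 2 ^ i → ‖T i z w - w‖ ≤ (1 / 2) ^ i / 2) :
    ∃ H : ℕ → Z → E → E, DifferentiableOn ℂ (fun p : Z × E => H 0 p.1 p.2) (V ×ˢ univ) ∧
      ∀ z ∈ V, ∀ w, ∀ j, ‖w‖ + 2 ≤ ρ * 2 ^ j →
        ‖H j z w - w‖ ≤ (1 / 2) ^ j ∧
        Tendsto (fun k => tailComp (fun i => T i z) j k w) atTop (𝓝 (H j z w)) ∧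
        H 0 z w = tailComp (fun i => T i z) 0 j (H j z w) := by
  have hTz : ∀ z ∈ V, ∀ i, Differentiable ℂ (T i z) := fun z hz i w => by
    have h1 : DifferentiableAt ℂ (fun p : Z × E => T i p.1 p.2) (z, w) :=
      (hT i _ ⟨hz, mem_univ w⟩).differentiableAt ((hV.prod isOpen_univ).mem_nhds ⟨hz, mem_univ w⟩)
    exact h1.comp w (f := fun w => (z, w)) (by fun_prop)
  have hcd : ∀ j k, DifferentiableOn ℂ (fun p : Z × E => tailComp (fun i => T i p.1) j k p.2)
      (V ×ˢ univ) := by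
    intro j k
    induction k generalizing j with
    | zero => exact differentiable_snd.differentiableOn
    | succ k ih =>
      exact (hT j).comp (differentiable_fst.differentiableOn.prodMk (ih (j + 1)))
        fun p hp => ⟨hp.1, mem_univ _⟩
  have hcz : ∀ z ∈ V, ∀ j k, Continuous (tailComp (fun i => T i z) j k) := by
    intro z hz j k
    induction k generalizing j with
    | zero => exact continuous_id
    | succ k ih => exact (hTz z hz j).continuous.comp (ih _)
  set H : ℕ → Z → E → E := fun j z w => limUnder atTop fun k => tailComp (fun i => T i z) j k w
    with hH
  have hlim : ∀ z ∈ V, ∀ w, ∀ j, ‖w‖ + 2 ≤ ρ * 2 ^ j →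
      Tendsto (fun k => tailComp (fun i => T i z) j k w) atTop (𝓝 (H j z w)) := fun z hz w j hw =>
    (cauchySeq_of_le_geometric_two (C := 3 * (1 / 2) ^ j) fun k =>
      dist_tailComp_succ_le (hTz z hz) hρ.le (fun i => h i z hz) j k hw).tendsto_limUnder
  have hrel : ∀ z ∈ V, ∀ w, ∀ j, ‖w‖ + 2 ≤ ρ * 2 ^ j →
      H 0 z w = tailComp (fun i => T i z) 0 j (H j z w) := by
    intro z hz w j hw
    refine Tendsto.limUnder_eq ?_
    rw [← tendsto_add_atTop_iff_nat j]
    have h1 := ((hcz z hz 0 j).tendsto _).comp (hlim z hz w j hw)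
    refine h1.congr fun k => ?_
    rw [add_comm k j, tailComp_add, zero_add]
    rfl
  refine ⟨H, ?_, fun z hz w j hw => ⟨?_, hlim z hz w j hw, hrel z hz w j hw⟩⟩
  · rintro ⟨z, w⟩ ⟨hz, -⟩
    obtain ⟨j, hj⟩ : ∃ j : ℕ, (‖w‖ + 3) / ρ < 2 ^ j := pow_unbounded_of_one_lt _ (by norm_num)
    rw [div_lt_iff₀ hρ, mul_comm] at hj
    set W : Set (Z × E) := V ×ˢ ball 0 (‖w‖ + 1) with hW
    have hWo : IsOpen W := hV.prod isOpen_ball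
    have hWn : ∀ p ∈ W, ‖p.2‖ + 2 ≤ ρ * 2 ^ j := fun p hp => by
      have := mem_ball_zero_iff.1 hp.2
      linarith
    have hHj : DifferentiableOn ℂ (fun p : Z × E => H j p.1 p.2) W := by
      refine differentiableOn_of_locally_tendstoUniformlyOn
        (f := fun k p => tailComp (fun i => T i p.1) j k p.2)
        (fun k => (hcd j k).mono (prod_mono subset_rfl (subset_univ _))) fun p hp => ?_
      obtain ⟨r, hr, hrW⟩ := Metric.isOpen_iff.1 hWo p hp
      refine ⟨r, hr, hrW, ?_⟩
      rw [Metric.tendstoUniformlyOn_iff]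
      intro ε hε
      have h1 : Tendsto (fun k : ℕ => 3 * ((1 : ℝ) / 2) ^ j * (1 / 2) ^ k) atTop
          (𝓝 (3 * (1 / 2) ^ j * 0)) :=
        (tendsto_pow_atTop_nhds_zero_of_lt_one (by norm_num) (by norm_num)).const_mul _
      rw [mul_zero] at h1
      filter_upwards [h1.eventually (gt_mem_nhds hε)] with k hk q hq
      have hq' := hrW hq
      rw [dist_comm]
      refine lt_of_le_of_lt (dist_le_of_le_geometric_two_of_tendsto (fun k =>
        dist_tailComp_succ_le (hTz q.1 hq'.1) hρ.le (fun i => h i q.1 hq'.1) j k (hWn q hq'))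
          (hlim q.1 hq'.1 q.2 j (hWn q hq')) k) ?_
      convert hk using 1
      rw [one_div, inv_pow, inv_pow, div_eq_mul_inv]
    have hmem : (z, w) ∈ W := ⟨hz, by simp⟩
    refine DifferentiableAt.differentiableWithinAt ?_
    have h2 : (fun p : Z × E => H 0 p.1 p.2) =ᶠ[𝓝 (z, w)]
        fun p => tailComp (fun i => T i p.1) 0 j (H j p.1 p.2) := by
      filter_upwards [hWo.mem_nhds hmem] with p hp
      exact hrel p.1 hp.1 p.2 j (hWn p hp)
    refine DifferentiableAt.congr_of_eventuallyEq ?_ h2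
    refine DifferentiableOn.differentiableAt (s := W) ?_ (hWo.mem_nhds hmem)
    exact (hcd 0 j).comp (differentiable_fst.differentiableOn.prodMk hHj)
      fun p hp => ⟨hp.1, mem_univ _⟩
  · refine le_of_tendsto ((hlim z hz w j hw).sub_const w).norm (Eventually.of_forall fun k => ?_)
    exact norm_tailComp_sub_le hρ.le (fun i => h i z hz) j k (by linarith)

end TailComp

section Limit
variable {Z E : Type*} [NormedAddCommGroup Z] [NormedSpace ℂ Z] [NormedAddCommGroup E]
  [NormedSpace ℂ E]

theorem exists_fatou_bieberbach_of_steps [CompleteSpace E] {V : Set Z} (hV : IsOpen V) {f : Z → E}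
    (hf : DifferentiableOn ℂ f V) {K : Set E} {δ r ρ : ℝ} (hδ : 0 < δ) (hr : 0 < r) (hρ : 0 < ρ)
    (hsep : ∀ z ∈ V, ∀ v : E, ‖v‖ < r → f z + v ∉ cthickening δ K)
    (hstep : ∀ ε > 0, ∃ (Ψ Φ : Z → E → E) (μ : ℝ), 2 ≤ μ ∧ μ ≤ 3 ∧
      DifferentiableOn ℂ (fun p : Z × E => Ψ p.1 p.2) (V ×ˢ univ) ∧
      (∀ z ∈ V, Function.LeftInverse (Φ z) (Ψ z)) ∧ (∀ z ∈ V, Ψ z (f z) = f z) ∧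
      (∀ z ∈ V, ∀ v, ‖v‖ ≤ ρ → ‖Ψ z (f z + v) - f z - (μ : ℂ) • v‖ ≤ ε) ∧
      ∀ z ∈ V, ∀ x, closedBall x ε ⊆ cthickening δ K → ‖Φ z x - x‖ ≤ ε) :
    ∃ F : Z → E → E, DifferentiableOn ℂ (fun p : Z × E => F p.1 p.2) (V ×ˢ univ) ∧
      (∀ z ∈ V, F z 0 = f z) ∧ (∀ z ∈ V, Function.Injective (F z)) ∧
      ∀ z ∈ V, ∀ w, F z w ∉ K := by
  set ε : ℕ → ℝ := fun k => min δ 1 * (1 / 6) ^ k / 4 with hε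
  have hδ1 : 0 < min δ 1 := lt_min hδ one_pos
  have hε0 : ∀ k, 0 < ε k := fun k => by positivity
  choose Ψ Φ μ hμ2 hμ3 hΨd hinv hfix hnear hK using fun k => hstep (ε k) (hε0 k)
  set M : ℕ → ℝ := fun k => ∏ i ∈ Finset.range k, μ i with hM
  have hMs : ∀ k, M (k + 1) = M k * μ k := fun k => Finset.prod_range_succ _ _
  have hM2 : ∀ k, 2 ^ k ≤ M k := fun k => by
    induction k with
    | zero => simp [hM]
    | succ k ih =>
      rw [hMs, pow_succ]
      have : (0 : ℝ) < 2 ^ k := by positivity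
      nlinarith [hμ2 k]
  have hM0 : ∀ k, 0 < M k := fun k => lt_of_lt_of_le (by positivity) (hM2 k)
  have hM3 : ∀ k, M k ≤ 3 ^ k := fun k => by
    induction k with
    | zero => simp [hM]
    | succ k ih =>
      rw [hMs, pow_succ]
      have := hM0 k
      nlinarith [hμ3 k, hμ2 k]
  have hMc : ∀ k, (M k : ℂ) ≠ 0 := fun k => Complex.ofReal_ne_zero.2 (hM0 k).ne'
  set T : ℕ → Z → E → E := fun i z w =>
    (M i : ℂ) • (Ψ i z (f z + (M (i + 1) : ℂ)⁻¹ • w) - f z) with hT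
  have hTd : ∀ i, DifferentiableOn ℂ (fun p : Z × E => T i p.1 p.2) (V ×ˢ univ) := by
    intro i
    have hf1 : DifferentiableOn ℂ (fun p : Z × E => f p.1) (V ×ˢ univ) :=
      hf.comp differentiable_fst.differentiableOn fun p hp => hp.1
    refine DifferentiableOn.const_smul (DifferentiableOn.sub ?_ hf1) _
    refine (hΨd i).comp (f := fun p : Z × E => (p.1, f p.1 + (M (i + 1) : ℂ)⁻¹ • p.2)) ?_
      fun p hp => ⟨hp.1, mem_univ _⟩
    exact differentiable_fst.differentiableOn.prodMk
      (hf1.add (differentiable_snd.const_smul _).differentiableOn)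
  have hTn : ∀ i, ∀ z ∈ V, ∀ w, ‖w‖ ≤ ρ * 2 ^ i → ‖T i z w - w‖ ≤ (1 / 2) ^ i / 2 := by
    intro i z hz w hw
    have h1 : ‖(M (i + 1) : ℂ)⁻¹ • w‖ ≤ ρ := by
      rw [norm_smul, norm_inv, Complex.norm_real, Real.norm_of_nonneg (hM0 _).le,
        inv_mul_le_iff₀ (hM0 _)]
      have h2 : (2 : ℝ) ^ i ≤ 2 ^ (i + 1) := pow_le_pow_right₀ (by norm_num) (by omega)
      have := hM2 (i + 1)
      nlinarith
    have h2 := hnear i z hz _ h1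
    have h3 : T i z w - w = (M i : ℂ) • (Ψ i z (f z + (M (i + 1) : ℂ)⁻¹ • w) - f z -
        (μ i : ℂ) • (M (i + 1) : ℂ)⁻¹ • w) := by
      have h4 : (M i : ℂ) * μ i * (M (i + 1) : ℂ)⁻¹ = 1 := by
        rw [← Complex.ofReal_mul, ← hMs, mul_inv_cancel₀ (hMc _)]
      rw [smul_sub, smul_smul, smul_smul, h4, one_smul]
    rw [h3, norm_smul, Complex.norm_real, Real.norm_of_nonneg (hM0 _).le]
    calc M i * _ ≤ 3 ^ i * ε i := by
          gcongr
          exact hM3 i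
      _ = min δ 1 * (1 / 2) ^ i / 4 := by
          have : (3 : ℝ) ^ i * (1 / 6) ^ i = (1 / 2) ^ i := by
            rw [← mul_pow]
            norm_num
          rw [hε, ← this]
          ring
      _ ≤ (1 / 2) ^ i / 2 := by
          have : (0 : ℝ) < (1 / 2) ^ i := by positivity
          nlinarith [min_le_right δ 1]
  obtain ⟨H, hHd, hH⟩ := exists_tailComp_limit hV hρ hTd hTn
  have hTi : ∀ z ∈ V, ∀ i, Function.Injective (T i z) := by
    intro z hz i w w' h
    have h1 := (hinv i z hz).injective (sub_left_injective (smul_right_injective E (hMc i) h))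
    exact smul_right_injective E (inv_ne_zero (hMc (i + 1))) (add_right_injective _ h1)
  have hT0 : ∀ z ∈ V, ∀ i, T i z 0 = 0 := by
    intro z hz i
    simp [hT, hfix i z hz]
  have hbig : ∀ A B : ℝ, ∃ j : ℕ, A ≤ ρ * 2 ^ j ∧ B < r * 2 ^ j := by
    intro A B
    obtain ⟨j, hj⟩ : ∃ j : ℕ, max (A / ρ) (B / r) < 2 ^ j :=
      pow_unbounded_of_one_lt _ (by norm_num)
    obtain ⟨h1, h2⟩ := max_lt_iff.1 hj
    rw [div_lt_iff₀ hρ, mul_comm] at h1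
    rw [div_lt_iff₀ hr, mul_comm] at h2
    exact ⟨j, h1.le, h2⟩
  refine ⟨fun z w => f z + H 0 z w, ?_, ?_, ?_, ?_⟩
  · exact (hf.comp differentiable_fst.differentiableOn fun p hp => hp.1).add hHd
  · intro z hz
    obtain ⟨j, hj, -⟩ := hbig 2 0
    obtain ⟨-, h2, h3⟩ := hH z hz 0 j (by simpa using hj)
    simp only [tailComp_zero (hT0 z hz)] at h2
    have h4 := tendsto_nhds_unique h2 tendsto_const_nhds
    rw [h4, tailComp_zero (hT0 z hz)] at h3
    simp [h3]
  · intro z hz w w' hww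
    have h1 : H 0 z w = H 0 z w' := add_right_injective _ hww
    by_contra hne
    obtain ⟨i, hi⟩ : ∃ i : ℕ, ((1 : ℝ) / 2) ^ i < dist w w' / 2 :=
      exists_pow_lt_of_lt_one (half_pos (dist_pos.2 hne)) (by norm_num)
    obtain ⟨j', hj', -⟩ := hbig (max ‖w‖ ‖w'‖ + 2) 0
    set j := max i j'
    have hj : max ‖w‖ ‖w'‖ + 2 ≤ ρ * 2 ^ j := hj'.trans (by
      gcongr
      · norm_num
      · exact le_max_right _ _)
    obtain ⟨a1, -, a3⟩ := hH z hz w j (by linarith [le_max_left ‖w‖ ‖w'‖])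
    obtain ⟨b1, -, b3⟩ := hH z hz w' j (by linarith [le_max_right ‖w‖ ‖w'‖])
    rw [a3, b3] at h1
    have h2 := tailComp_injective (hTi z hz) 0 j h1
    rw [h2, ← dist_eq_norm, dist_comm] at a1
    rw [← dist_eq_norm] at b1
    have h3 := dist_triangle w (H j z w') w'
    have h4 : ((1 : ℝ) / 2) ^ j ≤ (1 / 2) ^ i :=
      pow_le_pow_of_le_one (by norm_num) (by norm_num) (le_max_left _ _)
    linarith
  · intro z hz w hw
    obtain ⟨j, hj1, hj2⟩ := hbig (‖w‖ + 2) (‖w‖ + 1)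
    obtain ⟨h1, -, h3⟩ := hH z hz w j hj1
    set x := f z + H 0 z w with hx
    have key : ∀ i (u : E), f z + tailComp (fun i => T i z) 0 i u = x →
        dist (f z + (M i : ℂ)⁻¹ • u) x ≤ δ / 2 * (1 - (1 / 2) ^ i) := by
      intro i
      induction i with
      | zero =>
        intro u hu
        rw [← hu]
        simp [tailComp, hM]
      | succ i ih =>
        intro u hu
        rw [tailComp_succ_right, zero_add] at hu
        have h4 := ih _ hu
        have h5 : f z + (M i : ℂ)⁻¹ • T i z u = Ψ i z (f z + (M (i + 1) : ℂ)⁻¹ • u) := by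
          simp only [hT]
          rw [inv_smul_smul₀ (hMc i), add_sub_cancel]
        rw [h5] at h4
        have h6 : ε i ≤ δ / 4 * (1 / 2) ^ i := by
          have a1 : ((1 : ℝ) / 6) ^ i ≤ (1 / 2) ^ i := by
            gcongr
            norm_num
          have a2 : min δ 1 * (1 / 6) ^ i ≤ δ * (1 / 2) ^ i := by
            gcongr
            exact min_le_left _ _
          simp only [hε]
          linarith
        have h7 : ((1 : ℝ) / 2) ^ i ≤ 1 := pow_le_one₀ (by norm_num) (by norm_num)
        have h8 : (0 : ℝ) < (1 / 2) ^ i := by positivity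
        have h9 := hK i z hz (Ψ i z (f z + (M (i + 1) : ℂ)⁻¹ • u)) (by
          refine (closedBall_subset_closedBall' ?_).trans (closedBall_subset_cthickening hw δ)
          nlinarith)
        rw [hinv i z hz, ← dist_eq_norm] at h9
        have := dist_triangle (f z + (M (i + 1) : ℂ)⁻¹ • u)
          (Ψ i z (f z + (M (i + 1) : ℂ)⁻¹ • u)) x
        rw [pow_succ]
        linarith
    have h4 := key j (H j z w) (by rw [← h3])
    refine hsep z hz ((M j : ℂ)⁻¹ • H j z w) ?_ ?_
    · rw [norm_smul, norm_inv, Complex.norm_real, Real.norm_of_nonneg (hM0 _).le,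
        inv_mul_lt_iff₀ (hM0 _)]
      have h5 := norm_sub_norm_le (H j z w) w
      have h6 : ((1 : ℝ) / 2) ^ j ≤ 1 := pow_le_one₀ (by norm_num) (by norm_num)
      have := hM2 j
      nlinarith
    · refine closedBall_subset_cthickening hw δ (mem_closedBall.2 (h4.trans ?_))
      have h8 : (0 : ℝ) < (1 / 2) ^ j := by positivity
      nlinarith

end Limit

section Taylor

theorem exists_taylor_bound {P F : Type*} [NormedAddCommGroup P] [NormedSpace ℝ P] [ProperSpace P]
    [NormedAddCommGroup F] [NormedSpace ℝ F] {g : ℝ × P → F} (hg : ContDiff ℝ 2 g) (R : ℝ) :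
    ∃ C, 0 ≤ C ∧ ∀ t : ℝ, |t| ≤ 1 → ∀ p : P, ‖p‖ ≤ R →
      ‖g (t, p) - g (0, p) - t • fderiv ℝ g (0, p) (1, 0)‖ ≤ C * t ^ 2 := by
  have hg' : ContDiff ℝ 1 fun q => fderiv ℝ g q (1, 0) :=
    (hg.fderiv_right (m := 1) (by norm_num)).clm_apply contDiff_const
  obtain ⟨C, hC⟩ := hg'.contDiffOn.exists_lipschitzOnWith (by norm_num)
    ((convex_closedBall (0 : ℝ) 1).prod (convex_closedBall (0 : P) R))
    ((isCompact_closedBall _ _).prod (isCompact_closedBall _ _))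
  refine ⟨C, C.2, fun t ht p hp => ?_⟩
  have hmem : ∀ s : ℝ, |s| ≤ 1 → (s, p) ∈ closedBall (0 : ℝ) 1 ×ˢ closedBall (0 : P) R :=
    fun s hs => ⟨by simpa using hs, by simpa using hp⟩
  have hder : ∀ s, HasDerivAt (fun s : ℝ => g (s, p) - s • fderiv ℝ g (0, p) (1, 0))
      (fderiv ℝ g (s, p) (1, 0) - fderiv ℝ g (0, p) (1, 0)) s := by
    intro s
    have h1 : HasDerivAt (fun s : ℝ => (s, p)) ((1 : ℝ), (0 : P)) s :=
      (hasDerivAt_id s).prodMk (hasDerivAt_const s p)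
    have h2 := ((hg.differentiable (by norm_num) (s, p)).hasFDerivAt).comp_hasDerivAt s h1
    have h3 := (hasDerivAt_id s).smul_const (fderiv ℝ g (0, p) (1, 0))
    rw [one_smul] at h3
    exact h2.sub h3
  have hb : ∀ s ∈ closedBall (0 : ℝ) |t|,
      ‖fderiv ℝ g (s, p) (1, 0) - fderiv ℝ g (0, p) (1, 0)‖ ≤ C * |t| := by
    intro s hs
    rw [mem_closedBall_zero_iff, Real.norm_eq_abs] at hs
    have := hC.dist_le_mul _ (hmem s (hs.trans ht)) _ (hmem 0 (by simp))
    rw [dist_eq_norm] at this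
    refine this.trans ?_
    rw [dist_prod_same_right, dist_zero_right, Real.norm_eq_abs]
    gcongr
  have := (convex_closedBall (0 : ℝ) |t|).norm_image_sub_le_of_norm_hasDerivWithin_le
    (fun s _ => (hder s).hasDerivWithinAt) hb (x := 0) (y := t) (by simp) (by simp)
  simp only [zero_smul, sub_zero, Real.norm_eq_abs] at this
  rw [sub_right_comm]
  refine this.trans (le_of_eq ?_)
  rw [mul_assoc, ← sq, sq_abs]

end Taylor

section Generator
variable {σ ι : Type*} [Fintype σ] [Fintype ι]

/-- `Y` is the infinitesimal generator at time `0` of a smooth family of holomorphic fibrewise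
injective maps with a left inverse. -/
def IsGenerator (Y : (σ → ℂ) → (ι → ℂ) → ι → ℂ) : Prop :=
  ∃ θ θ' : ℝ → (σ → ℂ) → (ι → ℂ) → ι → ℂ,
    ContDiff ℝ 2 (fun q : ℝ × (σ → ℂ) × (ι → ℂ) => θ q.1 q.2.1 q.2.2) ∧
    ContDiff ℝ 2 (fun q : ℝ × (σ → ℂ) × (ι → ℂ) => θ' q.1 q.2.1 q.2.2) ∧
    (∀ t, Differentiable ℂ fun p : (σ → ℂ) × (ι → ℂ) => θ t p.1 p.2) ∧
    (∀ t z, Function.LeftInverse (θ' t z) (θ t z)) ∧ (∀ z w, θ 0 z w = w) ∧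
    (∀ z w, HasDerivAt (fun t => θ t z w) (Y z w) 0) ∧
    ∀ z w, HasDerivAt (fun t => θ' t z w) (-Y z w) 0

theorem hasDerivAt_apply_curve {θ : ℝ → (σ → ℂ) → (ι → ℂ) → ι → ℂ}
    (hθ : ContDiff ℝ 2 (fun q : ℝ × (σ → ℂ) × (ι → ℂ) => θ q.1 q.2.1 q.2.2))
    (h0 : ∀ z w, θ 0 z w = w) {z : σ → ℂ} {c : ℝ → ι → ℂ} {y v : ι → ℂ}
    (hy : HasDerivAt (fun t => θ t z (c 0)) y 0) (hc : HasDerivAt c v 0) :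
    HasDerivAt (fun t => θ t z (c t)) (y + v) 0 := by
  have hd : Differentiable ℝ fun q : ℝ × (ι → ℂ) => θ q.1 z q.2 :=
    (hθ.differentiable (by norm_num)).comp (g := fun q : ℝ × (σ → ℂ) × (ι → ℂ) =>
      θ q.1 q.2.1 q.2.2) (f := fun q : ℝ × (ι → ℂ) => (q.1, z, q.2)) (by fun_prop)
  have hL := (hd (0, c 0)).hasFDerivAt
  have h1 := hL.comp_hasDerivAt (0 : ℝ) (f := fun t : ℝ => (t, c t))
    ((hasDerivAt_id (0 : ℝ)).prodMk hc)
  have h2 := hL.comp_hasDerivAt (0 : ℝ) (f := fun t : ℝ => (t, c 0))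
    ((hasDerivAt_id (0 : ℝ)).prodMk (hasDerivAt_const (0 : ℝ) (c 0)))
  have h3 := hL.comp (c 0) (f := fun u : ι → ℂ => ((0 : ℝ), u))
    ((hasFDerivAt_const (0 : ℝ) (c 0)).prodMk (hasFDerivAt_id (c 0)))
  have h4 : fderiv ℝ (fun q : ℝ × (ι → ℂ) => θ q.1 z q.2) (0, c 0) (1, 0) = y :=
    h2.unique hy
  have h5 : fderiv ℝ (fun q : ℝ × (ι → ℂ) => θ q.1 z q.2) (0, c 0) (0, v) = v := by
    have h6 : ((fun q : ℝ × (ι → ℂ) => θ q.1 z q.2) ∘ fun u : ι → ℂ => ((0 : ℝ), u)) = id :=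
      funext fun u => h0 z u
    rw [h6] at h3
    have h7 := h3.unique (hasFDerivAt_id (c 0))
    have h8 := congrArg (fun A : (ι → ℂ) →L[ℝ] (ι → ℂ) => A v) h7
    simpa using h8
  have h6 : ((1 : ℝ), v) = (1, 0) + (0, v) := by simp
  rw [h6, map_add, h4, h5] at h1
  exact h1

theorem IsGenerator.add {Y₁ Y₂ : (σ → ℂ) → (ι → ℂ) → ι → ℂ} (h₁ : IsGenerator Y₁)
    (h₂ : IsGenerator Y₂) : IsGenerator (fun z w => Y₁ z w + Y₂ z w) := by
  obtain ⟨θ, θ', hs, hs', hd, hinv, h0, hY, hY'⟩ := h₁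
  obtain ⟨η, η', ks, ks', kd, kinv, k0, kY, kY'⟩ := h₂
  have h0' : ∀ z w, θ' 0 z w = w := fun z w => by
    conv_lhs => rw [← h0 z w]
    exact hinv 0 z w
  have k0' : ∀ z w, η' 0 z w = w := fun z w => by
    conv_lhs => rw [← k0 z w]
    exact kinv 0 z w
  refine ⟨fun t z w => θ t z (η t z w), fun t z w => η' t z (θ' t z w), ?_, ?_, ?_, ?_, ?_, ?_, ?_⟩
  · exact hs.comp (contDiff_fst.prodMk ((contDiff_fst.comp contDiff_snd).prodMk ks))
  · exact ks'.comp (contDiff_fst.prodMk ((contDiff_fst.comp contDiff_snd).prodMk hs'))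
  · exact fun t => (hd t).comp (differentiable_fst.prodMk (kd t))
  · exact fun t z => (hinv t z).comp (kinv t z)
  · simp [h0, k0]
  · intro z w
    refine hasDerivAt_apply_curve hs h0 ?_ (kY z w)
    simpa only [k0] using hY z w
  · intro z w
    rw [neg_add_rev]
    refine hasDerivAt_apply_curve ks' k0' ?_ (hY' z w)
    simpa only [h0'] using kY' z w

theorem exists_flow_bound {θ : ℝ → (σ → ℂ) → (ι → ℂ) → ι → ℂ} {Y : (σ → ℂ) → (ι → ℂ) → ι → ℂ}
    (hθ : ContDiff ℝ 2 (fun q : ℝ × (σ → ℂ) × (ι → ℂ) => θ q.1 q.2.1 q.2.2))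
    (h0 : ∀ z w, θ 0 z w = w) (hY : ∀ z w, HasDerivAt (fun t => θ t z w) (Y z w) 0) (R : ℝ) :
    ∃ C, 0 ≤ C ∧ ∀ t : ℝ, |t| ≤ 1 → ∀ z w, ‖z‖ ≤ R → ‖w‖ ≤ R →
      ‖θ t z w - w - t • Y z w‖ ≤ C * t ^ 2 := by
  obtain ⟨C, hC0, hC⟩ := exists_taylor_bound hθ R
  refine ⟨C, hC0, fun t ht z w hz hw => ?_⟩
  have h := hC t ht (z, w) (by simpa using ⟨hz, hw⟩)
  have h1 : HasDerivAt (fun s : ℝ => (s, z, w)) ((1 : ℝ), (0 : (σ → ℂ) × (ι → ℂ))) 0 :=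
    (hasDerivAt_id (0 : ℝ)).prodMk (hasDerivAt_const (0 : ℝ) (z, w))
  have h2 := ((hθ.differentiable (by norm_num) (0, z, w)).hasFDerivAt).comp_hasDerivAt 0 h1
  rw [h2.unique (hY z w)] at h
  simpa only [h0] using h

theorem IsGenerator.exists_step {Y : (σ → ℂ) → (ι → ℂ) → ι → ℂ} (hY : IsGenerator Y)
    {V : Set (σ → ℂ)} {K' : Set (ι → ℂ)} {f : (σ → ℂ) → ι → ℂ} {r ε R : ℝ} (hr : 0 < r)
    (hε : 0 < ε) (hεr : 24 * ε ≤ r) (hVR : ∀ z ∈ V, ‖z‖ ≤ R)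
    (hfR : ∀ z ∈ V, ∀ v, ‖v‖ ≤ r → ‖f z + v‖ ≤ R) (hKR : ∀ x ∈ K', ‖x‖ ≤ R)
    (hYf : ∀ z ∈ V, ∀ v, ‖v‖ ≤ r → ‖Y z (f z + v) - v‖ ≤ ε)
    (hYK : ∀ z ∈ V, ∀ x ∈ K', ‖Y z x‖ ≤ ε) :
    ∃ (Ψ Φ : (σ → ℂ) → (ι → ℂ) → ι → ℂ) (μ : ℝ), 2 ≤ μ ∧ μ ≤ 3 ∧
      Differentiable ℂ (fun p : (σ → ℂ) × (ι → ℂ) => Ψ p.1 p.2) ∧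
      (∀ z, Function.LeftInverse (Φ z) (Ψ z)) ∧
      (∀ z ∈ V, ∀ v, ‖v‖ ≤ r / 4 → ‖Ψ z (f z + v) - f z - (μ : ℂ) • v‖ ≤ 6 * ε) ∧
      ∀ z ∈ V, ∀ x, closedBall x (2 * ε) ⊆ K' → ‖Φ z x - x‖ ≤ 2 * ε := by
  obtain ⟨θ, θ', hs, hs', hd, hinv, h0, hθY, hθY'⟩ := hY
  have h0' : ∀ z w, θ' 0 z w = w := fun z w => by
    conv_lhs => rw [← h0 z w]
    exact hinv 0 z w
  obtain ⟨C, hC0, hC⟩ := exists_flow_bound hs h0 hθY R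
  obtain ⟨C', hC0', hC'⟩ := exists_flow_bound hs' h0' hθY' R
  obtain ⟨m, hm⟩ := exists_nat_gt (max (C / ε) (C' / ε))
  obtain ⟨hm1, hm2⟩ := max_lt_iff.1 hm
  rw [div_lt_iff₀ hε] at hm1 hm2
  have hm0 : (0 : ℝ) < m := by
    by_contra h
    nlinarith
  have hm1' : (1 : ℝ) ≤ m := by
    have : 0 < m := by exact_mod_cast hm0
    exact_mod_cast this
  have hmm : |(m : ℝ)⁻¹| ≤ 1 := by
    rw [abs_of_pos (by positivity)]
    exact inv_le_one_of_one_le₀ hm1'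
  have herr : ∀ c : ℝ, c < m * ε → c * ((m : ℝ)⁻¹) ^ 2 + (m : ℝ)⁻¹ * ε ≤ 2 * ε / m := by
    intro c hc
    have : c * ((m : ℝ)⁻¹) ^ 2 ≤ m * ε * ((m : ℝ)⁻¹) ^ 2 := by gcongr
    have e : m * ε * ((m : ℝ)⁻¹) ^ 2 = ε / m := by field_simp
    have e2 : (m : ℝ)⁻¹ * ε = ε / m := by field_simp
    have e3 : 2 * ε / m = ε / m + ε / m := by ring
    linarith
  set a : ℝ := 1 + (m : ℝ)⁻¹ with ha
  have ha1 : 1 ≤ a := by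
    rw [ha]
    linarith [inv_pos.2 hm0]
  have ham : a ^ m ≤ 3 := by
    have h1 : a ≤ Real.exp (m : ℝ)⁻¹ := by
      rw [ha, add_comm]
      exact Real.add_one_le_exp _
    calc a ^ m ≤ Real.exp (m : ℝ)⁻¹ ^ m := by gcongr
      _ = Real.exp 1 := by rw [← Real.exp_nat_mul, mul_inv_cancel₀ hm0.ne']
      _ ≤ 3 := by linarith [Real.exp_one_lt_d9]
  refine ⟨fun z => (θ (m : ℝ)⁻¹ z)^[m], fun z => (θ' (m : ℝ)⁻¹ z)^[m], a ^ m, ?_, ham, ?_,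
    fun z => (hinv _ z).iterate m, ?_, ?_⟩
  · have := one_add_mul_le_pow (a := (m : ℝ)⁻¹) (by linarith [inv_pos.2 hm0]) m
    rw [mul_inv_cancel₀ hm0.ne'] at this
    linarith
  · have : ∀ k : ℕ, Differentiable ℂ fun p : (σ → ℂ) × (ι → ℂ) => (θ (m : ℝ)⁻¹ p.1)^[k] p.2 := by
      intro k
      induction k with
      | zero => exact differentiable_snd
      | succ k ih =>
        simp only [Function.iterate_succ_apply']
        exact (hd _).comp (differentiable_fst.prodMk ih)
    exact this m
  · intro z hz v hv
    have key : ∀ k ≤ m, ‖(θ (m : ℝ)⁻¹ z)^[k] (f z + v) - f z - a ^ k • v‖ ≤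
        a ^ k * (k * (2 * ε / m)) := by
      intro k
      induction k with
      | zero => simp
      | succ k ih =>
        intro hk
        have ih := ih (by omega)
        set u := (θ (m : ℝ)⁻¹ z)^[k] (f z + v) - f z with hu
        have hak : a ^ k ≤ 3 := (pow_le_pow_right₀ ha1 (by omega)).trans ham
        have hak0 : 0 ≤ a ^ k := by positivity
        have hkm : (k : ℝ) * (2 * ε / m) ≤ 2 * ε := by
          rw [mul_div_assoc', div_le_iff₀ hm0, mul_comm]
          have : (k : ℝ) ≤ m := by exact_mod_cast (by omega : k ≤ m)
          nlinarith
        have hkm0 : 0 ≤ (k : ℝ) * (2 * ε / m) := by positivity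
        have hur : ‖u‖ ≤ r := by
          have h1 := norm_sub_norm_le u (a ^ k • v)
          rw [norm_smul, Real.norm_of_nonneg hak0] at h1
          nlinarith [norm_nonneg v]
        have hfu : f z + u = (θ (m : ℝ)⁻¹ z)^[k] (f z + v) := by rw [hu]; abel
        rw [Function.iterate_succ_apply', ← hfu]
        have h1 := hC _ hmm z _ (hVR z hz) (hfR z hz u hur)
        have h2 := hYf z hz u hur
        have h3 : θ (m : ℝ)⁻¹ z (f z + u) - f z - a ^ (k + 1) • v =
            (θ (m : ℝ)⁻¹ z (f z + u) - (f z + u) - (m : ℝ)⁻¹ • Y z (f z + u)) +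
            (m : ℝ)⁻¹ • (Y z (f z + u) - u) + a • (u - a ^ k • v) := by
          rw [pow_succ', mul_smul, ha]
          module
        rw [h3]
        refine (norm_add₃_le).trans ?_
        rw [norm_smul, norm_smul, Real.norm_of_nonneg (by positivity : 0 ≤ a),
          Real.norm_of_nonneg (inv_nonneg.2 hm0.le)]
        have h4 : a * ‖u - a ^ k • v‖ ≤ a * (a ^ k * (k * (2 * ε / m))) := by gcongr
        have h5 : (m : ℝ)⁻¹ * ‖Y z (f z + u) - u‖ ≤ (m : ℝ)⁻¹ * ε := by gcongr
        have h6 := herr C hm1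
        have h7 : 2 * ε / m ≤ a ^ (k + 1) * (2 * ε / m) :=
          le_mul_of_one_le_left (by positivity) (one_le_pow₀ ha1)
        have h8 : a ^ (k + 1) * (((k + 1 : ℕ) : ℝ) * (2 * ε / m)) =
            a * (a ^ k * (k * (2 * ε / m))) + a ^ (k + 1) * (2 * ε / m) := by
          push_cast
          ring
        rw [h8]
        linarith
    have h1 := key m le_rfl
    rw [mul_div_cancel₀ _ hm0.ne'] at h1
    have h2 : ((a ^ m : ℝ) : ℂ) • v = a ^ m • v := rfl
    rw [h2]
    refine h1.trans ?_
    nlinarith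
  · intro z hz x hx
    have key : ∀ k ≤ m, ‖(θ' (m : ℝ)⁻¹ z)^[k] x - x‖ ≤ k * (2 * ε / m) := by
      intro k
      induction k with
      | zero => simp
      | succ k ih =>
        intro hk
        have ih := ih (by omega)
        rw [Function.iterate_succ_apply']
        set u := (θ' (m : ℝ)⁻¹ z)^[k] x with hu
        have hkm : (k : ℝ) * (2 * ε / m) ≤ 2 * ε := by
          rw [mul_div_assoc', div_le_iff₀ hm0, mul_comm]
          have : (k : ℝ) ≤ m := by exact_mod_cast (by omega : k ≤ m)
          nlinarith
        have huK : u ∈ K' := hx (by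
          rw [mem_closedBall, dist_eq_norm]
          exact ih.trans hkm)
        have h1 := hC' _ hmm z u (hVR z hz) (hKR u huK)
        have h2 := hYK z hz u huK
        have h3 : θ' (m : ℝ)⁻¹ z u - x = (θ' (m : ℝ)⁻¹ z u - u - (m : ℝ)⁻¹ • -Y z u) +
            (m : ℝ)⁻¹ • -Y z u + (u - x) := by
          module
        rw [h3]
        refine (norm_add₃_le).trans ?_
        rw [norm_smul, norm_neg, Real.norm_of_nonneg (inv_nonneg.2 hm0.le)]
        have h5 : (m : ℝ)⁻¹ * ‖Y z u‖ ≤ (m : ℝ)⁻¹ * ε := by gcongr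
        have h6 := herr C' hm2
        push_cast
        linarith
    have h1 := key m le_rfl
    rwa [mul_div_cancel₀ _ hm0.ne'] at h1

end Generator

section Shear
variable {σ ι : Type*} [Fintype σ] [Fintype ι]

/-- Entire functions, with the real smoothness recorded. -/
def IsSmoothEntire (c : (σ → ℂ) → ℂ) : Prop := Differentiable ℂ c ∧ ContDiff ℝ 2 c

theorem IsSmoothEntire.const (a : ℂ) : IsSmoothEntire (fun _ : σ → ℂ => a) :=
  ⟨differentiable_const _, contDiff_const⟩

theorem IsSmoothEntire.mul {c d : (σ → ℂ) → ℂ} (hc : IsSmoothEntire c) (hd : IsSmoothEntire d) :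
    IsSmoothEntire fun z => c z * d z := ⟨hc.1.mul hd.1, hc.2.mul hd.2⟩

theorem IsSmoothEntire.coord (i : σ) : IsSmoothEntire fun z : σ → ℂ => z i :=
  ⟨by fun_prop, by fun_prop⟩

theorem contDiff_clm_complex (ℓ : (ι → ℂ) →L[ℂ] ℂ) : ContDiff ℝ 2 ℓ :=
  (ℓ.restrictScalars ℝ).contDiff

theorem contDiff_exp_mul_clm {c : (σ → ℂ) → ℂ} (hc : IsSmoothEntire c) (ℓ : (ι → ℂ) →L[ℂ] ℂ) :
    ContDiff ℝ 2 fun q : ℝ × (σ → ℂ) × (ι → ℂ) =>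
      (q.1 : ℂ) * c q.2.1 * Complex.exp (ℓ q.2.2) :=
  ((Complex.ofRealCLM.contDiff.comp contDiff_fst).mul
    (hc.2.comp (contDiff_fst.comp contDiff_snd))).mul
    ((contDiff_clm_complex ℓ).comp (contDiff_snd.comp contDiff_snd)).cexp

theorem differentiable_exp_mul_clm {c : (σ → ℂ) → ℂ} (hc : IsSmoothEntire c)
    (ℓ : (ι → ℂ) →L[ℂ] ℂ) (t : ℂ) :
    Differentiable ℂ fun p : (σ → ℂ) × (ι → ℂ) => t * c p.1 * Complex.exp (ℓ p.2) :=
  ((hc.1.comp differentiable_fst).const_mul t).mul (ℓ.differentiable.comp differentiable_snd).cexp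

theorem hasDerivAt_ofReal_mul (a b : ℂ) : HasDerivAt (fun t : ℝ => (t : ℂ) * a * b) (a * b) 0 := by
  have := ((hasDerivAt_id (0 : ℝ)).ofReal_comp.mul_const a).mul_const b
  simpa using this

theorem isGenerator_shear {c : (σ → ℂ) → ℂ} (hc : IsSmoothEntire c) {ℓ : (ι → ℂ) →L[ℂ] ℂ}
    {v : ι → ℂ} (hv : ℓ v = 0) : IsGenerator fun z w => (c z * Complex.exp (ℓ w)) • v := by
  have hcd := contDiff_exp_mul_clm hc ℓ
  have hder : ∀ z w, HasDerivAt (fun t : ℝ => w + ((t : ℂ) * c z * Complex.exp (ℓ w)) • v)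
      ((c z * Complex.exp (ℓ w)) • v) 0 := fun z w =>
    ((hasDerivAt_ofReal_mul _ _).smul_const v).const_add w
  refine ⟨fun t z w => w + ((t : ℂ) * c z * Complex.exp (ℓ w)) • v,
    fun t z w => w - ((t : ℂ) * c z * Complex.exp (ℓ w)) • v, ?_, ?_, fun t => ?_, fun t z w => ?_,
    ?_, hder, fun z w => ?_⟩
  · exact (contDiff_snd.comp contDiff_snd).add (hcd.smul contDiff_const)
  · exact (contDiff_snd.comp contDiff_snd).sub (hcd.smul contDiff_const)
  · exact differentiable_snd.add ((differentiable_exp_mul_clm hc ℓ t).smul_const v)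
  · simp [hv]
  · simp
  · exact ((hasDerivAt_ofReal_mul _ _).smul_const v).const_sub w

theorem isGenerator_overshear {c : (σ → ℂ) → ℂ} (hc : IsSmoothEntire c) {ℓ m : (ι → ℂ) →L[ℂ] ℂ}
    {e : ι → ℂ} (he : ℓ e = 0) (hm : m e = 1) :
    IsGenerator fun z w => (c z * Complex.exp (ℓ w) * m w) • e := by
  have hcd := contDiff_exp_mul_clm hc ℓ
  have hmd : ContDiff ℝ 2 fun q : ℝ × (σ → ℂ) × (ι → ℂ) => m q.2.2 :=
    (contDiff_clm_complex m).comp (contDiff_snd.comp contDiff_snd)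
  refine ⟨fun t z w => w + ((Complex.exp ((t : ℂ) * c z * Complex.exp (ℓ w)) - 1) * m w) • e,
    fun t z w => w + ((Complex.exp (-((t : ℂ) * c z * Complex.exp (ℓ w))) - 1) * m w) • e,
    ?_, ?_, fun t => ?_, fun t z w => ?_, ?_, fun z w => ?_, fun z w => ?_⟩
  · exact (contDiff_snd.comp contDiff_snd).add
      (((hcd.cexp.sub contDiff_const).mul hmd).smul contDiff_const)
  · exact (contDiff_snd.comp contDiff_snd).add
      (((hcd.neg.cexp.sub contDiff_const).mul hmd).smul contDiff_const)
  · exact differentiable_snd.add ((((differentiable_exp_mul_clm hc ℓ t).cexp.sub_const 1).mul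
      (m.differentiable.comp differentiable_snd)).smul_const e)
  · simp only [map_add, map_smul, he, hm, mul_zero, add_zero, smul_eq_mul, mul_one]
    rw [add_assoc, ← add_smul]
    have h := Complex.exp_ne_zero ((t : ℂ) * c z * Complex.exp (ℓ w))
    rw [Complex.exp_neg]
    have : (Complex.exp ((t : ℂ) * c z * Complex.exp (ℓ w)) - 1) * m w +
        ((Complex.exp ((t : ℂ) * c z * Complex.exp (ℓ w)))⁻¹ - 1) *
          (m w + (Complex.exp ((t : ℂ) * c z * Complex.exp (ℓ w)) - 1) * m w) = 0 := by
      field_simp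
      ring
    rw [this, zero_smul, add_zero]
  · simp
  · have h1 := (hasDerivAt_ofReal_mul (c z) (Complex.exp (ℓ w))).cexp
    have h2 := (((h1.sub_const 1).mul_const (m w)).smul_const e).const_add w
    simpa using h2
  · have h1 := (hasDerivAt_ofReal_mul (c z) (Complex.exp (ℓ w))).neg.cexp
    have h2 := (((h1.sub_const 1).mul_const (m w)).smul_const e).const_add w
    simpa using h2

/-- `X` is a limit of generators, uniformly on bounded sets. -/
def IsApproxGenerator (X : (σ → ℂ) → (ι → ℂ) → ι → ℂ) : Prop :=
  ∀ R : ℝ, ∀ ε > 0, ∃ Y, IsGenerator Y ∧ ∀ z w, ‖z‖ ≤ R → ‖w‖ ≤ R → ‖X z w - Y z w‖ ≤ ε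

theorem IsGenerator.isApproxGenerator {X : (σ → ℂ) → (ι → ℂ) → ι → ℂ} (h : IsGenerator X) :
    IsApproxGenerator X := fun R ε hε => ⟨X, h, fun z w _ _ => by simpa using hε.le⟩

theorem IsApproxGenerator.add {X₁ X₂ : (σ → ℂ) → (ι → ℂ) → ι → ℂ} (h₁ : IsApproxGenerator X₁)
    (h₂ : IsApproxGenerator X₂) : IsApproxGenerator fun z w => X₁ z w + X₂ z w := by
  intro R ε hε
  obtain ⟨Y₁, g₁, k₁⟩ := h₁ R (ε / 2) (half_pos hε)
  obtain ⟨Y₂, g₂, k₂⟩ := h₂ R (ε / 2) (half_pos hε)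
  refine ⟨_, g₁.add g₂, fun z w hz hw => ?_⟩
  rw [add_sub_add_comm]
  exact (norm_add_le _ _).trans (by linarith [k₁ z w hz hw, k₂ z w hz hw])

theorem IsApproxGenerator.of_approx {X : (σ → ℂ) → (ι → ℂ) → ι → ℂ}
    (h : ∀ R : ℝ, 0 ≤ R → ∀ ε > 0, ∃ X', IsApproxGenerator X' ∧
      ∀ z w, ‖z‖ ≤ R → ‖w‖ ≤ R → ‖X z w - X' z w‖ ≤ ε) : IsApproxGenerator X := by
  intro R ε hε
  obtain ⟨X', h', hX⟩ := h |R| (abs_nonneg R) (ε / 2) (half_pos hε)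
  obtain ⟨Y, g, k⟩ := h' R (ε / 2) (half_pos hε)
  refine ⟨Y, g, fun z w hz hw => ?_⟩
  rw [← sub_add_sub_cancel _ (X' z w)]
  exact (norm_add_le _ _).trans
    (by linarith [k z w hz hw, hX z w (hz.trans (le_abs_self R)) (hw.trans (le_abs_self R))])

theorem IsApproxGenerator.sum {κ : Type*} {X : κ → (σ → ℂ) → (ι → ℂ) → ι → ℂ} (s : Finset κ)
    (h : ∀ k ∈ s, IsApproxGenerator (X k)) : IsApproxGenerator fun z w => ∑ k ∈ s, X k z w := by
  classical
  induction s using Finset.induction_on with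
  | empty =>
    have := (isGenerator_shear (σ := σ) (IsSmoothEntire.const 0) (ℓ := (0 : (ι → ℂ) →L[ℂ] ℂ))
      (v := 0) rfl).isApproxGenerator
    simpa using this
  | insert k s hk ih =>
    simp only [Finset.sum_insert hk]
    exact (h k (Finset.mem_insert_self _ _)).add
      (ih fun j hj => h j (Finset.mem_insert_of_mem hj))

/-- A continuous function is bounded on products of balls. -/
theorem exists_bound_of_continuous {g : (σ → ℂ) × (ι → ℂ) → ℂ} (hg : Continuous g) (R : ℝ) :
    ∃ B, 0 ≤ B ∧ ∀ z w, ‖z‖ ≤ R → ‖w‖ ≤ R → ‖g (z, w)‖ ≤ B := by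
  obtain ⟨B, hB⟩ := (isCompact_closedBall (0 : (σ → ℂ) × (ι → ℂ)) R).exists_bound_of_continuousOn
    hg.continuousOn
  refine ⟨max B 0, le_max_right _ _, fun z w hz hw => (hB _ ?_).trans (le_max_left _ _)⟩
  simpa [Prod.norm_def] using ⟨hz, hw⟩

theorem exists_small_pos (A D : ℝ) {ε : ℝ} (hε : 0 < ε) :
    ∃ s : ℝ, 0 < s ∧ s * A ≤ 1 ∧ s * D ≤ ε := by
  have hs : 0 < min (1 / (|A| + 1)) (ε / (|D| + 1)) := lt_min (by positivity) (by positivity)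
  refine ⟨_, hs, ?_, ?_⟩
  · calc _ ≤ min (1 / (|A| + 1)) (ε / (|D| + 1)) * |A| :=
          mul_le_mul_of_nonneg_left (le_abs_self A) hs.le
      _ ≤ 1 / (|A| + 1) * (|A| + 1) :=
          mul_le_mul (min_le_left _ _) (by linarith) (abs_nonneg A) (by positivity)
      _ = 1 := by field_simp
  · calc _ ≤ min (1 / (|A| + 1)) (ε / (|D| + 1)) * |D| :=
          mul_le_mul_of_nonneg_left (le_abs_self D) hs.le
      _ ≤ ε / (|D| + 1) * (|D| + 1) :=
          mul_le_mul (min_le_right _ _) (by linarith) (abs_nonneg D) (by positivity)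
      _ = ε := by field_simp

variable [DecidableEq ι]

theorem isApproxGenerator_exp_smul_single {c : (σ → ℂ) → ℂ} (hc : IsSmoothEntire c)
    (ℓ : (ι → ℂ) →L[ℂ] ℂ) {i j : ι} (hij : i ≠ j) :
    IsApproxGenerator fun z w => (c z * Complex.exp (ℓ w)) • (Pi.single i 1 : ι → ℂ) := by
  set e : ι → ℂ := Pi.single i 1 with he
  set m : (ι → ℂ) →L[ℂ] ℂ := ContinuousLinearMap.proj j with hm
  have hme : m e = 0 := by simp [hm, he, hij.symm]
  by_cases hl : ℓ e = 0
  · exact (isGenerator_shear hc hl).isApproxGenerator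
  set a := ℓ e with ha
  set e₂ : ι → ℂ := Pi.single j 1 - (ℓ (Pi.single j 1) / a) • e with he₂
  have hle : ℓ e₂ = 0 := by
    rw [he₂, map_sub, map_smul, ← ha, smul_eq_mul, div_mul_cancel₀ _ hl, sub_self]
  have hme₂ : m e₂ = 1 := by
    rw [he₂, map_sub, map_smul, hme]
    simp [hm]
  refine IsApproxGenerator.of_approx fun R hR ε hε => ?_
  obtain ⟨B, hB0, hB⟩ := exists_bound_of_continuous (g := fun p : (σ → ℂ) × (ι → ℂ) =>
    c p.1 * Complex.exp (ℓ p.2)) ((hc.1.continuous.comp continuous_fst).mul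
      (Complex.continuous_exp.comp (ℓ.continuous.comp continuous_snd))) R
  obtain ⟨s, hs0, hs1, hs2⟩ := exists_small_pos (‖a‖ * R)
    (B * (2 * (‖a‖ * R) + (‖a‖ * R) ^ 2 * ‖e₂‖)) hε
  have hsc : (s : ℂ) ≠ 0 := Complex.ofReal_ne_zero.2 hs0.ne'
  have g1 := isGenerator_shear (hc.mul (IsSmoothEntire.const (-(s : ℂ)⁻¹)))
    (ℓ := ℓ + ((s : ℂ) * a) • m) (v := e₂ - (s : ℂ) • e) (by
      simp [hle, hme₂, hme, ← ha])
  have g2 := isGenerator_shear (hc.mul (IsSmoothEntire.const (s : ℂ)⁻¹)) hle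
  have g3 := isGenerator_overshear (hc.mul (IsSmoothEntire.const a)) hle hme₂
  refine ⟨_, ((g1.add g2).add g3).isApproxGenerator, fun z w hz hw => ?_⟩
  set x := (s : ℂ) * a * m w with hx
  have hxn : ‖x‖ ≤ s * (‖a‖ * R) := by
    rw [hx, norm_mul, norm_mul, Complex.norm_real, Real.norm_of_nonneg hs0.le, mul_assoc]
    gcongr
    exact (norm_le_pi_norm w j).trans hw
  have hx1 : ‖x‖ ≤ 1 := hxn.trans hs1
  have key : (c z * Complex.exp (ℓ w)) • e -
      ((c z * -(s : ℂ)⁻¹ * Complex.exp ((ℓ + ((s : ℂ) * a) • m) w)) • (e₂ - (s : ℂ) • e) +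
        (c z * (s : ℂ)⁻¹ * Complex.exp (ℓ w)) • e₂ + (c z * a * Complex.exp (ℓ w) * m w) • e₂) =
      (c z * Complex.exp (ℓ w)) • (-(Complex.exp x - 1) • e +
        ((Complex.exp x - 1 - x) * (s : ℂ)⁻¹) • e₂) := by
    have h1 : (ℓ + ((s : ℂ) * a) • m) w = ℓ w + x := by simp [hx]
    rw [h1, Complex.exp_add]
    ext k
    simp only [Pi.sub_apply, Pi.add_apply, Pi.smul_apply, smul_eq_mul]
    rw [hx]
    field_simp
    ring
  rw [key, norm_smul]
  have hen : ‖e‖ ≤ 1 := by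
    refine (pi_norm_le_iff_of_nonneg zero_le_one).2 fun k => ?_
    rw [he, Pi.single_apply]
    split_ifs <;> simp
  have h2 : ‖-(Complex.exp x - 1) • e + ((Complex.exp x - 1 - x) * (s : ℂ)⁻¹) • e₂‖ ≤
      s * (2 * (‖a‖ * R) + (‖a‖ * R) ^ 2 * ‖e₂‖) := by
    refine (norm_add_le _ _).trans ?_
    rw [norm_smul, norm_smul, norm_neg, norm_mul, norm_inv, Complex.norm_real,
      Real.norm_of_nonneg hs0.le]
    have h3 := Complex.norm_exp_sub_one_le hx1
    have h4 := Complex.norm_exp_sub_one_sub_id_le hx1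
    have h5 : ‖Complex.exp x - 1‖ * ‖e‖ ≤ 2 * (s * (‖a‖ * R)) * 1 := by
      gcongr
      linarith
    have h6 : ‖Complex.exp x - 1 - x‖ * s⁻¹ * ‖e₂‖ ≤ (s * (‖a‖ * R)) ^ 2 * s⁻¹ * ‖e₂‖ := by
      gcongr
      exact h4.trans (by gcongr)
    have h7 : (s * (‖a‖ * R)) ^ 2 * s⁻¹ * ‖e₂‖ = s * ((‖a‖ * R) ^ 2 * ‖e₂‖) := by
      field_simp
    linarith
  calc _ ≤ B * (s * (2 * (‖a‖ * R) + (‖a‖ * R) ^ 2 * ‖e₂‖)) := by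
        gcongr
        exact hB z w hz hw
    _ ≤ ε := by linarith

theorem isApproxGenerator_polynomial_mul_exp (P : MvPolynomial (σ ⊕ ι) ℂ) {i j : ι} (hij : i ≠ j) :
    ∀ (c : (σ → ℂ) → ℂ) (_ : IsSmoothEntire c) (ℓ : (ι → ℂ) →L[ℂ] ℂ),
      IsApproxGenerator fun z w => (c z * MvPolynomial.eval (Sum.elim z w) P *
        Complex.exp (ℓ w)) • (Pi.single i 1 : ι → ℂ) := by
  induction P using MvPolynomial.induction_on with
  | C a =>
    intro c hc ℓ
    simp only [MvPolynomial.eval_C]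
    exact isApproxGenerator_exp_smul_single (hc.mul (IsSmoothEntire.const a)) ℓ hij
  | add P Q hP hQ =>
    intro c hc ℓ
    have := (hP c hc ℓ).add (hQ c hc ℓ)
    simpa only [map_add, mul_add, add_mul, add_smul] using this
  | mul_X P k hP =>
    intro c hc ℓ
    rcases k with k | k
    · have := hP _ (hc.mul (IsSmoothEntire.coord k)) ℓ
      simp only [map_mul, MvPolynomial.eval_X, Sum.elim_inl]
      convert this using 5
      ring
    · simp only [map_mul, MvPolynomial.eval_X, Sum.elim_inr]
      refine IsApproxGenerator.of_approx fun R hR ε hε => ?_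
      have hPc : Continuous fun p : (σ → ℂ) × (ι → ℂ) =>
          MvPolynomial.eval (Sum.elim p.1 p.2) P := by
        refine (MvPolynomial.continuous_eval P).comp (continuous_pi ?_)
        rintro (k | k)
        · exact (continuous_apply k).comp continuous_fst
        · exact (continuous_apply k).comp continuous_snd
      obtain ⟨B, hB0, hB⟩ := exists_bound_of_continuous (g := fun p : (σ → ℂ) × (ι → ℂ) =>
        c p.1 * MvPolynomial.eval (Sum.elim p.1 p.2) P * Complex.exp (ℓ p.2))
        (((hc.1.continuous.comp continuous_fst).mul hPc).mul
          (Complex.continuous_exp.comp (ℓ.continuous.comp continuous_snd))) R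
      obtain ⟨s, hs0, hs1, hs2⟩ := exists_small_pos R (B * R ^ 2) hε
      have hsc : (s : ℂ) ≠ 0 := Complex.ofReal_ne_zero.2 hs0.ne'
      have g1 := hP _ (hc.mul (IsSmoothEntire.const (s : ℂ)⁻¹))
        (ℓ + (s : ℂ) • ContinuousLinearMap.proj k)
      have g2 := hP _ (hc.mul (IsSmoothEntire.const (-(s : ℂ)⁻¹))) ℓ
      refine ⟨_, g1.add g2, fun z w hz hw => ?_⟩
      set x := (s : ℂ) * w k with hx
      have hxn : ‖x‖ ≤ s * R := by
        rw [hx, norm_mul, Complex.norm_real, Real.norm_of_nonneg hs0.le]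
        gcongr
        exact (norm_le_pi_norm w k).trans hw
      have hx1 : ‖x‖ ≤ 1 := hxn.trans hs1
      have h1 : (ℓ + (s : ℂ) • ContinuousLinearMap.proj k : (ι → ℂ) →L[ℂ] ℂ) w = ℓ w + x := by
        simp [hx]
      rw [h1, Complex.exp_add, ← add_smul, ← sub_smul]
      have key : c z * (MvPolynomial.eval (Sum.elim z w) P * w k) * Complex.exp (ℓ w) -
          (c z * (s : ℂ)⁻¹ * MvPolynomial.eval (Sum.elim z w) P *
            (Complex.exp (ℓ w) * Complex.exp x) +
            c z * -(s : ℂ)⁻¹ * MvPolynomial.eval (Sum.elim z w) P * Complex.exp (ℓ w)) =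
          -(c z * MvPolynomial.eval (Sum.elim z w) P * Complex.exp (ℓ w) *
            ((Complex.exp x - 1 - x) * (s : ℂ)⁻¹)) := by
        rw [hx]
        field_simp
        ring
      rw [key, norm_smul, norm_neg, norm_mul, norm_mul (_ - _), norm_inv, Complex.norm_real,
        Real.norm_of_nonneg hs0.le]
      have hen : ‖(Pi.single i 1 : ι → ℂ)‖ ≤ 1 := by
        refine (pi_norm_le_iff_of_nonneg zero_le_one).2 fun k => ?_
        rw [Pi.single_apply]
        split_ifs <;> simp
      have h4 := (Complex.norm_exp_sub_one_sub_id_le hx1).trans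
        (pow_le_pow_left₀ (norm_nonneg x) hxn 2)
      calc _ ≤ B * ((s * R) ^ 2 * s⁻¹) * 1 := by
            gcongr
            exact hB z w hz hw
        _ = s * (B * R ^ 2) := by field_simp
        _ ≤ ε := hs2

/-- Fibrewise polynomial vector fields in dimension at least two are limits of generators. -/
theorem isApproxGenerator_polynomial [Nontrivial ι] (P : ι → MvPolynomial (σ ⊕ ι) ℂ) :
    IsApproxGenerator fun z w i => MvPolynomial.eval (Sum.elim z w) (P i) := by
  have h := IsApproxGenerator.sum (σ := σ) (X := fun i z w =>
    (MvPolynomial.eval (Sum.elim z w) (P i)) • (Pi.single i 1 : ι → ℂ)) Finset.univ fun i _ => by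
      obtain ⟨j, hj⟩ := exists_ne i
      simpa using isApproxGenerator_polynomial_mul_exp (P i) hj.symm _ (IsSmoothEntire.const 1) 0
  convert h using 3 with z w
  ext i
  simp [Finset.sum_apply, Pi.single_apply]

end Shear

section Field
variable {σ ι : Type*} [Fintype σ] [Fintype ι]

/-- The map with polynomial components `f i`. -/
def polyMap (f : ι → MvPolynomial σ ℂ) (z : σ → ℂ) : ι → ℂ := fun i => MvPolynomial.eval z (f i)

/-- The union of `L × K` and the graph of `f` over `L`. -/
def prodUnionGraph (L : Set (σ → ℂ)) (K : Set (ι → ℂ)) (f : (σ → ℂ) → ι → ℂ) :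
    Set (σ ⊕ ι → ℂ) :=
  {x | x ∘ Sum.inl ∈ L ∧ (x ∘ Sum.inr ∈ K ∨ x ∘ Sum.inr = f (x ∘ Sum.inl))}

theorem isCompact_prodUnionGraph {L : Set (σ → ℂ)} (hL : IsCompact L) {K : Set (ι → ℂ)}
    (hK : IsCompact K) {f : (σ → ℂ) → ι → ℂ} (hf : Continuous f) :
    IsCompact (prodUnionGraph L K f) := by
  have hc : Continuous fun p : (σ → ℂ) × (ι → ℂ) => (Sum.elim p.1 p.2 : σ ⊕ ι → ℂ) := by
    refine continuous_pi ?_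
    rintro (k | k)
    · exact (continuous_apply k).comp continuous_fst
    · exact (continuous_apply k).comp continuous_snd
  convert ((hL.prod hK).image hc).union (hL.image (hc.comp (continuous_id.prodMk hf))) using 1
  ext x
  constructor
  · rintro ⟨h1, h2 | h2⟩
    · exact Or.inl ⟨(x ∘ Sum.inl, x ∘ Sum.inr), ⟨h1, h2⟩, Sum.elim_comp_inl_inr x⟩
    · refine Or.inr ⟨x ∘ Sum.inl, h1, ?_⟩
      simp only [Function.comp, id]
      exact (congrArg _ h2.symm).trans (Sum.elim_comp_inl_inr x)
  · rintro (⟨⟨z, w⟩, ⟨h1, h2⟩, rfl⟩ | ⟨z, h1, rfl⟩)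
    · exact ⟨by simpa using h1, Or.inl (by simpa using h2)⟩
    · exact ⟨by simpa using h1, Or.inr (by simp)⟩

theorem differentiable_polyMap [DecidableEq σ] (f : ι → MvPolynomial σ ℂ) :
    Differentiable ℂ (polyMap f) :=
  differentiable_pi.2 fun i => differentiable_mvPolynomial_eval (f i)

theorem isPolySeparated_prodUnionGraph [DecidableEq σ] {L : Set (σ → ℂ)}
    (hL : IsCompact L) (hLp : IsPolySeparated L) {K : Set (ι → ℂ)} (hK : IsCompact K)
    (hKp : IsPolySeparated K) (f : ι → MvPolynomial σ ℂ) :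
    IsPolySeparated (prodUnionGraph L K (polyMap f)) := by
  intro x hx
  by_cases hxL : x ∘ Sum.inl ∈ L
  · have hx' : ¬ (x ∘ Sum.inr ∈ K ∨ x ∘ Sum.inr = polyMap f (x ∘ Sum.inl)) := fun h => hx ⟨hxL, h⟩
    rw [not_or] at hx'
    obtain ⟨hxK, hxf⟩ := hx'
    obtain ⟨i, hi⟩ := Function.ne_iff.1 hxf
    obtain ⟨Q, hQ1, hQ2⟩ := hKp _ hxK
    set D : MvPolynomial (σ ⊕ ι) ℂ :=
      MvPolynomial.X (Sum.inr i) - MvPolynomial.rename Sum.inl (f i) with hD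
    have hDe : ∀ y, MvPolynomial.eval y D = y (Sum.inr i) - polyMap f (y ∘ Sum.inl) i := by
      intro y
      simp [hD, polyMap, MvPolynomial.eval_rename]
    obtain ⟨B, hB⟩ := (isCompact_prodUnionGraph hL hK
      (differentiable_polyMap f).continuous).exists_bound_of_continuousOn
      (MvPolynomial.continuous_eval D).continuousOn
    have hd : 0 < ‖MvPolynomial.eval x D‖ := by
      rw [norm_pos_iff, hDe, sub_ne_zero]
      exact hi
    obtain ⟨M, hM⟩ : ∃ M : ℕ, 2 * (|B| + 1) / ‖MvPolynomial.eval x D‖ < 2 ^ M :=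
      pow_unbounded_of_one_lt _ (by norm_num)
    have hB1 : 0 < |B| + 1 := by positivity
    refine ⟨MvPolynomial.C (((|B| + 1)⁻¹ : ℝ) : ℂ) * MvPolynomial.rename Sum.inr Q ^ M * D,
      fun w hw => ?_, ?_⟩
    · simp only [map_mul, map_pow, MvPolynomial.eval_C, MvPolynomial.eval_rename, norm_mul,
        norm_pow, Complex.norm_real, Real.norm_of_nonneg (inv_pos.2 hB1).le]
      rcases hw.2 with h | h
      · have h1 := hB w hw
        have h2 : ‖MvPolynomial.eval (w ∘ Sum.inr) Q‖ ^ M ≤ 1 :=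
          pow_le_one₀ (norm_nonneg _) (hQ1 _ h).le
        calc _ ≤ (|B| + 1)⁻¹ * 1 * |B| := by
              gcongr
              exact h1.trans (le_abs_self B)
          _ < 1 := by
              rw [mul_one, inv_mul_lt_iff₀ hB1]
              linarith
      · have : MvPolynomial.eval w D = 0 := by
          rw [hDe, ← h]
          simp
        rw [this]
        simp
    · simp only [map_mul, map_pow, MvPolynomial.eval_C, MvPolynomial.eval_rename, norm_mul,
        norm_pow, Complex.norm_real, Real.norm_of_nonneg (inv_pos.2 hB1).le]
      rw [div_lt_iff₀ hd] at hM
      have h2 : (2 : ℝ) ^ M ≤ ‖MvPolynomial.eval (x ∘ Sum.inr) Q‖ ^ M := by gcongr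
      rw [mul_assoc, ← div_eq_inv_mul, lt_div_iff₀ hB1]
      refine hM.trans_le ?_
      gcongr
  · obtain ⟨P, hP1, hP2⟩ := hLp _ hxL
    exact ⟨MvPolynomial.rename Sum.inl P, fun w hw => by
      rw [MvPolynomial.eval_rename]
      exact hP1 _ hw.1, by rwa [MvPolynomial.eval_rename]⟩

theorem dist_sumElim_lt {z z' : σ → ℂ} {w w' : ι → ℂ} {τ : ℝ} (hτ : 0 < τ) (hz : dist z z' < τ)
    (hw : dist w w' < τ) : dist (Sum.elim z w : σ ⊕ ι → ℂ) (Sum.elim z' w') < τ := by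
  rw [dist_pi_lt_iff hτ] at *
  rintro (k | k)
  · exact hz k
  · exact hw k

/-- Polynomial fields which are nearly radial around the graph of `f` and nearly vanish
near `K`. -/
theorem exists_polynomial_fields [DecidableEq σ] [DecidableEq ι] {L : Set (σ → ℂ)}
    (hL : IsCompact L) (hLp : IsPolySeparated L) {K : Set (ι → ℂ)} (hK : IsCompact K)
    (hKp : IsPolySeparated K) (f : ι → MvPolynomial σ ℂ) (hfK : ∀ z ∈ L, polyMap f z ∉ K) :
    ∃ (V : Set (σ → ℂ)) (δ r R : ℝ), IsOpen V ∧ L ⊆ V ∧ 0 < δ ∧ 0 < r ∧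
      (∀ z ∈ V, ‖z‖ ≤ R) ∧ (∀ z ∈ V, ∀ v, ‖v‖ ≤ r → ‖polyMap f z + v‖ ≤ R) ∧
      (∀ x ∈ cthickening δ K, ‖x‖ ≤ R) ∧
      (∀ z ∈ V, ∀ v, ‖v‖ < r → polyMap f z + v ∉ cthickening δ K) ∧
      ∀ ε > 0, ∃ P : ι → MvPolynomial (σ ⊕ ι) ℂ,
        (∀ z ∈ V, ∀ v, ‖v‖ ≤ r → ‖polyMap P (Sum.elim z (polyMap f z + v)) - v‖ ≤ ε) ∧
        ∀ z ∈ V, ∀ x ∈ cthickening δ K, ‖polyMap P (Sum.elim z x)‖ ≤ ε := by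
  classical
  have hfc := (differentiable_polyMap f).continuous
  obtain ⟨d, hd, hdK⟩ : ∃ d > 0, ∀ z ∈ L, ∀ x ∈ K, 3 * d ≤ dist x (polyMap f z) := by
    have hdisj : Disjoint K (polyMap f '' L) := by
      rw [Set.disjoint_left]
      rintro _ hx ⟨z, hz, rfl⟩
      exact hfK z hz hx
    obtain ⟨r, hr, h⟩ := Metric.exists_pos_forall_lt_edist hK (hL.image hfc).isClosed hdisj
    refine ⟨r / 3, by positivity, fun z hz x hx => ?_⟩
    have h1 := h x hx _ (mem_image_of_mem _ hz)
    rw [edist_nndist, ENNReal.coe_lt_coe, ← NNReal.coe_lt_coe, coe_nndist] at h1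
    linarith
  have hπ : Differentiable ℂ fun x : σ ⊕ ι → ℂ => x ∘ Sum.inl :=
    differentiable_pi.2 fun i => by simp only [Function.comp]; fun_prop
  have hgd : Differentiable ℂ fun x : σ ⊕ ι → ℂ => x ∘ Sum.inr - polyMap f (x ∘ Sum.inl) :=
    (differentiable_pi.2 fun i => by simp only [Function.comp]; fun_prop).sub
      ((differentiable_polyMap f).comp hπ)
  set g : (σ ⊕ ι → ℂ) → ι → ℂ := fun x => x ∘ Sum.inr - polyMap f (x ∘ Sum.inl) with hg
  have hgn := hgd.continuous.norm
  set h : (σ ⊕ ι → ℂ) → ι → ℂ := fun x => if ‖g x‖ < d then g x else 0 with hh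
  set U : Set (σ ⊕ ι → ℂ) := {x | ‖g x‖ < d} ∪ {x | d < ‖g x‖} with hU
  have hUo : IsOpen U := (isOpen_lt hgn continuous_const).union (isOpen_lt continuous_const hgn)
  have hhd : ∀ i, DifferentiableOn ℂ (fun x => h x i) U := by
    rintro i x (hx | hx)
    · refine DifferentiableAt.differentiableWithinAt (DifferentiableAt.congr_of_eventuallyEq
        (differentiable_pi.1 hgd i x) ?_)
      filter_upwards [(isOpen_lt hgn continuous_const).mem_nhds hx] with y hy
      have hy : ‖g y‖ < d := hy
      simp only [hh, if_pos hy]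
    · refine DifferentiableAt.differentiableWithinAt (DifferentiableAt.congr_of_eventuallyEq
        (differentiableAt_const 0) ?_)
      filter_upwards [(isOpen_lt continuous_const hgn).mem_nhds hx] with y hy
      have hy : d < ‖g y‖ := hy
      simp [hh, hy.not_gt]
  set S := prodUnionGraph L K (polyMap f) with hS
  have hSc : IsCompact S := isCompact_prodUnionGraph hL hK hfc
  have hSU : S ⊆ U := by
    rintro x ⟨h1, h2 | h2⟩
    · have := hdK _ h1 _ h2
      rw [dist_eq_norm] at this
      exact Or.inr (show d < ‖g x‖ by simp only [hg]; linarith)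
    · refine Or.inl (show ‖g x‖ < d from ?_)
      rw [hg]
      simp only
      rw [h2, sub_self, norm_zero]
      exact hd
  choose W hWo hSW hWU hW using fun i =>
    oka_weil hSc (isPolySeparated_prodUnionGraph hL hLp hK hKp f) hUo hSU (hhd i)
  obtain ⟨τ', hτ', hτW⟩ := hSc.exists_thickening_subset_open (isOpen_iInter_of_finite hWo)
    (subset_iInter hSW)
  set τ := min τ' d with hτd
  have hτ : 0 < τ := lt_min hτ' hd
  have hSel : ∀ z w, (∃ z' ∈ L, dist z z' < τ ∧ ((∃ x ∈ K, dist w x < τ) ∨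
      dist w (polyMap f z') < τ)) → ∀ i, Sum.elim z w ∈ W i := by
    rintro z w ⟨z', hz', hzz, hx⟩
    have hmem : Sum.elim z w ∈ thickening τ' S := by
      rw [mem_thickening_iff]
      rcases hx with ⟨x, hx, hwx⟩ | hx
      · exact ⟨Sum.elim z' x, ⟨by simpa using hz', Or.inl (by simpa using hx)⟩,
          (dist_sumElim_lt hτ hzz hwx).trans_le (min_le_left _ _)⟩
      · exact ⟨Sum.elim z' (polyMap f z'), ⟨by simpa using hz', Or.inr (by simp)⟩,
          (dist_sumElim_lt hτ hzz hx).trans_le (min_le_left _ _)⟩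
    exact mem_iInter.1 (hτW hmem)
  set V : Set (σ → ℂ) := ⋃ z' ∈ L, ball z' τ ∩ polyMap f ⁻¹' ball (polyMap f z') (τ / 4) with hV
  have hVm : ∀ z ∈ V, ∃ z' ∈ L, dist z z' < τ ∧ dist (polyMap f z) (polyMap f z') < τ / 4 := by
    intro z hz
    obtain ⟨z', hz', h1, h2⟩ := mem_iUnion₂.1 hz
    exact ⟨z', hz', h1, h2⟩
  have hKm : ∀ x ∈ cthickening (τ / 4) K, ∃ y ∈ K, dist x y < τ / 2 := fun x hx =>
    mem_thickening_iff.1 (cthickening_subset_thickening' (by positivity) (by linarith) K hx)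
  have hτd' : τ ≤ d := min_le_right _ _
  have hfar : ∀ z ∈ V, ∀ x ∈ cthickening (τ / 4) K, d < ‖x - polyMap f z‖ := by
    intro z hz x hx
    obtain ⟨z', hz', -, h2⟩ := hVm z hz
    obtain ⟨y, hy, hxy⟩ := hKm x hx
    rw [← dist_eq_norm]
    have h3 := hdK z' hz' y hy
    have h4 := dist_triangle4 y x (polyMap f z) (polyMap f z')
    rw [dist_comm y x] at h4
    linarith
  obtain ⟨R₁, hR₁⟩ := hL.isBounded.exists_norm_le
  obtain ⟨R₂, hR₂⟩ := (hL.image hfc).isBounded.exists_norm_le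
  obtain ⟨R₃, hR₃⟩ := hK.isBounded.exists_norm_le
  set R := max R₁ (max R₂ R₃) + τ with hR
  have hR1 : R₁ ≤ max R₁ (max R₂ R₃) := le_max_left _ _
  have hR2 : R₂ ≤ max R₁ (max R₂ R₃) := (le_max_left _ _).trans (le_max_right _ _)
  have hR3 : R₃ ≤ max R₁ (max R₂ R₃) := (le_max_right _ _).trans (le_max_right _ _)
  have hvn : ∀ (z z' : σ → ℂ) (v : ι → ℂ), dist (polyMap f z) (polyMap f z') < τ / 4 →
      ‖v‖ ≤ τ / 4 → dist (polyMap f z + v) (polyMap f z') < τ := by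
    intro z z' v h1 h2
    have h3 := dist_triangle (polyMap f z + v) (polyMap f z) (polyMap f z')
    rw [dist_self_add_left] at h3
    linarith
  refine ⟨V, τ / 4, τ / 4, R, ?_, ?_, by positivity, by positivity, ?_, ?_, ?_, ?_, ?_⟩
  · exact isOpen_biUnion fun z' _ => isOpen_ball.inter (isOpen_ball.preimage hfc)
  · exact fun z hz => mem_iUnion₂.2 ⟨z, hz, mem_ball_self hτ, mem_ball_self (by positivity)⟩
  · intro z hz
    obtain ⟨z', hz', h1, -⟩ := hVm z hz
    have := hR₁ z' hz'
    rw [dist_eq_norm] at h1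
    have := norm_sub_norm_le z z'
    linarith
  · intro z hz v hv
    obtain ⟨z', hz', -, h2⟩ := hVm z hz
    have h3 := hvn z z' v h2 hv
    have := hR₂ _ (mem_image_of_mem _ hz')
    rw [dist_eq_norm] at h3
    have := norm_sub_norm_le (polyMap f z + v) (polyMap f z')
    linarith
  · intro x hx
    obtain ⟨y, hy, hxy⟩ := hKm x hx
    have := hR₃ y hy
    rw [dist_eq_norm] at hxy
    have := norm_sub_norm_le x y
    linarith
  · intro z hz v hv hmem
    have := hfar z hz _ hmem
    rw [add_sub_cancel_left] at this
    linarith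
  · intro ε hε
    choose P hP using fun i => hW i ε hε
    refine ⟨P, fun z hz v hv => ?_, fun z hz x hx => ?_⟩
    · obtain ⟨z', hz', h1, h2⟩ := hVm z hz
      refine (pi_norm_le_iff_of_nonneg hε.le).2 fun i => ?_
      have h3 := hP i _ (hSel z _ ⟨z', hz', h1, Or.inr (hvn z z' v h2 hv)⟩ i)
      have h4 : g (Sum.elim z (polyMap f z + v)) = v := by simp [hg]
      have h5 : ‖v‖ < d := by linarith
      simp only [hh, h4, h5, if_true] at h3
      rw [norm_sub_rev] at h3
      exact h3
    · obtain ⟨z', hz', h1, h2⟩ := hVm z hz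
      obtain ⟨y, hy, hxy⟩ := hKm x hx
      refine (pi_norm_le_iff_of_nonneg hε.le).2 fun i => ?_
      have h3 := hP i _ (hSel z _ ⟨z', hz', h1, Or.inl ⟨y, hy, by linarith⟩⟩ i)
      have h4 : g (Sum.elim z x) = x - polyMap f z := by simp [hg]
      have h5 := hfar z hz x hx
      simp only [hh, h4, h5.not_gt, if_false] at h3
      rw [Pi.zero_apply, zero_sub, norm_neg] at h3
      exact h3

end Field

section Family
variable {σ ι : Type*} [Fintype σ] [Fintype ι]

theorem exists_fatou_bieberbach_polyMap [DecidableEq σ] [DecidableEq ι] [Nontrivial ι]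
    {L : Set (σ → ℂ)} (hL : IsCompact L) (hLp : IsPolySeparated L) {K : Set (ι → ℂ)}
    (hK : IsCompact K) (hKp : IsPolySeparated K) (f : ι → MvPolynomial σ ℂ)
    (hfK : ∀ z ∈ L, polyMap f z ∉ K) :
    ∃ V, IsOpen V ∧ L ⊆ V ∧ ∃ F : (σ → ℂ) → (ι → ℂ) → ι → ℂ,
      DifferentiableOn ℂ (fun p : (σ → ℂ) × (ι → ℂ) => F p.1 p.2) (V ×ˢ univ) ∧
      (∀ z ∈ V, F z 0 = polyMap f z) ∧ (∀ z ∈ V, Function.Injective (F z)) ∧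
      ∀ z ∈ V, ∀ w, F z w ∉ K := by
  obtain ⟨V, δ, r, R, hV, hLV, hδ, hr, hVR, hfR, hKR, hsep, hP⟩ :=
    exists_polynomial_fields hL hLp hK hKp f hfK
  refine ⟨V, hV, hLV, exists_fatou_bieberbach_of_steps hV
    (differentiable_polyMap f).differentiableOn
    hδ hr (show 0 < r / 4 by positivity) hsep fun ε hε => ?_⟩
  obtain ⟨ε₀, hε₀, h12, h24⟩ : ∃ ε₀ > 0, 12 * ε₀ ≤ ε ∧ 24 * ε₀ ≤ r :=
    ⟨min (ε / 12) (r / 24), by positivity, by linarith [min_le_left (ε / 12) (r / 24)],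
      by linarith [min_le_right (ε / 12) (r / 24)]⟩
  obtain ⟨P, hPf, hPK⟩ := hP (ε₀ / 2) (by positivity)
  obtain ⟨Y, hY, hPY⟩ := isApproxGenerator_polynomial P R (ε₀ / 2) (by positivity)
  obtain ⟨Ψ, Φ, μ, hμ2, hμ3, hΨd, hinv, hnear, hfar⟩ := hY.exists_step hr hε₀ h24 hVR hfR hKR
    (fun z hz v hv => by
      have h1 := hPf z hz v hv
      have h2 := hPY z _ (hVR z hz) (hfR z hz v hv)
      rw [norm_sub_rev] at h2
      have h3 := norm_add_le_of_le h2 h1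
      rw [add_halves] at h3
      refine le_trans (le_of_eq ?_) h3
      congr 1
      exact (sub_add_sub_cancel _ _ _).symm)
    (fun z hz x hx => by
      have h1 := hPK z hz x hx
      have h2 := hPY z _ (hVR z hz) (hKR x hx)
      rw [norm_sub_rev] at h2
      have h3 := norm_add_le_of_le h2 h1
      rw [add_halves] at h3
      refine le_trans (le_of_eq ?_) h3
      congr 1
      exact (sub_add_cancel _ _).symm)
  set s : (σ → ℂ) → ι → ℂ := fun z => polyMap f z - Ψ z (polyMap f z) with hs
  have hsd : Differentiable ℂ s := (differentiable_polyMap f).sub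
    (hΨd.comp (differentiable_id.prodMk (differentiable_polyMap f)))
  have hsn : ∀ z ∈ V, ‖s z‖ ≤ 6 * ε₀ := fun z hz => by
    have := hnear z hz 0 (by rw [norm_zero]; positivity)
    rw [smul_zero, sub_zero, add_zero, norm_sub_rev] at this
    exact this
  refine ⟨fun z w => Ψ z w + s z, fun z x => Φ z (x - s z), μ, hμ2, hμ3,
    (hΨd.add (hsd.comp differentiable_fst)).differentiableOn, fun z _ w => ?_, fun z _ => ?_,
    fun z hz v hv => ?_, fun z hz x hx => ?_⟩
  · simp only [add_sub_cancel_right]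
    exact hinv z w
  · simp [hs]
  · have h1 := norm_add_le_of_le (hnear z hz v hv) (hsn z hz)
    refine le_trans (le_of_eq ?_) (h1.trans (by linarith))
    rw [sub_add_eq_add_sub, sub_add_eq_add_sub]
  · have h1 : closedBall (x - s z) (2 * ε₀) ⊆ cthickening δ K := by
      refine (closedBall_subset_closedBall' ?_).trans hx
      rw [dist_eq_norm, sub_sub_cancel_left, norm_neg]
      linarith [hsn z hz]
    have h2 := norm_sub_le_of_le (hfar z hz _ h1) (hsn z hz)
    refine le_trans (le_of_eq ?_) (h2.trans (by linarith))
    congr 1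
    abel

theorem IsPolySeparated.of_lt {K : Set (ι → ℂ)}
    (h : ∀ z ∉ K, ∃ (P : MvPolynomial ι ℂ) (c : ℝ), (∀ w ∈ K, ‖MvPolynomial.eval w P‖ ≤ c) ∧
      c < ‖MvPolynomial.eval z P‖) : IsPolySeparated K := by
  intro z hz
  rcases K.eq_empty_or_nonempty with rfl | ⟨w₀, hw₀⟩
  · exact ⟨MvPolynomial.C 3, by simp, by norm_num⟩
  obtain ⟨P, c, hc, hcz⟩ := h z hz
  have hc0 : 0 ≤ c := (norm_nonneg _).trans (hc w₀ hw₀)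
  set b := (c + ‖MvPolynomial.eval z P‖) / 2 with hb
  have hcb : c < b := by rw [hb]; linarith
  have hbz : b < ‖MvPolynomial.eval z P‖ := by rw [hb]; linarith
  have hb0 : 0 < b := hc0.trans_lt hcb
  obtain ⟨M, hM⟩ := pow_unbounded_of_one_lt 2 ((one_lt_div hb0).2 hbz)
  have he : ∀ x, ‖MvPolynomial.eval x ((MvPolynomial.C ((b : ℂ)⁻¹) * P) ^ (M + 1))‖ =
      (‖MvPolynomial.eval x P‖ / b) ^ (M + 1) := fun x => by
    rw [map_pow, map_mul, MvPolynomial.eval_C, norm_pow, norm_mul, norm_inv, Complex.norm_real,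
      Real.norm_of_nonneg hb0.le, div_eq_inv_mul]
  refine ⟨(MvPolynomial.C ((b : ℂ)⁻¹) * P) ^ (M + 1), fun w hw => ?_, ?_⟩
  · rw [he]
    exact pow_lt_one₀ (by positivity) ((div_lt_one hb0).2 ((hc w hw).trans_lt hcb)) M.succ_ne_zero
  · rw [he]
    exact hM.trans_le (pow_le_pow_right₀ ((one_le_div hb0).2 hbz.le) M.le_succ)

theorem isPolySeparated_polynomialPolyhedron (T : Finset (MvPolynomial ι ℂ)) {R : ℝ} :
    IsPolySeparated {w : ι → ℂ | (∀ i, ‖w i‖ ≤ R) ∧ ∀ P ∈ T, ‖MvPolynomial.eval w P‖ ≤ 1} := by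
  refine .of_lt fun z hz => ?_
  by_cases h : ∀ i, ‖z i‖ ≤ R
  · have : ¬ ∀ P ∈ T, ‖MvPolynomial.eval z P‖ ≤ 1 := fun h' => hz ⟨h, h'⟩
    push Not at this
    obtain ⟨P, hP, hPz⟩ := this
    exact ⟨P, 1, fun w hw => hw.2 P hP, hPz⟩
  · push Not at h
    obtain ⟨i, hi⟩ := h
    exact ⟨MvPolynomial.X i, R, fun w hw => by simpa using hw.1 i, by simpa using hi⟩

/-- A polynomially separated compact set has a polynomially separated compact neighbourhood
disjoint from a given compact set. -/
theorem IsPolySeparated.exists_cthickening_subset [DecidableEq ι] {K C : Set (ι → ℂ)}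
    (hKp : IsPolySeparated K)
    (hK : IsCompact K) (hC : IsCompact C) (hd : ∀ z ∈ C, z ∉ K) :
    ∃ K₁, IsCompact K₁ ∧ IsPolySeparated K₁ ∧ Disjoint K₁ C ∧ ∃ δ > 0, cthickening δ K ⊆ K₁ := by
  obtain ⟨T, hT1, hT2⟩ := hKp.exists_finset hC hd
  obtain ⟨R, hR⟩ := hK.isBounded.subset_ball 0
  have hcont : ∀ P : MvPolynomial ι ℂ, Continuous fun w : ι → ℂ => ‖MvPolynomial.eval w P‖ :=
    fun P => (differentiable_mvPolynomial_eval P).continuous.norm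
  set O : Set (ι → ℂ) := ball 0 R ∩ ⋂ P ∈ T, {w | ‖MvPolynomial.eval w P‖ < 1} with hO
  have hOo : IsOpen O := isOpen_ball.inter
    (isOpen_biInter_finset fun P _ => isOpen_lt (hcont P) continuous_const)
  have hKO : K ⊆ O := fun w hw => ⟨hR hw, mem_iInter₂.2 fun P hP => hT1 P hP w hw⟩
  obtain ⟨δ, hδ, hδO⟩ := hK.exists_cthickening_subset_open hOo hKO
  refine ⟨{w | (∀ i, ‖w i‖ ≤ R) ∧ ∀ P ∈ T, ‖MvPolynomial.eval w P‖ ≤ 1}, ?_,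
    isPolySeparated_polynomialPolyhedron T, ?_, δ, hδ, hδO.trans fun w hw => ⟨fun i => ?_, ?_⟩⟩
  · refine (isCompact_univ_pi fun i : ι => isCompact_closedBall (0 : ℂ) R).of_isClosed_subset
      ?_ fun w hw i _ => by simpa using hw.1 i
    simp only [ofPred_and, ofPred_forall]
    exact (isClosed_iInter fun i => isClosed_le (by fun_prop) continuous_const).inter
      (isClosed_biInter fun P _ => isClosed_le (hcont P) continuous_const)
  · rw [Set.disjoint_left]
    intro z hz hzC
    obtain ⟨P, hP, hPz⟩ := hT2 z hzC
    linarith [hz.2 P hP]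
  · exact (norm_le_pi_norm w i).trans (mem_ball_zero_iff.1 hw.1).le
  · exact fun P hP => (mem_iInter₂.1 hw.2 P hP).le

theorem exists_fatou_bieberbach_pi [DecidableEq σ] [DecidableEq ι] [Nontrivial ι]
    {L U : Set (σ → ℂ)} (hL : IsCompact L) (hLp : IsPolySeparated L) {K : Set (ι → ℂ)}
    (hK : IsCompact K) (hKp : IsPolySeparated K) (hU : IsOpen U) (hLU : L ⊆ U)
    {f : (σ → ℂ) → ι → ℂ} (hf : DifferentiableOn ℂ f U) (hfK : ∀ z ∈ L, f z ∉ K) :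
    ∃ V, IsOpen V ∧ L ⊆ V ∧ V ⊆ U ∧ ∃ F : (σ → ℂ) → (ι → ℂ) → ι → ℂ,
      DifferentiableOn ℂ (fun p : (σ → ℂ) × (ι → ℂ) => F p.1 p.2) (V ×ˢ univ) ∧
      (∀ z ∈ V, F z 0 = f z) ∧ (∀ z ∈ V, Function.Injective (F z)) ∧
      ∀ z ∈ V, ∀ w, F z w ∉ K := by
  have hfL : IsCompact (f '' L) := hL.image_of_continuousOn (hf.continuousOn.mono hLU)
  obtain ⟨K₁, hK₁, hK₁p, hdisj, δ, hδ, hδK⟩ := hKp.exists_cthickening_subset hK hfL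
    (by rintro _ ⟨z, hz, rfl⟩; exact hfK z hz)
  obtain ⟨η, hη, hηK⟩ := hfL.exists_cthickening_subset_open hK₁.isClosed.isOpen_compl
    hdisj.symm.subset_compl_right
  choose W hWo hLW hWU hW using fun i => oka_weil hL hLp hU hLU (differentiableOn_pi.1 hf i)
  choose P hP using fun i => hW i (min δ η) (by positivity)
  have hfP : ∀ z ∈ ⋂ i, W i, ‖f z - polyMap P z‖ ≤ min δ η := fun z hz =>
    (pi_norm_le_iff_of_nonneg (by positivity)).2 fun i => hP i z (mem_iInter.1 hz i)
  have hLW' : L ⊆ ⋂ i, W i := subset_iInter hLW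
  obtain ⟨V, hV, hLV, F, hFd, hF0, hFi, hFK⟩ := exists_fatou_bieberbach_polyMap hL hLp hK₁ hK₁p P
    fun z hz => hηK <| mem_cthickening_of_dist_le _ (f z) _ _ (mem_image_of_mem f hz) <| by
      rw [dist_eq_norm, norm_sub_rev]
      exact (hfP z (hLW' hz)).trans (min_le_right _ _)
  refine ⟨V ∩ (U ∩ ⋂ i, W i), hV.inter (hU.inter (isOpen_iInter_of_finite hWo)),
    subset_inter hLV (subset_inter hLU hLW'), fun z hz => hz.2.1,
    fun z w => F z w + (f z - polyMap P z), ?_, fun z hz => ?_, fun z hz x y hxy => ?_,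
    fun z hz w hw => ?_⟩
  · exact (hFd.mono (prod_mono_left inter_subset_left)).add
      ((hf.sub (differentiable_polyMap P).differentiableOn).comp
        differentiable_fst.differentiableOn fun p hp => hp.1.2.1)
  · simp only [hF0 z hz.1, add_sub_cancel]
  · exact hFi z hz.1 (add_right_cancel hxy)
  · refine hFK z hz.1 w (hδK (mem_cthickening_of_dist_le _ _ _ _ hw ?_))
    rw [dist_eq_norm, sub_add_cancel_left, norm_neg]
    exact (hfP z hz.2.2).trans (min_le_left _ _)

end Family

theorem IsPolynomiallyConvex.isPolySeparated {n : ℕ} {K : Set (EuclideanSpace ℂ (Fin n))}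
    (h : IsPolynomiallyConvex K) : IsPolySeparated (EuclideanSpace.equiv (Fin n) ℂ '' K) := by
  refine .of_lt fun z hz => ?_
  have h1 : (EuclideanSpace.equiv (Fin n) ℂ).symm z ∉ polyHull K := by
    rw [show polyHull K = K from h]
    exact fun h2 => hz ⟨_, h2, ContinuousLinearEquiv.apply_symm_apply _ z⟩
  simp only [polyHull, mem_ofPred_eq, not_forall, not_le] at h1
  obtain ⟨p, c, hc, hcz⟩ := h1
  exact ⟨p, c, by rintro _ ⟨w, hw, rfl⟩; exact hc w hw, hcz⟩


end Auxiliary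

/-- Forstnerič–Wold: holomorphically varying families of Fatou–Bieberbach maps into ℂⁿ \ K.
Given compact polynomially convex sets K ⊆ ℂⁿ (n ≥ 2) and L ⊆ ℂᴺ and a holomorphic map f on
a neighbourhood U of L with f(L) ⊆ ℂⁿ \ K, there are a neighbourhood V of L and a holomorphic
map F : V × ℂⁿ → ℂⁿ with F(z,0) = f(z) such that each F(z,·) is injective with image in
ℂⁿ \ K. -/
theorem holomorphic_family_of_fatou_bieberbach_maps (n N : ℕ) (hn : 2 ≤ n) (hN : 1 ≤ N)
    (K : Set (EuclideanSpace ℂ (Fin n))) (hK : IsCompact K) (hKpc : IsPolynomiallyConvex K)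
    (L : Set (EuclideanSpace ℂ (Fin N))) (hL : IsCompact L) (hLpc : IsPolynomiallyConvex L)
    (U : Set (EuclideanSpace ℂ (Fin N))) (hUopen : IsOpen U) (hLU : L ⊆ U)
    (f : EuclideanSpace ℂ (Fin N) → EuclideanSpace ℂ (Fin n))
    (hf : DifferentiableOn ℂ f U)
    (hfK : ∀ z ∈ L, f z ∉ K) :
    ∃ V : Set (EuclideanSpace ℂ (Fin N)), IsOpen V ∧ L ⊆ V ∧ V ⊆ U ∧
      ∃ F : EuclideanSpace ℂ (Fin N) → EuclideanSpace ℂ (Fin n) → EuclideanSpace ℂ (Fin n),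
        DifferentiableOn ℂ
          (fun p : EuclideanSpace ℂ (Fin N) × EuclideanSpace ℂ (Fin n) => F p.1 p.2)
          (V ×ˢ (Set.univ : Set (EuclideanSpace ℂ (Fin n)))) ∧
        (∀ z ∈ V, F z 0 = f z) ∧
        (∀ z ∈ V, Function.Injective (F z)) ∧
        (∀ z ∈ V, ∀ w, F z w ∉ K) := by
  have : Nontrivial (Fin n) := Fin.nontrivial_iff_two_le.2 hn
  set e := EuclideanSpace.equiv (Fin n) ℂ
  set e' := EuclideanSpace.equiv (Fin N) ℂ
  obtain ⟨V, hV, hLV, hVU, F, hFd, hF0, hFi, hFK⟩ :=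
    exists_fatou_bieberbach_pi (L := e' '' L) (U := e'.symm ⁻¹' U) (K := e '' K)
      (f := fun z => e (f (e'.symm z))) (hL.image e'.continuous) hLpc.isPolySeparated
      (hK.image e.continuous) hKpc.isPolySeparated (hUopen.preimage e'.symm.continuous)
      (by
        rintro _ ⟨z, hz, rfl⟩
        simpa using hLU hz)
      (e.differentiable.comp_differentiableOn
        (hf.comp e'.symm.differentiable.differentiableOn fun z hz => hz))
      (by
        rintro _ ⟨z, hz, rfl⟩
        simpa using hfK z hz)
  refine ⟨e' ⁻¹' V, hV.preimage e'.continuous, fun z hz => hLV (Set.mem_image_of_mem e' hz),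
    fun z hz => by simpa using hVU hz, fun z w => e.symm (F (e' z) (e w)), ?_, fun z hz => ?_,
    fun z hz => ?_, fun z hz w hw => hFK _ hz (e w) ⟨_, hw, e.apply_symm_apply _⟩⟩
  · exact e.symm.differentiable.comp_differentiableOn <| hFd.comp
      (((e'.differentiable.comp differentiable_fst).prodMk
        (e.differentiable.comp differentiable_snd)).differentiableOn) fun p hp => ⟨hp.1, trivial⟩
  · simp [hF0 _ hz]
  · exact e.symm.injective.comp ((hFi _ hz).comp e.injective)
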